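/- Fix a number field k and quadratic extensions L_1, \dots, L_r of k whose compositum L satisfies [L : k] = 2^r. Call a finite prime of k nonsplit if it does not split in any of the L_i. Then, as y \to \infty, \sum (-1)^{\omega(I)} = o\big( \#\{I\} \big), where both the sum and the count range over squarefree nonzero ideals I of O_k with absolute norm N(I) \le y all of whose prime divisors are nonsplit finite primes, and \omega(I) denotes the number of distinct prime divisors of I. -/

import Mathlib

open NumberField Filter Topology Asymptotics

noncomputable section

variable (k : Type*) [Field k] [NumberField k]

/-- A finite prime `p` of `k` splits in `L` if `p O_L` is a product of two distinct
primes of `L`. -/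
def SplitsIn (p : Ideal (𝓞 k)) (L : IntermediateField k (AlgebraicClosure k)) : Prop :=
  ∃ P Q : Ideal (𝓞 L), P ≠ Q ∧ P.IsPrime ∧ Q.IsPrime ∧
    Ideal.map (algebraMap (𝓞 k) (𝓞 L)) p = P * Q

/-- `ω(I)`: the number of distinct prime divisors of the ideal `I`. -/
def omegaI (I : Ideal (𝓞 k)) : ℕ :=
  Nat.card {P : Ideal (𝓞 k) // P.IsPrime ∧ P ∣ I}

section FejerKernel

open MeasureTheory

/-- The triangle function supported on `[-1, 1]`. -/
def triangleFun (y : ℝ) : ℝ := max 0 (1 - |y|)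

/-- The Fejér kernel on the real line. -/
def fejerKernel (u : ℝ) : ℝ := (1 - Real.cos u) / (Real.pi * u ^ 2)

lemma continuous_triangleFun : Continuous triangleFun := by
  unfold triangleFun; fun_prop

lemma triangleFun_nonneg (y : ℝ) : 0 ≤ triangleFun y := le_max_left _ _

lemma triangleFun_eq_zero {y : ℝ} (hy : 1 ≤ |y|) : triangleFun y = 0 := by
  unfold triangleFun
  exact max_eq_left (by linarith)

lemma hasCompactSupport_triangleFun : HasCompactSupport triangleFun := by
  refine HasCompactSupport.intro (K := Set.Icc (-1) 1) isCompact_Icc fun x hx => ?_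
  apply triangleFun_eq_zero
  by_contra! h
  exact hx ⟨by linarith [(abs_lt.mp h).1], by linarith [(abs_lt.mp h).2]⟩

lemma integrable_triangleFun : Integrable triangleFun :=
  continuous_triangleFun.integrable_of_hasCompactSupport hasCompactSupport_triangleFun

lemma fejerKernel_nonneg (u : ℝ) : 0 ≤ fejerKernel u := by
  unfold fejerKernel
  have := Real.cos_le_one u
  have := Real.pi_pos
  apply div_nonneg <;> nlinarith [sq_nonneg u]

lemma fejerKernel_le (u : ℝ) : fejerKernel u ≤ (1 + u ^ 2)⁻¹ := by
  rcases eq_or_ne u 0 with rfl | hu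
  · simp [fejerKernel]
  have h1 := Real.one_sub_sq_div_two_le_cos (x := u)
  have h2 := Real.neg_one_le_cos u
  have h3 := Real.pi_gt_three
  have hu2 : 0 < u ^ 2 := by positivity
  unfold fejerKernel
  rw [div_le_iff₀ (by positivity), inv_mul_eq_div, le_div_iff₀ (by positivity)]
  nlinarith

lemma measurable_fejerKernel : Measurable fejerKernel := by
  unfold fejerKernel; fun_prop

lemma integrable_fejerKernel : Integrable fejerKernel := by
  refine integrable_inv_one_add_sq.mono' measurable_fejerKernel.aestronglyMeasurable ?_
  refine Eventually.of_forall fun u => ?_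
  rw [Real.norm_of_nonneg (fejerKernel_nonneg u)]
  exact fejerKernel_le u

lemma integral_one_sub_mul_cos {u : ℝ} (hu : u ≠ 0) :
    ∫ y in (0 : ℝ)..1, (1 - y) * Real.cos (u * y) = (1 - Real.cos u) / u ^ 2 := by
  have h : ∀ y ∈ Set.uIcc (0 : ℝ) 1, HasDerivAt
      (fun y => (1 - y) * Real.sin (u * y) / u - Real.cos (u * y) / u ^ 2)
      ((1 - y) * Real.cos (u * y)) y := by
    intro y _
    have h0 : HasDerivAt (fun y : ℝ => u * y) u y := by
      simpa using (hasDerivAt_id y).const_mul u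
    have h1 := ((hasDerivAt_id y).const_sub 1).mul h0.sin
    have h2 := (h1.div_const u).sub (h0.cos.div_const (u ^ 2))
    refine h2.congr_deriv ?_
    simp only [id]
    field_simp
    ring
  rw [intervalIntegral.integral_eq_sub_of_hasDerivAt h
    (by apply Continuous.intervalIntegrable; fun_prop)]
  simp
  ring

lemma integral_triangleFun_mul_cos {u : ℝ} (hu : u ≠ 0) :
    ∫ y, triangleFun y * Real.cos (u * y) = 2 * Real.pi * fejerKernel u := by
  have heven : ∫ y, triangleFun y * Real.cos (u * y)
      = ∫ y, (fun z => triangleFun z * Real.cos (u * z)) |y| := by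
    refine integral_congr_ae (Eventually.of_forall fun y => ?_)
    rcases abs_cases y with ⟨h, _⟩ | ⟨h, _⟩ <;> simp [triangleFun, h]
  rw [heven, integral_comp_abs (f := fun z => triangleFun z * Real.cos (u * z))]
  have h2 : ∫ y in Set.Ioi (0 : ℝ), triangleFun y * Real.cos (u * y)
      = ∫ y in Set.Ioc (0 : ℝ) 1, (1 - y) * Real.cos (u * y) := by
    rw [← Set.Ioc_union_Ioi_eq_Ioi (zero_le_one' ℝ),
      setIntegral_union (Set.Ioc_disjoint_Ioi le_rfl) measurableSet_Ioi
        (by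
          apply Continuous.integrableOn_Ioc
          exact continuous_triangleFun.mul (by fun_prop))
        (by
          refine (integrableOn_zero).congr_fun (fun y hy => ?_) measurableSet_Ioi
          rw [triangleFun_eq_zero (by rw [abs_of_pos (zero_lt_one.trans hy)]; exact hy.le)]; simp)]
    rw [setIntegral_eq_zero_of_forall_eq_zero (t := Set.Ioi 1), add_zero]
    · refine setIntegral_congr_fun measurableSet_Ioc fun y hy => ?_
      simp only [triangleFun, abs_of_pos hy.1]
      rw [max_eq_right (by linarith [hy.2])]
    · intro y hy
      rw [triangleFun_eq_zero (by rw [abs_of_pos (zero_lt_one.trans hy)]; exact hy.le), zero_mul]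
  rw [h2, ← intervalIntegral.integral_of_le zero_le_one, integral_one_sub_mul_cos hu]
  unfold fejerKernel
  field_simp

lemma integral_triangleFun_mul_cexp {u : ℝ} (hu : u ≠ 0) :
    ∫ y : ℝ, (triangleFun y : ℂ) * Complex.exp (u * y * Complex.I)
      = (2 * Real.pi * fejerKernel u : ℝ) := by
  rw [← integral_triangleFun_mul_cos hu]
  have hintg : Integrable (fun y : ℝ => (triangleFun y : ℂ) * Complex.exp (u * y * Complex.I)) := by
    apply Continuous.integrable_of_hasCompactSupport
    · exact (Complex.continuous_ofReal.comp continuous_triangleFun).mul (by fun_prop)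
    · exact HasCompactSupport.mul_right
        (hasCompactSupport_triangleFun.comp_left (g := ((↑) : ℝ → ℂ)) rfl)
  have hre : ∀ y : ℝ, ((triangleFun y : ℂ) * Complex.exp (u * y * Complex.I)).re
      = triangleFun y * Real.cos (u * y) := by
    intro y
    rw [Complex.re_ofReal_mul, ← Complex.ofReal_mul, Complex.exp_ofReal_mul_I_re]
  have him : ∀ y : ℝ, ((triangleFun y : ℂ) * Complex.exp (u * y * Complex.I)).im
      = triangleFun y * Real.sin (u * y) := by
    intro y
    rw [Complex.im_ofReal_mul, ← Complex.ofReal_mul, Complex.exp_ofReal_mul_I_im]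
  apply Complex.ext
  · rw [Complex.ofReal_re, ← RCLike.re_eq_complex_re, ← integral_re hintg]
    exact integral_congr_ae (Eventually.of_forall hre)
  · rw [Complex.ofReal_im, ← RCLike.im_eq_complex_im, ← integral_im hintg]
    have h1 : ∫ y, RCLike.im ((triangleFun y : ℂ) * Complex.exp (u * y * Complex.I))
        = ∫ y, triangleFun y * Real.sin (u * y) :=
      integral_congr_ae (Eventually.of_forall him)
    have h2 : ∫ y, triangleFun y * Real.sin (u * y) = - ∫ y, triangleFun y * Real.sin (u * y) := by
      conv_lhs => rw [← integral_neg_eq_self]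
      rw [← integral_neg]
      refine integral_congr_ae (Eventually.of_forall fun y => ?_)
      simp [triangleFun]
    rw [h1]; linarith

open FourierTransform in
lemma integral_fejerKernel : ∫ u, fejerKernel u = 1 := by
  set f : ℝ → ℂ := fun y => (triangleFun y : ℂ) with hf
  have hF : ∀ w : ℝ, w ≠ 0 → 𝓕 f w = (2 * Real.pi * fejerKernel (2 * Real.pi * w) : ℝ) := by
    intro w hw
    have hw' : -2 * Real.pi * w ≠ 0 := by
      have := Real.pi_pos.ne'
      simp [hw]
    rw [Real.fourier_real_eq_integral_exp_smul]
    have := integral_triangleFun_mul_cexp hw'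
    have he : fejerKernel (-2 * Real.pi * w) = fejerKernel (2 * Real.pi * w) := by
      unfold fejerKernel
      rw [show -2 * Real.pi * w = -(2 * Real.pi * w) by ring, Real.cos_neg, neg_sq]
    rw [he] at this
    rw [← this]
    refine integral_congr_ae (Eventually.of_forall fun y => ?_)
    simp only [smul_eq_mul, hf]
    rw [mul_comm]
    congr 2
    push_cast
    ring
  have hae : 𝓕 f =ᵐ[volume] fun w : ℝ => ((2 * Real.pi * fejerKernel (2 * Real.pi * w) : ℝ) : ℂ) := by
    have : ∀ᵐ w : ℝ, w ≠ 0 := by simp [ae_iff]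
    filter_upwards [this] with w hw using hF w hw
  have h2pi : (2 * Real.pi) ≠ 0 := by positivity
  have hFint : Integrable (𝓕 f) := by
    refine Integrable.congr ?_ hae.symm
    exact ((integrable_fejerKernel.comp_mul_left' h2pi).const_mul (2 * Real.pi)).ofReal
  have hfint : Integrable f := integrable_triangleFun.ofReal
  have hfc : Continuous f := Complex.continuous_ofReal.comp continuous_triangleFun
  have hinv := hfint.fourierInv_fourier_eq hFint (v := 0) hfc.continuousAt
  rw [Real.fourierInv_eq'] at hinv
  simp only [inner_zero_right, mul_zero, Complex.ofReal_zero, zero_mul, Complex.exp_zero,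
    one_smul] at hinv
  rw [integral_congr_ae hae, integral_complex_ofReal] at hinv
  have h1 : f 0 = 1 := by simp [hf, triangleFun]
  rw [h1] at hinv
  have h3 : ∫ w, 2 * Real.pi * fejerKernel (2 * Real.pi * w) = 1 := by exact_mod_cast hinv
  rw [integral_const_mul, Measure.integral_comp_mul_left (fun u => fejerKernel u),
    smul_eq_mul, abs_of_pos (by positivity), ← mul_assoc, mul_inv_cancel₀ h2pi, one_mul] at h3
  exact h3

end FejerKernel

section WienerIkehara

open MeasureTheory

lemma integral_fejerKernel_scaled {l : ℝ} (hl : 0 < l) : ∫ u, l * fejerKernel (l * u) = 1 := by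
  rw [integral_const_mul, Measure.integral_comp_mul_left (fun u => fejerKernel u),
    integral_fejerKernel, smul_eq_mul, mul_one, abs_of_pos (by positivity),
    mul_inv_cancel₀ hl.ne']

lemma integrable_fejerKernel_scaled {l : ℝ} (hl : 0 < l) :
    Integrable (fun u => l * fejerKernel (l * u)) :=
  (integrable_fejerKernel.comp_mul_left' hl.ne').const_mul l

lemma fejerKernel_le_one (u : ℝ) : fejerKernel u ≤ 1 :=
  (fejerKernel_le u).trans (inv_le_one_of_one_le₀ (by nlinarith [sq_nonneg u]))

lemma fejerKernel_scaled_eq (l : ℝ) {u : ℝ} (hu : l * u ≠ 0) :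
    ((l * fejerKernel (l * u) : ℝ) : ℂ) = (l / (2 * Real.pi) : ℝ) *
      ∫ y : ℝ, (triangleFun y : ℂ) * Complex.exp ((l * u : ℝ) * y * Complex.I) := by
  rw [integral_triangleFun_mul_cexp hu, ← Complex.ofReal_mul]
  congr 1
  have := Real.pi_pos.ne'
  field_simp

lemma integral_mul_fejerKernel {g : ℝ → ℝ} (hg : Integrable g) {l : ℝ} (hl : 0 < l) (x : ℝ) :
    ((∫ t, g t * (l * fejerKernel (l * (t - x))) : ℝ) : ℂ) = (l / (2 * Real.pi) : ℝ) *
      ∫ y : ℝ, (triangleFun y : ℂ) * (Complex.exp (-(l * x * y : ℝ) * Complex.I) *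
        ∫ t, (g t : ℂ) * Complex.exp ((l * y * t : ℝ) * Complex.I)) := by
  have h1 : ((∫ t, g t * (l * fejerKernel (l * (t - x))) : ℝ) : ℂ) =
      ∫ t, (g t : ℂ) * ((l / (2 * Real.pi) : ℝ) * ∫ y : ℝ, (triangleFun y : ℂ) *
        Complex.exp ((l * (t - x) : ℝ) * y * Complex.I)) := by
    rw [← integral_complex_ofReal]
    have : ∀ᵐ t : ℝ, t ≠ x := by simp [ae_iff]
    refine integral_congr_ae ?_
    filter_upwards [this] with t ht
    have hne : l * (t - x) ≠ 0 := mul_ne_zero hl.ne' (sub_ne_zero.mpr ht)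
    rw [Complex.ofReal_mul, fejerKernel_scaled_eq l hne]
  rw [h1]
  have h2 : ∀ t : ℝ, (g t : ℂ) * ((l / (2 * Real.pi) : ℝ) * ∫ y : ℝ, (triangleFun y : ℂ) *
        Complex.exp ((l * (t - x) : ℝ) * y * Complex.I)) = (l / (2 * Real.pi) : ℝ) *
        ∫ y : ℝ, (g t : ℂ) * ((triangleFun y : ℂ) *
        Complex.exp ((l * (t - x) : ℝ) * y * Complex.I)) := by
    intro t
    rw [integral_const_mul]; ring
  simp_rw [h2]
  rw [integral_const_mul, integral_integral_swap]
  · congr 1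
    refine integral_congr_ae (Eventually.of_forall fun y => ?_)
    simp only
    rw [← integral_const_mul, ← integral_const_mul]
    refine integral_congr_ae (Eventually.of_forall fun t => ?_)
    simp only
    have : Complex.exp ((l * (t - x) : ℝ) * y * Complex.I)
        = Complex.exp (-(l * x * y : ℝ) * Complex.I) * Complex.exp ((l * y * t : ℝ) * Complex.I) := by
      rw [← Complex.exp_add]; congr 1; push_cast; ring
    rw [this]; ring
  · have h3 := hg.ofReal (𝕜 := ℂ) |>.mul_prod (integrable_triangleFun.ofReal (𝕜 := ℂ))
    have h4 := h3.mul_bdd (c := 1) (g := fun p : ℝ × ℝ =>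
      Complex.exp ((l * (p.1 - x) : ℝ) * p.2 * Complex.I))
      (by apply Continuous.aestronglyMeasurable; fun_prop)
      (Eventually.of_forall fun p => by
        rw [← Complex.ofReal_mul, Complex.norm_exp_ofReal_mul_I])
    refine h4.congr (Eventually.of_forall fun p => ?_)
    simp [Function.uncurry, mul_assoc]

/-- Smoothed form of the Wiener–Ikehara theorem. -/
lemma tendsto_integral_mul_fejerKernel {H : ℝ → ℝ} (h0 : ∀ t, 0 ≤ H t) (hneg : ∀ t < 0, H t = 0)
    (hmeas : Measurable H) (hintg : ∀ σ > 0, Integrable (fun t => H t * Real.exp (-σ * t)))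
    (h : ℝ × ℝ → ℂ) (hcont : ContinuousOn h {p | 0 ≤ p.1})
    (hh : ∀ σ > 0, ∀ y : ℝ, ∫ t, (((H t - Set.indicator (Set.Ici 0) 1 t) * Real.exp (-σ * t) : ℝ) : ℂ)
      * Complex.exp ((y * t : ℝ) * Complex.I) = h (σ, y)) {l : ℝ} (hl : 0 < l) :
    (∀ x, Integrable (fun t => H t * (l * fejerKernel (l * (t - x))))) ∧
    Tendsto (fun x => ∫ t, H t * (l * fejerKernel (l * (t - x)))) atTop (𝓝 1) := by
  set ind : ℝ → ℝ := Set.indicator (Set.Ici 0) 1 with hind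
  have hindnn : ∀ t, 0 ≤ ind t := fun t => Set.indicator_nonneg (by simp) t
  have hindle : ∀ t, ind t ≤ 1 := fun t => Set.indicator_le_self' (by simp) t
  have hindneg : ∀ t < 0, ind t = 0 := fun t ht => Set.indicator_of_notMem (by simpa using ht) _
  have hindmeas : Measurable ind := measurable_one.indicator measurableSet_Ici
  have hKnn : ∀ x t, 0 ≤ l * fejerKernel (l * (t - x)) :=
    fun x t => mul_nonneg hl.le (fejerKernel_nonneg _)
  have hKmeas : ∀ x, Measurable fun t => l * fejerKernel (l * (t - x)) :=
    fun x => (measurable_fejerKernel.comp (by fun_prop)).const_mul l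
  have hKle : ∀ x t, l * fejerKernel (l * (t - x)) ≤ l := fun x t =>
    mul_le_of_le_one_right hl.le (fejerKernel_le_one _)
  have hKint : ∀ x, Integrable fun t => l * fejerKernel (l * (t - x)) :=
    fun x => (integrable_fejerKernel_scaled hl).comp_sub_right x
  have hindint : ∀ σ > 0, Integrable (fun t => ind t * Real.exp (-σ * t)) := by
    intro σ hσ
    have := (integrableOn_exp_mul_Ioi (a := -σ) (by linarith) 0)
    rw [← integrableOn_Ici_iff_integrableOn_Ioi, ← integrable_indicator_iff measurableSet_Ici] at this
    refine this.congr (Eventually.of_forall fun t => ?_)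
    by_cases ht : t ∈ Set.Ici (0 : ℝ) <;> simp [hind, ht]
  -- the correction term
  set R : ℝ → ℝ → ℂ := fun σ x => (l / (2 * Real.pi) : ℝ) *
      ∫ y : ℝ, (triangleFun y : ℂ) * (Complex.exp (-(l * x * y : ℝ) * Complex.I) * h (σ, l * y))
    with hR
  set J : ℝ → ℝ → ℝ := fun σ x =>
    ∫ t, (ind t * Real.exp (-σ * t)) * (l * fejerKernel (l * (t - x))) with hJ
  have hbdint : ∀ f : ℝ → ℝ, Integrable f → ∀ x,
      Integrable (fun t => f t * (l * fejerKernel (l * (t - x)))) := by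
    intro f hf x
    exact hf.mul_bdd (c := l) (hKmeas x).aestronglyMeasurable
      (Eventually.of_forall fun t => by
        rw [Real.norm_of_nonneg (hKnn x t)]; exact hKle x t)
  have key : ∀ σ > 0, ∀ x, ((∫ t, (H t * Real.exp (-σ * t)) * (l * fejerKernel (l * (t - x))) : ℝ) : ℂ)
      = J σ x + R σ x := by
    intro σ hσ x
    have h1 := integral_mul_fejerKernel ((hintg σ hσ).sub (hindint σ hσ)) hl x
    have h2 : ∀ y : ℝ, ∫ t, ((((fun t => H t * Real.exp (-σ * t)) -
        fun t => ind t * Real.exp (-σ * t)) t : ℝ) : ℂ) * Complex.exp ((l * y * t : ℝ) * Complex.I)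
        = h (σ, l * y) := by
      intro y
      rw [← hh σ hσ]
      refine integral_congr_ae (Eventually.of_forall fun t => ?_)
      simp only [Pi.sub_apply]
      congr 2
      ring
    simp_rw [h2] at h1
    rw [hR]
    simp only
    rw [← h1, hJ]
    simp only
    rw [← Complex.ofReal_add, ← integral_add]
    · congr 1
      refine integral_congr_ae (Eventually.of_forall fun t => ?_)
      simp only [Pi.sub_apply]; ring
    · exact hbdint _ (hindint σ hσ) x
    · exact hbdint _ ((hintg σ hσ).sub (hindint σ hσ)) x
  -- limits as `σ → 0`
  set s : ℕ → ℝ := fun n => 1 / ((n : ℝ) + 1) with hs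
  have hspos : ∀ n, 0 < s n := fun n => by positivity
  have hsle : ∀ n, s n ≤ 1 := fun n => by
    rw [hs]; simp only; rw [div_le_one (by positivity)]; linarith [Nat.cast_nonneg (α := ℝ) n]
  have hs0 : Tendsto s atTop (𝓝 0) := tendsto_one_div_add_atTop_nhds_zero_nat
  have hsanti : Antitone s := fun m n hmn => by
    simp only [hs]; gcongr
  have hexp : ∀ t, Tendsto (fun n => Real.exp (-s n * t)) atTop (𝓝 1) := by
    intro t
    have : Tendsto (fun n => Real.exp (-s n * t)) atTop (𝓝 (Real.exp (-0 * t))) :=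
      (Real.continuous_exp.tendsto _).comp ((hs0.neg).mul_const t)
    simpa using this
  have hR0 : ∀ x, Tendsto (fun n => R (s n) x) atTop (𝓝 (R 0 x)) := by
    intro x
    refine Tendsto.const_mul _ ?_
    obtain ⟨B, hB⟩ := (isCompact_Icc.prod isCompact_Icc :
      IsCompact (Set.Icc (0 : ℝ) 1 ×ˢ Set.Icc (-l) l)).exists_bound_of_continuousOn
      (hcont.mono (fun p hp => hp.1.1))
    have hcy : ∀ σ, 0 ≤ σ → Continuous fun y : ℝ => h (σ, l * y) := by
      intro σ hσ
      rw [← continuousOn_univ]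
      exact hcont.comp (by fun_prop) (fun y _ => hσ)
    refine tendsto_integral_of_dominated_convergence (fun y => triangleFun y * B) ?_
      (integrable_triangleFun.mul_const B) ?_ ?_
    · intro n
      apply Continuous.aestronglyMeasurable
      have := hcy (s n) (hspos n).le
      exact (Complex.continuous_ofReal.comp continuous_triangleFun).mul ((by fun_prop : Continuous
        fun y : ℝ => Complex.exp (-(l * x * y : ℝ) * Complex.I)).mul this)
    · intro n
      refine Eventually.of_forall fun y => ?_
      rw [norm_mul, norm_mul, ← Complex.ofReal_neg, Complex.norm_exp_ofReal_mul_I, one_mul,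
        Complex.norm_real, Real.norm_of_nonneg (triangleFun_nonneg y)]
      by_cases hy : 1 ≤ |y|
      · simp [triangleFun_eq_zero hy]
      · push Not at hy
        have := abs_lt.mp hy
        refine mul_le_mul_of_nonneg_left (hB _ ⟨⟨(hspos n).le, hsle n⟩, ?_, ?_⟩)
          (triangleFun_nonneg y)
        · simp only; nlinarith
        · simp only; nlinarith
    · refine Eventually.of_forall fun y => ?_
      refine Tendsto.const_mul _ (Tendsto.const_mul _ ?_)
      have h1 : Tendsto (fun n => ((s n, l * y) : ℝ × ℝ)) atTop (𝓝[{p | 0 ≤ p.1}] (0, l * y)) := by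
        rw [tendsto_nhdsWithin_iff]
        exact ⟨hs0.prodMk_nhds tendsto_const_nhds, Eventually.of_forall fun n => (hspos n).le⟩
      exact (hcont (0, l * y) (le_refl (0:ℝ))).tendsto.comp h1
  have hJ0 : ∀ x, Tendsto (fun n => J (s n) x) atTop (𝓝 (J 0 x)) := by
    intro x
    refine tendsto_integral_of_dominated_convergence (fun t => l * fejerKernel (l * (t - x))) ?_
      (hKint x) ?_ ?_
    · intro n
      exact ((hindmeas.mul (by fun_prop)).mul (hKmeas x)).aestronglyMeasurable
    · intro n
      refine Eventually.of_forall fun t => ?_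
      rw [norm_mul, Real.norm_of_nonneg (hKnn x t)]
      refine mul_le_of_le_one_left (hKnn x t) ?_
      rw [Real.norm_of_nonneg (mul_nonneg (hindnn t) (Real.exp_nonneg _))]
      rcases lt_or_ge t 0 with ht | ht
      · simp [hindneg t ht]
      · refine mul_le_one₀ (hindle t) (Real.exp_nonneg _) (Real.exp_le_one_iff.mpr ?_)
        nlinarith [hspos n]
    · refine Eventually.of_forall fun t => ?_
      refine Tendsto.mul_const _ (Tendsto.const_mul _ ?_)
      simpa using hexp t
  have hI : ∀ x, Tendsto (fun n => ∫ t, (H t * Real.exp (-s n * t)) * (l * fejerKernel (l * (t - x))))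
      atTop (𝓝 (J 0 x + (R 0 x).re)) := by
    intro x
    have h1 : ∀ n, ∫ t, (H t * Real.exp (-s n * t)) * (l * fejerKernel (l * (t - x)))
        = J (s n) x + (R (s n) x).re := by
      intro n
      have := congrArg Complex.re (key (s n) (hspos n) x)
      simpa using this
    simp_rw [h1]
    exact (hJ0 x).add ((Complex.continuous_re.tendsto _).comp (hR0 x))
  have hmain : ∀ x, Integrable (fun t => H t * (l * fejerKernel (l * (t - x)))) ∧
      ∫ t, H t * (l * fejerKernel (l * (t - x))) = J 0 x + (R 0 x).re := by
    intro x
    have hnn : ∀ n t, 0 ≤ (H t * Real.exp (-s n * t)) * (l * fejerKernel (l * (t - x))) :=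
      fun n t => mul_nonneg (mul_nonneg (h0 t) (Real.exp_nonneg _)) (hKnn x t)
    have h1 := lintegral_tendsto_of_tendsto_of_monotone (μ := volume)
      (f := fun n t => ENNReal.ofReal
        ((H t * Real.exp (-s n * t)) * (l * fejerKernel (l * (t - x)))))
      (F := fun t => ENNReal.ofReal (H t * (l * fejerKernel (l * (t - x)))))
      (fun n => ((hmeas.mul (by fun_prop)).mul (hKmeas x)).ennreal_ofReal.aemeasurable)
      (Eventually.of_forall fun t m n hmn => by
        apply ENNReal.ofReal_le_ofReal
        refine mul_le_mul_of_nonneg_right ?_ (hKnn x t)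
        rcases lt_or_ge t 0 with ht | ht
        · simp [hneg t ht]
        · refine mul_le_mul_of_nonneg_left (Real.exp_le_exp.mpr ?_) (h0 t)
          nlinarith [hsanti hmn])
      (Eventually.of_forall fun t => by
        apply ENNReal.tendsto_ofReal
        refine Tendsto.mul_const _ ?_
        simpa using (hexp t).const_mul (H t))
    have h2 : ∀ n, ∫⁻ t, ENNReal.ofReal
        ((H t * Real.exp (-s n * t)) * (l * fejerKernel (l * (t - x))))
        = ENNReal.ofReal (∫ t, (H t * Real.exp (-s n * t)) * (l * fejerKernel (l * (t - x)))) := by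
      intro n
      rw [ofReal_integral_eq_lintegral_ofReal (hbdint _ (hintg _ (hspos n)) x)
        (Eventually.of_forall (hnn n))]
    simp_rw [h2] at h1
    have h3 := tendsto_nhds_unique h1 (ENNReal.tendsto_ofReal (hI x))
    have hFnn : ∀ t, 0 ≤ H t * (l * fejerKernel (l * (t - x))) :=
      fun t => mul_nonneg (h0 t) (hKnn x t)
    have hFm := (hmeas.mul (hKmeas x)).aestronglyMeasurable (μ := volume)
    have hge : 0 ≤ J 0 x + (R 0 x).re :=
      ge_of_tendsto' (hI x) (fun n => integral_nonneg (hnn n))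
    refine ⟨⟨hFm, ?_⟩, ?_⟩
    · rw [hasFiniteIntegral_iff_ofReal (Eventually.of_forall hFnn)]
      exact h3 ▸ ENNReal.ofReal_lt_top
    · rw [integral_eq_lintegral_of_nonneg_ae (Eventually.of_forall hFnn) hFm]
      erw [h3]
      exact ENNReal.toReal_ofReal hge
  refine ⟨fun x => (hmain x).1, ?_⟩
  simp_rw [fun x => (hmain x).2]
  rw [show (1 : ℝ) = 1 + (0 : ℂ).re by simp]
  refine Tendsto.add ?_ ((Complex.continuous_re.tendsto _).comp ?_)
  · -- the main term
    have h1 : ∀ x, J 0 x = ∫ t, ind (t + x) * (l * fejerKernel (l * t)) := by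
      intro x
      rw [hJ]
      simp only
      rw [← integral_add_right_eq_self _ x]
      simp
    refine Tendsto.congr (fun x => (h1 x).symm) ?_
    rw [← integral_fejerKernel_scaled hl]
    refine tendsto_integral_filter_of_dominated_convergence (fun t => l * fejerKernel (l * t))
      (Eventually.of_forall fun x => ?_) (Eventually.of_forall fun x => ?_)
      (integrable_fejerKernel_scaled hl) ?_
    · exact ((hindmeas.comp (by fun_prop)).mul
        ((measurable_fejerKernel.comp (by fun_prop)).const_mul l)).aestronglyMeasurable
    · refine Eventually.of_forall fun t => ?_
      have h2 : 0 ≤ l * fejerKernel (l * t) := mul_nonneg hl.le (fejerKernel_nonneg _)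
      rw [norm_mul, Real.norm_of_nonneg h2, Real.norm_of_nonneg (hindnn _)]
      exact mul_le_of_le_one_left h2 (hindle _)
    · refine Eventually.of_forall fun t => ?_
      refine tendsto_const_nhds.congr' ?_
      filter_upwards [eventually_ge_atTop (-t)] with x hx
      simp [hind, show 0 ≤ t + x by linarith]
  · -- Riemann–Lebesgue
    rw [hR]
    simp only
    rw [← mul_zero (((l / (2 * Real.pi) : ℝ)) : ℂ)]
    refine Tendsto.const_mul _ ?_
    have h1 := Real.tendsto_integral_exp_smul_cocompact
      (fun y : ℝ => (triangleFun y : ℂ) * h (0, l * y))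
    have h2 : Tendsto (fun x : ℝ => l * x / (2 * Real.pi)) atTop (cocompact ℝ) := by
      refine Tendsto.mono_right ?_ atTop_le_cocompact
      exact (tendsto_id.const_mul_atTop hl).atTop_div_const (by positivity)
    refine (h1.comp h2).congr fun x => ?_
    refine integral_congr_ae (Eventually.of_forall fun y => ?_)
    simp only [Circle.smul_def, Real.fourierChar_apply, smul_eq_mul]
    have : (2 * Real.pi * -(y * (l * x / (2 * Real.pi))) : ℝ) = -(l * x * y) := by
      have := Real.pi_pos.ne'
      field_simp
    rw [this]
    push_cast
    ring

end WienerIkehara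

section WienerIkehara

open MeasureTheory

lemma tendsto_setIntegral_fejerKernel {η : ℝ} (hη : 0 < η) :
    Tendsto (fun l : ℝ => ∫ u in Set.Icc (-η) η, l * fejerKernel (l * u)) atTop (𝓝 1) := by
  have h1 : ∀ l : ℝ, ∫ u in Set.Icc (-η) η, l * fejerKernel (l * u)
      = ∫ v in (l * (-η))..(l * η), fejerKernel v := by
    intro l
    rw [integral_Icc_eq_integral_Ioc, ← intervalIntegral.integral_of_le (by linarith),
      intervalIntegral.integral_const_mul, intervalIntegral.mul_integral_comp_mul_left]
  simp_rw [h1]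
  rw [← integral_fejerKernel]
  refine intervalIntegral_tendsto_integral integrable_fejerKernel ?_ ?_
  · exact tendsto_id.atTop_mul_const_of_neg (by linarith)
  · exact tendsto_id.atTop_mul_const hη

/-- Tauberian step in the Wiener–Ikehara theorem. -/
lemma tendsto_of_tendsto_integral_mul_fejerKernel {H : ℝ → ℝ} (h0 : ∀ t, 0 ≤ H t)
    (hneg : ∀ t < 0, H t = 0)
    (hmono : Monotone fun t => H t * Real.exp t)
    (hintg : ∀ l > 0, ∀ x, Integrable (fun t => H t * (l * fejerKernel (l * (t - x)))))
    (hlim : ∀ l > 0, Tendsto (fun x => ∫ t, H t * (l * fejerKernel (l * (t - x)))) atTop (𝓝 1)) :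
    Tendsto H atTop (𝓝 1) := by
  have hcmp : ∀ s t, s ≤ t → H s ≤ H t * Real.exp (t - s) := by
    intro s t hst
    have := hmono hst
    simp only at this
    rw [Real.exp_sub, ← mul_div_assoc, le_div_iff₀ (Real.exp_pos s)]
    exact this
  have hKnn : ∀ l > 0, ∀ u, 0 ≤ l * fejerKernel (l * u) :=
    fun l hl u => mul_nonneg (le_of_lt hl) (fejerKernel_nonneg _)
  have hshift : ∀ l η x : ℝ, ∫ t in Set.Icc (x - η) (x + η), l * fejerKernel (l * (t - x))
      = ∫ u in Set.Icc (-η) η, l * fejerKernel (l * u) := by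
    intro l η x
    rw [← integral_indicator measurableSet_Icc, ← integral_indicator measurableSet_Icc,
      ← integral_add_right_eq_self _ x]
    refine integral_congr_ae (Eventually.of_forall fun t => ?_)
    have : t + x ∈ Set.Icc (x - η) (x + η) ↔ t ∈ Set.Icc (-η) η := by
      simp only [Set.mem_Icc]
      constructor <;> rintro ⟨h, h'⟩ <;> constructor <;> linarith
    by_cases ht : t ∈ Set.Icc (-η) η
    · simp only [Set.indicator_of_mem ht, Set.indicator_of_mem (this.mpr ht), add_sub_cancel_right]
    · simp only [Set.indicator_of_notMem ht, Set.indicator_of_notMem (fun h => ht (this.mp h))]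
  have hc1 : ∀ l > 0, ∀ η, ∫ u in Set.Icc (-η) η, l * fejerKernel (l * u) ≤ 1 := by
    intro l hl η
    rw [← integral_fejerKernel_scaled hl]
    exact setIntegral_le_integral (integrable_fejerKernel_scaled hl)
      (Eventually.of_forall (hKnn l hl))
  have hparam : ∀ δ, 0 < δ → ∃ l > 0, 1 - δ ≤ ∫ u in Set.Icc (-(δ / 2)) (δ / 2),
      l * fejerKernel (l * u) := by
    intro δ hδ
    have h1 := (tendsto_setIntegral_fejerKernel (half_pos hδ)).eventually
      (eventually_ge_nhds (show 1 - δ < 1 by linarith))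
    obtain ⟨l, hl1, hl2⟩ := ((eventually_gt_atTop 0).and h1).exists
    exact ⟨l, hl1, hl2⟩
  have hKint : ∀ l > 0, ∀ x, Integrable fun t => l * fejerKernel (l * (t - x)) :=
    fun l hl x => (integrable_fejerKernel_scaled hl).comp_sub_right x
  have hup : ∀ δ, 0 < δ → δ < 1 → ∀ᶠ x in atTop, H x ≤ (1 + δ) * Real.exp δ / (1 - δ) := by
    intro δ hδ hδ1
    obtain ⟨l, hl, hc⟩ := hparam δ hδ
    have h1 : Tendsto (fun x : ℝ => x + δ / 2) atTop atTop := tendsto_atTop_add_const_right _ _ tendsto_id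
    have h2 := ((hlim l hl).comp h1).eventually (eventually_le_nhds (show 1 < 1 + δ by linarith))
    filter_upwards [h2] with x hx
    simp only [Function.comp] at hx
    have h3 : H x * Real.exp (-δ) * ∫ u in Set.Icc (-(δ / 2)) (δ / 2), l * fejerKernel (l * u)
        ≤ ∫ t, H t * (l * fejerKernel (l * (t - (x + δ / 2)))) := by
      rw [← hshift l (δ / 2) (x + δ / 2), ← integral_const_mul]
      refine (setIntegral_mono_on ?_ (hintg l hl _).integrableOn measurableSet_Icc ?_).trans
        (setIntegral_le_integral (hintg l hl _)
          (Eventually.of_forall fun t => mul_nonneg (h0 t) (hKnn l hl _)))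
      · exact ((hKint l hl _).const_mul _).integrableOn
      · intro t ht
        refine mul_le_mul_of_nonneg_right ?_ (hKnn l hl _)
        have h4 := hcmp x t (by linarith [ht.1])
        calc H x * Real.exp (-δ) ≤ H t * Real.exp (t - x) * Real.exp (-δ) := by gcongr
          _ = H t * Real.exp (t - x - δ) := by rw [mul_assoc, ← Real.exp_add]; ring_nf
          _ ≤ H t * 1 := by
            refine mul_le_mul_of_nonneg_left (Real.exp_le_one_iff.mpr ?_) (h0 t)
            linarith [ht.2]
          _ = H t := mul_one _
    have h5 : H x * Real.exp (-δ) * (1 - δ) ≤ 1 + δ :=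
      (mul_le_mul_of_nonneg_left hc (mul_nonneg (h0 x) (Real.exp_nonneg _))).trans (h3.trans hx)
    rw [le_div_iff₀ (by linarith)]
    have h6 : Real.exp (-δ) * Real.exp δ = 1 := by rw [← Real.exp_add]; simp
    calc H x * (1 - δ) = H x * Real.exp (-δ) * (1 - δ) * Real.exp δ := by
          linear_combination (-(H x * (1 - δ))) * h6
      _ ≤ _ := by gcongr
  obtain ⟨B, hB0, hB⟩ : ∃ B, 0 ≤ B ∧ ∀ t, H t ≤ B := by
    obtain ⟨X, hX⟩ := eventually_atTop.mp (hup (1 / 2) (by norm_num) (by norm_num))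
    refine ⟨max ((1 + 1 / 2) * Real.exp (1 / 2) / (1 - 1 / 2)) (H X * Real.exp X),
      le_max_of_le_left (by positivity), fun t => ?_⟩
    rcases le_total X t with h | h
    · exact le_max_of_le_left (hX t h)
    · rcases lt_or_ge t 0 with h' | h'
      · rw [hneg t h']; exact le_max_of_le_left (by positivity)
      · refine le_max_of_le_right ((hcmp t X h).trans ?_)
        have := h0 X
        gcongr
        linarith
  have hlow : ∀ δ, 0 < δ → ∀ᶠ x in atTop, (1 - δ - B * δ) * Real.exp (-δ) ≤ H x := by
    intro δ hδ
    obtain ⟨l, hl, hc⟩ := hparam δ hδ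
    have h1 : Tendsto (fun x : ℝ => x + -(δ / 2)) atTop atTop :=
      tendsto_atTop_add_const_right _ _ tendsto_id
    have h2 := ((hlim l hl).comp h1).eventually (eventually_ge_nhds (show 1 - δ < 1 by linarith))
    filter_upwards [h2] with x hx
    simp only [Function.comp, ← sub_eq_add_neg] at hx
    have hA : IntegrableOn (fun t => l * fejerKernel (l * (t - (x - δ / 2))))
      (Set.Icc (x - δ / 2 - δ / 2) (x - δ / 2 + δ / 2)) := (hKint l hl _).integrableOn
    have h3 : ∫ t, H t * (l * fejerKernel (l * (t - (x - δ / 2))))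
        ≤ (H x * Real.exp δ - B) * (∫ u in Set.Icc (-(δ / 2)) (δ / 2), l * fejerKernel (l * u))
          + B := by
      have h4 : B = ∫ t, B * (l * fejerKernel (l * (t - (x - δ / 2)))) := by
        rw [integral_const_mul, integral_sub_right_eq_self (fun u => l * fejerKernel (l * u)),
          integral_fejerKernel_scaled hl, mul_one]
      conv_rhs => rw [← hshift l (δ / 2) (x - δ / 2), ← integral_const_mul,
        ← integral_indicator measurableSet_Icc]
      conv_rhs => rw [h4]
      rw [← integral_add ((integrable_indicator_iff measurableSet_Icc).mpr (hA.const_mul _))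
        ((hKint l hl _).const_mul _)]
      refine integral_mono (hintg l hl _) (((integrable_indicator_iff measurableSet_Icc).mpr
        (hA.const_mul _)).add ((hKint l hl _).const_mul _)) fun t => ?_
      simp only
      rw [← h4]
      have hK := hKnn l hl (t - (x - δ / 2))
      by_cases ht : t ∈ Set.Icc (x - δ / 2 - δ / 2) (x - δ / 2 + δ / 2)
      · rw [Set.indicator_of_mem ht, ← add_mul, sub_add_cancel]
        refine mul_le_mul_of_nonneg_right ((hcmp t x (by linarith [ht.2])).trans ?_) hK
        have := h0 x
        gcongr
        linarith [ht.1]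
      · rw [Set.indicator_of_notMem ht, zero_add]
        exact mul_le_mul_of_nonneg_right (hB t) hK
    have hc' := hc1 l hl (δ / 2)
    set c := ∫ u in Set.Icc (-(δ / 2)) (δ / 2), l * fejerKernel (l * u) with hcdef
    have h5 : 1 - δ - B * δ ≤ H x * Real.exp δ := by
      have h6 : H x * Real.exp δ * c ≤ H x * Real.exp δ :=
        mul_le_of_le_one_right (mul_nonneg (h0 x) (Real.exp_nonneg _)) hc'
      nlinarith
    have h6 : Real.exp (-δ) * Real.exp δ = 1 := by rw [← Real.exp_add]; simp
    calc (1 - δ - B * δ) * Real.exp (-δ) ≤ H x * Real.exp δ * Real.exp (-δ) := by gcongr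
      _ = H x := by linear_combination (H x) * h6
  have hne : (𝓝[>] (0 : ℝ)).NeBot := inferInstance
  rw [tendsto_order]
  constructor
  · intro a ha
    have h1 : Tendsto (fun δ : ℝ => (1 - δ - B * δ) * Real.exp (-δ)) (𝓝[>] 0) (𝓝 1) := by
      have : Continuous (fun δ : ℝ => (1 - δ - B * δ) * Real.exp (-δ)) := by fun_prop
      have := (this.tendsto 0).mono_left (nhdsWithin_le_nhds (s := Set.Ioi 0))
      simpa using this
    obtain ⟨δ, hδ, hδ0⟩ := ((h1.eventually (lt_mem_nhds ha)).and self_mem_nhdsWithin).exists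
    filter_upwards [hlow δ hδ0] with x hx using hδ.trans_le hx
  · intro a ha
    have h1 : Tendsto (fun δ : ℝ => (1 + δ) * Real.exp δ / (1 - δ)) (𝓝[>] 0) (𝓝 1) := by
      have : ContinuousAt (fun δ : ℝ => (1 + δ) * Real.exp δ / (1 - δ)) 0 := by
        apply ContinuousAt.div <;> first | fun_prop | simp
      have := this.tendsto.mono_left (nhdsWithin_le_nhds (s := Set.Ioi 0))
      simpa using this
    obtain ⟨δ, ⟨hδ, hδ0⟩, hδ1⟩ := (((h1.eventually (gt_mem_nhds ha)).and self_mem_nhdsWithin).and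
      (nhdsWithin_le_nhds (gt_mem_nhds (show (0 : ℝ) < 1 by norm_num)))).exists
    filter_upwards [hup δ hδ0 hδ1] with x hx using hx.trans_lt hδ

end WienerIkehara

section DirichletSeries

open MeasureTheory

lemma isBigO_sum_of_abs_sub_le {a : ℕ → ℝ} {κ C θ : ℝ} (hθ1 : θ < 1)
    (hA : ∀ x : ℝ, 1 ≤ x → |∑ n ∈ Finset.Icc 1 ⌊x⌋₊, a n - κ * x| ≤ C * x ^ θ) :
    (fun n : ℕ => ∑ k ∈ Finset.Icc 1 n, a k) =O[atTop] fun n : ℕ => (n : ℝ) ^ (1 : ℝ) := by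
  have hC : 0 ≤ C := by simpa using (abs_nonneg _).trans (hA 1 le_rfl)
  refine IsBigO.of_bound (|κ| + C) ?_
  filter_upwards [eventually_ge_atTop 1] with n hn
  have hn' : (1 : ℝ) ≤ n := by exact_mod_cast hn
  have h := hA n hn'
  rw [Nat.floor_natCast] at h
  have h2 : (n : ℝ) ^ θ ≤ n := by
    simpa using Real.rpow_le_rpow_of_exponent_le hn' hθ1.le
  rw [Real.rpow_one, Real.norm_eq_abs, Real.norm_natCast]
  calc |∑ k ∈ Finset.Icc 1 n, a k| = |(∑ k ∈ Finset.Icc 1 n, a k - κ * n) + κ * n| := by ring_nf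
    _ ≤ C * n ^ θ + |κ * n| := (abs_add_le _ _).trans (by gcongr)
    _ ≤ C * n + |κ| * n := by rw [abs_mul, Nat.abs_cast]; gcongr
    _ = _ := by ring

/-- Analytic continuation of a Dirichlet series with nonnegative coefficients whose summatory
function is linear up to a power saving. -/
lemma exists_continuation_of_abs_sub_le {a : ℕ → ℝ} (ha : ∀ n, 0 ≤ a n) {κ C θ : ℝ}
    (hθ0 : 0 ≤ θ) (hθ1 : θ < 1)
    (hA : ∀ x : ℝ, 1 ≤ x → |∑ n ∈ Finset.Icc 1 ⌊x⌋₊, a n - κ * x| ≤ C * x ^ θ) :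
    ∃ Z : ℂ → ℂ, (∀ s : ℂ, θ < s.re → DifferentiableAt ℂ Z s) ∧
      (∀ s : ℂ, 1 < s.re → Z s = (s - 1) * LSeries (fun n => (a n : ℂ)) s) ∧ Z 1 = κ := by
  set E : ℝ → ℂ := (Set.Ioi 1).indicator
    (fun x => ((∑ n ∈ Finset.Icc 1 ⌊x⌋₊, a n - κ * x : ℝ) : ℂ)) with hE
  have hC : 0 ≤ C := by simpa using (abs_nonneg _).trans (hA 1 le_rfl)
  have hEbd : ∀ x : ℝ, 0 < x → ‖E x‖ ≤ C * x ^ θ := by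
    intro x hx
    by_cases h : x ∈ Set.Ioi 1
    · rw [hE, Set.indicator_of_mem h, Complex.norm_real]
      exact hA x (le_of_lt h)
    · rw [hE, Set.indicator_of_notMem h, norm_zero]
      positivity
  have hEm : Measurable E := by
    refine Measurable.indicator ?_ measurableSet_Ioi
    refine Complex.measurable_ofReal.comp (Measurable.sub ?_ (by fun_prop))
    exact (measurable_from_nat (f := fun m => ∑ n ∈ Finset.Icc 1 m, a n)).comp
      Nat.measurable_floor
  have hEloc : LocallyIntegrableOn E (Set.Ioi 0) := by
    have h1 : Continuous (fun x : ℝ => C * |x| ^ θ) :=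
      continuous_const.mul (continuous_abs.rpow_const fun _ => Or.inr hθ0)
    refine h1.continuousOn.locallyIntegrableOn measurableSet_Ioi |>.mono
      hEm.aestronglyMeasurable (ae_of_all _ fun x => ?_)
    rw [Real.norm_of_nonneg (by positivity)]
    rcases le_or_gt x 0 with hx | hx
    · have : x ∉ Set.Ioi (1 : ℝ) := by simp; linarith
      rw [hE, Set.indicator_of_notMem this, norm_zero]
      positivity
    · rw [abs_of_pos hx]
      exact hEbd x hx
  have htop : E =O[atTop] fun x : ℝ => x ^ (-(-θ)) := by
    refine IsBigO.of_bound C ?_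
    filter_upwards [eventually_gt_atTop 0] with x hx
    rw [neg_neg, Real.norm_of_nonneg (Real.rpow_nonneg hx.le _)]
    exact hEbd x hx
  have hbot : ∀ b : ℝ, E =O[𝓝[>] 0] fun x : ℝ => x ^ (-b) := by
    intro b
    refine IsBigO.of_bound 1 ?_
    filter_upwards [nhdsWithin_le_nhds (Iio_mem_nhds (show (0:ℝ) < 1 by norm_num))] with x hx
    have : x ∉ Set.Ioi (1 : ℝ) := by simpa using le_of_lt hx
    rw [hE, Set.indicator_of_notMem this, norm_zero]
    positivity
  refine ⟨fun s => κ * s + (s - 1) * s * mellin E (-s), ?_, ?_, by simp⟩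
  · intro s hs
    have h1 : DifferentiableAt ℂ (mellin E) (-s) :=
      mellin_differentiableAt_of_isBigO_rpow hEloc htop (by simpa using hs)
        (hbot ((-s).re - 1)) (by linarith)
    have h2 : DifferentiableAt ℂ (fun s => mellin E (-s)) s :=
      DifferentiableAt.comp (g := mellin E) (f := fun s : ℂ => -s) s h1 differentiableAt_id.neg
    fun_prop
  · intro s hs
    have hs1 : s - 1 ≠ 0 := by
      intro h
      have := congrArg Complex.re h
      simp at this
      linarith
    rw [LSeries_eq_mul_integral_of_nonneg a zero_le_one hs (isBigO_sum_of_abs_sub_le hθ1 hA) ha]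
    have hconv : MellinConvergent E (-s) :=
      mellinConvergent_of_isBigO_rpow hEloc htop (by simp; linarith)
        (hbot ((-s).re - 1)) (by linarith)
    have h1 : mellin E (-s) = ∫ t in Set.Ioi (1:ℝ), (t : ℂ) ^ (-s - 1) * E t := by
      refine setIntegral_eq_of_subset_of_forall_sdiff_eq_zero measurableSet_Ioi
        (Set.Ioi_subset_Ioi zero_le_one) fun t ht => ?_
      rw [hE, Set.indicator_of_notMem ht.2, smul_zero]
    have h2 : ∫ t in Set.Ioi (1 : ℝ), (∑ k ∈ Finset.Icc 1 ⌊t⌋₊, (a k : ℂ)) * t ^ (-(s + 1)) =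
        ∫ t in Set.Ioi (1 : ℝ), ((t : ℂ) ^ (-s - 1) * E t + κ * (t : ℂ) ^ (-s)) := by
      refine setIntegral_congr_fun measurableSet_Ioi fun t ht => ?_
      have ht0 : (t : ℂ) ≠ 0 := by
        exact_mod_cast (zero_lt_one.trans ht).ne'
      simp only [hE, Set.indicator_of_mem ht]
      have : (t : ℂ) ^ (-s) = (t : ℂ) ^ (-s - 1) * t := by
        rw [Complex.cpow_sub _ _ ht0, Complex.cpow_one]; field_simp
      rw [this]
      push_cast
      rw [show -(s + 1) = -s - 1 by ring]
      ring
    have hre : (-s).re < -1 := by simpa using hs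
    rw [h2, integral_add, ← h1, integral_const_mul, integral_Ioi_cpow_of_lt hre zero_lt_one]
    · have : -s + 1 ≠ 0 := by
        intro h; apply hs1; linear_combination -h
      simp only [Complex.ofReal_one, Complex.one_cpow]
      field_simp
      ring
    · exact (hconv.mono_set (Set.Ioi_subset_Ioi zero_le_one))
    · exact ((integrableOn_Ioi_cpow_iff zero_lt_one).2 hre).const_mul _

end DirichletSeries

section DirichletSeries

open MeasureTheory

lemma AnalyticAt.exists_tendsto_mul_logDeriv {f : ℂ → ℂ} {z₀ : ℂ} (hf : AnalyticAt ℂ f z₀)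
    (hne : ¬ ∀ᶠ z in 𝓝 z₀, f z = 0) :
    ∃ m : ℕ, (f z₀ ≠ 0 ↔ m = 0) ∧
      Tendsto (fun ε : ℝ => (ε : ℂ) * (deriv f (z₀ + ε) / f (z₀ + ε))) (𝓝[>] 0) (𝓝 m) ∧
      ∀ᶠ ε : ℝ in 𝓝[>] 0, f (z₀ + ε) ≠ 0 := by
  obtain ⟨m, g, hg, hg0, hfg⟩ := hf.exists_eventuallyEq_pow_smul_nonzero_iff.2 hne
  have hT : Tendsto (fun ε : ℝ => z₀ + (ε : ℂ)) (𝓝[>] 0) (𝓝 z₀) := by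
    have : Continuous (fun ε : ℝ => z₀ + (ε : ℂ)) := by fun_prop
    have := (this.tendsto 0).mono_left (nhdsWithin_le_nhds (s := Set.Ioi 0))
    simpa using this
  have hd : ∀ᶠ z in 𝓝 z₀, deriv f z = m * (z - z₀) ^ (m - 1) * g z + (z - z₀) ^ m * deriv g z := by
    filter_upwards [(show f =ᶠ[𝓝 z₀] fun z => (z - z₀) ^ m • g z from hfg).eventuallyEq_nhds,
      hg.eventually_analyticAt] with z hz hgz
    rw [hz.deriv_eq]
    have h1 : HasDerivAt (fun z : ℂ => (z - z₀) ^ m) (m * (z - z₀) ^ (m - 1) * 1) z :=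
      ((hasDerivAt_id z).sub_const z₀).pow m
    have := (h1.smul hgz.differentiableAt.hasDerivAt).deriv
    simp only [smul_eq_mul, mul_one] at this ⊢
    rw [show (fun z => (z - z₀) ^ m * g z) = (fun z => (z - z₀) ^ m) * g from rfl, this]
    ring
  have hgne : ∀ᶠ z in 𝓝 z₀, g z ≠ 0 := hg.continuousAt.eventually_ne hg0
  refine ⟨m, ?_, ?_, ?_⟩
  · have := hfg.self_of_nhds
    rw [this]
    simp [hg0]
  · have h1 : Tendsto (fun ε : ℝ => (m : ℂ) + ε * (deriv g (z₀ + ε) / g (z₀ + ε))) (𝓝[>] 0)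
        (𝓝 (m + ((0 : ℝ) : ℂ) * (deriv g z₀ / g z₀))) := by
      refine tendsto_const_nhds.add (Tendsto.mul ?_ (Tendsto.div ?_ ?_ hg0))
      · exact (Complex.continuous_ofReal.tendsto 0).mono_left nhdsWithin_le_nhds
      · exact hg.deriv.continuousAt.tendsto.comp hT
      · exact hg.continuousAt.tendsto.comp hT
    simp only [Complex.ofReal_zero, zero_mul, add_zero] at h1
    refine h1.congr' ?_
    filter_upwards [hT.eventually hfg, hT.eventually hd, hT.eventually hgne,
      self_mem_nhdsWithin] with ε h2 h3 h4 h5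
    have hε : (ε : ℂ) ≠ 0 := by exact_mod_cast (ne_of_gt h5)
    rw [h2, h3]
    simp only [add_sub_cancel_left, smul_eq_mul]
    rcases m with _ | m
    · field_simp; simp
    · simp only [Nat.add_sub_cancel]
      field_simp
      ring
  · filter_upwards [hT.eventually hfg, hT.eventually hgne,
      self_mem_nhdsWithin] with ε h2 h4 h5
    have hε : (ε : ℂ) ≠ 0 := by exact_mod_cast (ne_of_gt h5)
    rw [h2]
    simp [h4, hε]

lemma LSeries_three_four_one_nonneg {Λ : ℕ → ℝ} (hΛ : ∀ n, 0 ≤ Λ n) {x : ℝ} (t : ℝ)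
    (hs : ∀ s : ℂ, s.re = x → LSeriesSummable (fun n => (Λ n : ℂ)) s) :
    0 ≤ 3 * (LSeries (fun n => (Λ n : ℂ)) x).re + 4 * (LSeries (fun n => (Λ n : ℂ)) (x + t * Complex.I)).re +
      (LSeries (fun n => (Λ n : ℂ)) (x + 2 * t * Complex.I)).re := by
  have h0 := Complex.hasSum_re (hs x (by simp)).LSeriesHasSum
  have h1 := Complex.hasSum_re (hs (x + t * Complex.I) (by simp)).LSeriesHasSum
  have h2 := Complex.hasSum_re (hs (x + 2 * t * Complex.I) (by simp)).LSeriesHasSum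
  refine ((h0.mul_left 3).add (h1.mul_left 4)).add h2 |>.nonneg fun n => ?_
  rcases eq_or_ne n 0 with rfl | hn
  · simp
  have hn' : (n : ℂ) ≠ 0 := by exact_mod_cast hn
  have hn0 : (0 : ℝ) < n := by positivity
  simp only [LSeries.term_of_ne_zero hn, div_eq_mul_inv, ← Complex.cpow_neg]
  set w : ℂ := (n : ℂ) ^ (-(t * Complex.I)) with hw
  have hwn : ‖w‖ = 1 := by
    rw [hw, Complex.norm_natCast_cpow_of_pos (by positivity)]; simp
  have e1 : (n : ℂ) ^ (-(x + t * Complex.I)) = ((n : ℝ) ^ (-x) : ℝ) * w := by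
    rw [neg_add, Complex.cpow_add _ _ hn', Complex.ofReal_cpow hn0.le]; simp [hw]
  have e2 : (n : ℂ) ^ (-(x + 2 * t * Complex.I)) = ((n : ℝ) ^ (-x) : ℝ) * (w * w) := by
    rw [hw, ← Complex.cpow_add _ _ hn', Complex.ofReal_cpow hn0.le]
    push_cast
    rw [← Complex.cpow_add _ _ hn']
    ring_nf
  have e0 : (n : ℂ) ^ (-(x : ℂ)) = ((n : ℝ) ^ (-x) : ℝ) := by
    rw [Complex.ofReal_cpow hn0.le]; simp
  rw [e0, e1, e2]
  simp only [Complex.mul_re, Complex.mul_im, Complex.ofReal_re, Complex.ofReal_im]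
  have hw2 : w.re * w.re + w.im * w.im = 1 := by
    rw [← Complex.normSq_apply, Complex.normSq_eq_norm_sq, hwn]; norm_num
  have : 0 ≤ Λ n * (n : ℝ) ^ (-x) * (2 * (1 + w.re) ^ 2) := by
    have := hΛ n
    positivity
  linear_combination this + Λ n * (n : ℝ) ^ (-x) * hw2

lemma ne_zero_of_continuation {Z : ℂ → ℂ} {Λ : ℕ → ℝ} {θ : ℝ} (hθ1 : θ < 1)
    (hΛ : ∀ n, 0 ≤ Λ n)
    (hZ : ∀ s : ℂ, θ < s.re → DifferentiableAt ℂ Z s) (hZ1 : Z 1 ≠ 0)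
    (hs : ∀ s : ℂ, 1 < s.re → LSeriesSummable (fun n => (Λ n : ℂ)) s)
    (hd : ∀ s : ℂ, 1 < s.re → (s - 1) * deriv Z s =
      Z s * (1 - (s - 1) * LSeries (fun n => (Λ n : ℂ)) s)) :
    ∀ s : ℂ, 1 ≤ s.re → Z s ≠ 0 := by
  have hopen : IsOpen {s : ℂ | θ < s.re} := isOpen_lt continuous_const Complex.continuous_re
  have hpre : IsPreconnected {s : ℂ | θ < s.re} := (convex_halfSpace_re_gt θ).isPreconnected
  have hA : AnalyticOnNhd ℂ Z {s : ℂ | θ < s.re} :=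
    DifferentiableOn.analyticOnNhd (fun s hs => (hZ s hs).differentiableWithinAt) hopen
  have hne : ∀ s : ℂ, θ < s.re → ¬ ∀ᶠ z in 𝓝 s, Z z = 0 := by
    intro s hs' h
    exact hZ1 (hA.eqOn_zero_of_preconnected_of_eventuallyEq_zero hpre hs' h
      (show (1 : ℂ) ∈ {s : ℂ | θ < s.re} by simpa using hθ1))
  set D : ℂ → ℂ := LSeries (fun n => (Λ n : ℂ)) with hD
  have key : ∀ s : ℂ, 1 ≤ s.re → ∃ m : ℕ, (Z s ≠ 0 ↔ m = 0) ∧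
      Tendsto (fun ε : ℝ => (ε : ℂ) * D (s + ε)) (𝓝[>] 0) (𝓝 ((if s = 1 then 1 else 0) - m)) := by
    intro s hs1
    obtain ⟨m, hm, hlim, hnz⟩ := (hA s (hθ1.trans_le hs1)).exists_tendsto_mul_logDeriv
      (hne s (hθ1.trans_le hs1))
    refine ⟨m, hm, ?_⟩
    have h2 : Tendsto (fun ε : ℝ => (ε : ℂ) / (s + ε - 1)) (𝓝[>] 0)
        (𝓝 (if s = 1 then 1 else 0)) := by
      split_ifs with h
      · refine tendsto_const_nhds.congr' ?_
        filter_upwards [self_mem_nhdsWithin] with ε h5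
        have hε : (ε : ℂ) ≠ 0 := by exact_mod_cast (ne_of_gt h5)
        rw [h, add_sub_cancel_left, div_self hε]
      · have hc : ContinuousAt (fun ε : ℝ => (ε : ℂ) / (s + ε - 1)) 0 := by
          apply ContinuousAt.div
          · fun_prop
          · fun_prop
          · simpa [sub_eq_zero] using h
        have := hc.tendsto.mono_left (nhdsWithin_le_nhds (s := Set.Ioi 0))
        simpa using this
    refine (h2.sub hlim).congr' ?_
    filter_upwards [hnz, self_mem_nhdsWithin] with ε h4 h5
    have h5 : 0 < ε := h5
    have hre : 1 < (s + ε).re := by simp; linarith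
    have h6 : s + ε - 1 ≠ 0 := by
      intro h
      have := congrArg Complex.re h
      simp at this hre
      linarith
    have := hd (s + ε) hre
    field_simp
    linear_combination -(ε : ℂ) * this
  intro s hs1
  obtain ⟨m, hm, hlim⟩ := key s hs1
  rw [hm]
  rcases hs1.lt_or_eq with hs2 | hs2
  · have hc : ContinuousAt D s := by
      have : LSeries.abscissaOfAbsConv (fun n => (Λ n : ℂ)) < s.re := by
        refine (LSeries.abscissaOfAbsConv_le_of_forall_lt_LSeriesSummable (x := 1) fun y hy => ?_).trans_lt
          (by exact_mod_cast hs2)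
        exact hs y (by simpa using hy)
      exact (LSeries_hasDerivAt this).continuousAt
    have hT : Tendsto (fun ε : ℝ => s + (ε : ℂ)) (𝓝[>] 0) (𝓝 s) := by
      have : Continuous (fun ε : ℝ => s + (ε : ℂ)) := by fun_prop
      have := (this.tendsto 0).mono_left (nhdsWithin_le_nhds (s := Set.Ioi 0))
      simpa using this
    have h3 : Tendsto (fun ε : ℝ => (ε : ℂ) * D (s + ε)) (𝓝[>] 0) (𝓝 (((0:ℝ):ℂ) * D s)) :=
      ((Complex.continuous_ofReal.tendsto 0).mono_left nhdsWithin_le_nhds).mul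
        (hc.tendsto.comp hT)
    have h4 := tendsto_nhds_unique hlim h3
    rw [if_neg (by rintro rfl; simp at hs2)] at h4
    simpa using h4
  · by_cases h1 : s = 1
    · rw [← hm, h1]; exact hZ1
    obtain ⟨m0, hm0, hlim0⟩ := key 1 (by simp)
    obtain ⟨m2, hm2, hlim2⟩ := key (1 + 2 * s.im * Complex.I) (by simp)
    have hs3 : s = 1 + s.im * Complex.I := by
      apply Complex.ext <;> simp [hs2.symm]
    have him : s.im ≠ 0 := by
      intro h; apply h1; rw [hs3, h]; simp
    rw [hm0.1 hZ1, if_pos rfl] at hlim0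
    rw [if_neg h1] at hlim
    rw [if_neg (by simp [him])] at hlim2
    have hlim0' := (Complex.continuous_re.tendsto _).comp hlim0
    have hlim' := (Complex.continuous_re.tendsto _).comp hlim
    have hlim2' := (Complex.continuous_re.tendsto _).comp hlim2
    have hT := ((hlim0'.const_mul 3).add (hlim'.const_mul 4)).add hlim2'
    have := ge_of_tendsto (b := 0) hT (by
      filter_upwards [self_mem_nhdsWithin] with ε h5
      have h5 : 0 < ε := h5
      have hh := LSeries_three_four_one_nonneg hΛ (x := 1 + ε) s.im (fun z hz => hs z (by linarith))
      have e0 : (((1 + ε : ℝ)) : ℂ) = 1 + ε := by push_cast; ring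
      have e1 : (((1 + ε : ℝ)) : ℂ) + s.im * Complex.I = s + ε := by
        rw [hs3]; push_cast; simp; ring
      have e2 : (((1 + ε : ℝ)) : ℂ) + 2 * s.im * Complex.I = 1 + 2 * s.im * Complex.I + ε := by
        push_cast; ring
      rw [e1, e2, e0] at hh
      have := mul_nonneg h5.le hh
      simp only [Function.comp_apply, Complex.re_ofReal_mul]
      simp only [hD]
      linarith)
    simp at this
    by_contra hm'
    have : (1 : ℝ) ≤ m := by exact_mod_cast Nat.one_le_iff_ne_zero.2 hm'
    have : (0 : ℝ) ≤ m2 := by positivity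
    linarith

end DirichletSeries

section Beurling

open MeasureTheory

/-- Wiener–Ikehara theorem for Dirichlet series. -/
lemma tendsto_sum_div_of_LSeries_sub_continuousOn {Λ : ℕ → ℝ} (hΛ : ∀ n, 0 ≤ Λ n) {K : ℝ}
    (hK : ∀ x : ℝ, 1 ≤ x → ∑ n ∈ Finset.Icc 1 ⌊x⌋₊, Λ n ≤ K * (x * Real.log x))
    {G : ℂ → ℂ} (hG : ContinuousOn G {s | 1 ≤ s.re})
    (hGΛ : ∀ s : ℂ, 1 < s.re → LSeries (fun n => (Λ n : ℂ)) s = 1 / (s - 1) + G s) :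
    Tendsto (fun x : ℝ => (∑ n ∈ Finset.Icc 1 ⌊x⌋₊, Λ n) / x) atTop (𝓝 1) := by
  set ψ : ℝ → ℝ := fun x => ∑ n ∈ Finset.Icc 1 ⌊x⌋₊, Λ n with hψ
  have hψ0 : ∀ x, 0 ≤ ψ x := fun x => Finset.sum_nonneg fun n _ => hΛ n
  have hψmono : Monotone ψ := by
    intro x y hxy
    exact Finset.sum_le_sum_of_subset_of_nonneg
      (Finset.Icc_subset_Icc le_rfl (Nat.floor_mono hxy)) fun n _ _ => hΛ n
  have hK0 : 0 ≤ K := by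
    have := (hψ0 _).trans (hK (Real.exp 1) (Real.one_le_exp zero_le_one))
    rw [Real.log_exp, mul_one] at this
    exact nonneg_of_mul_nonneg_left this (Real.exp_pos 1)
  set H : ℝ → ℝ := (Set.Ici 0).indicator fun t => ψ (Real.exp t) * Real.exp (-t) with hH
  have hHpos : ∀ t, 0 ≤ t → H t = ψ (Real.exp t) * Real.exp (-t) := fun t ht =>
    Set.indicator_of_mem (by simpa using ht) _
  have hneg : ∀ t < 0, H t = 0 := fun t ht => Set.indicator_of_notMem (by simpa using ht) _
  have h0 : ∀ t, 0 ≤ H t := fun t =>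
    Set.indicator_nonneg (fun t _ => mul_nonneg (hψ0 _) (Real.exp_nonneg _)) t
  have hHle : ∀ t, 0 ≤ t → H t ≤ K * t := by
    intro t ht
    rw [hHpos t ht]
    calc ψ (Real.exp t) * Real.exp (-t) ≤ K * (Real.exp t * Real.log (Real.exp t)) * Real.exp (-t) := by
          gcongr; exact hK _ (Real.one_le_exp ht)
      _ = K * t * (Real.exp t * Real.exp (-t)) := by rw [Real.log_exp]; ring
      _ = K * t := by rw [← Real.exp_add]; simp
  have hmeas : Measurable H :=
    ((hψmono.measurable.comp Real.measurable_exp).mul (by fun_prop)).indicator measurableSet_Ici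
  have hmono : Monotone fun t => H t * Real.exp t := by
    intro s t hst
    simp only
    rcases lt_or_ge s 0 with hs | hs
    · rw [hneg s hs, zero_mul]
      exact mul_nonneg (h0 t) (Real.exp_nonneg _)
    · rw [hHpos s hs, hHpos t (hs.trans hst), mul_assoc, mul_assoc, ← Real.exp_add, ← Real.exp_add]
      simpa using hψmono (Real.exp_le_exp.2 hst)
  have hindint : ∀ σ > 0, Integrable (fun t => Set.indicator (Set.Ici 0) 1 t * Real.exp (-σ * t)) := by
    intro σ hσ
    have := ((integrableOn_Ici_iff_integrableOn_Ioi).2 (exp_neg_integrableOn_Ioi 0 hσ)).integrable_indicator measurableSet_Ici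
    refine this.congr (ae_of_all _ fun t => ?_)
    by_cases ht : t ∈ Set.Ici (0 : ℝ) <;> simp [Set.indicator, ht]
  have hintg : ∀ σ > 0, Integrable (fun t => H t * Real.exp (-σ * t)) := by
    intro σ hσ
    refine ((hindint (σ / 2) (by positivity)).const_mul (K * (2 / σ))).mono'
      (by fun_prop) (ae_of_all _ fun t => ?_)
    rw [Real.norm_of_nonneg (mul_nonneg (h0 t) (Real.exp_nonneg _))]
    rcases lt_or_ge t 0 with ht | ht
    · rw [hneg t ht, Set.indicator_of_notMem (by simpa using ht)]; simp
    · rw [Set.indicator_of_mem (by simpa using ht)]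
      have e1 : Real.exp (-σ * t) = Real.exp (-(σ / 2) * t) * Real.exp (-(σ / 2) * t) := by
        rw [← Real.exp_add]; ring_nf
      have e2 : t * Real.exp (-(σ / 2) * t) ≤ 2 / σ := by
        have := Real.add_one_le_exp (σ / 2 * t)
        have e3 : Real.exp (σ / 2 * t) * Real.exp (-(σ / 2) * t) = 1 := by
          rw [← Real.exp_add]; simp
        rw [le_div_iff₀ hσ]
        have := mul_le_mul_of_nonneg_right this (Real.exp_nonneg (-(σ / 2) * t))
        nlinarith [Real.exp_nonneg (-(σ / 2) * t)]
      calc H t * Real.exp (-σ * t) ≤ K * t * Real.exp (-σ * t) := by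
            gcongr; exact hHle t ht
        _ = K * (t * Real.exp (-(σ / 2) * t)) * Real.exp (-(σ / 2) * t) := by rw [e1]; ring
        _ ≤ K * (2 / σ) * Real.exp (-(σ / 2) * t) := by gcongr
        _ = _ := by simp
  set h : ℝ × ℝ → ℂ := fun p => (G (1 + (p.1 - p.2 * Complex.I)) - 1) / (1 + (p.1 - p.2 * Complex.I)) with hh
  have hcont : ContinuousOn h {p | 0 ≤ p.1} := by
    have h1 : Continuous fun p : ℝ × ℝ => (1 : ℂ) + (p.1 - p.2 * Complex.I) := by fun_prop
    refine ContinuousOn.div ((hG.comp h1.continuousOn fun p hp => ?_).sub continuousOn_const)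
      h1.continuousOn fun p hp => ?_
    · simpa using hp
    · intro h
      have := congrArg Complex.re h
      have hp : 0 ≤ p.1 := hp
      simp at this
      linarith
  have hlap : ∀ σ > 0, ∀ y : ℝ, ∫ t, (((H t - Set.indicator (Set.Ici 0) 1 t) * Real.exp (-σ * t) : ℝ) : ℂ)
      * Complex.exp ((y * t : ℝ) * Complex.I) = h (σ, y) := by
    intro σ hσ y
    set z : ℂ := σ - y * Complex.I with hz
    have hzre : z.re = σ := by simp [hz]
    have hz0 : z ≠ 0 := by intro h; rw [h] at hzre; simp at hzre; linarith
    have hz1 : 1 + z ≠ 0 := by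
      intro h
      have := congrArg Complex.re h
      simp [hzre] at this; linarith
    have hexp : ∀ t : ℝ, ((Real.exp (-σ * t) : ℝ) : ℂ) * Complex.exp ((y * t : ℝ) * Complex.I) =
        Complex.exp (-z * t) := by
      intro t
      rw [Complex.ofReal_exp, ← Complex.exp_add, hz]; push_cast; ring_nf
    have hni : ∀ f : ℝ → ℝ, Integrable (fun t => f t * Real.exp (-σ * t)) →
        Integrable (fun t => (f t : ℂ) * Complex.exp (-z * t)) := by
      intro f hf
      have h1 : Integrable (fun t => ((f t * Real.exp (-σ * t) : ℝ) : ℂ)) := hf.ofReal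
      refine (h1.mul_bdd (c := 1) (g := fun t : ℝ => Complex.exp ((y * t : ℝ) * Complex.I))
        (by fun_prop) (ae_of_all _ fun t => ?_)).congr (ae_of_all _ fun t => ?_)
      · rw [Complex.norm_exp_ofReal_mul_I]
      · simp only
        rw [Complex.ofReal_mul, mul_assoc, hexp]
    have hI1 : ∫ t, (H t : ℂ) * Complex.exp (-z * t) =
        LSeries (fun n => (Λ n : ℂ)) (1 + z) / (1 + z) := by
      have hO : (fun n : ℕ => ∑ k ∈ Finset.Icc 1 n, Λ k) =O[atTop]
          fun n : ℕ => (n : ℝ) ^ (1 + σ / 2) := by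
        have h1 : (fun n : ℕ => ∑ k ∈ Finset.Icc 1 n, Λ k) =O[atTop]
            fun n : ℕ => (n : ℝ) * Real.log n := by
          refine IsBigO.of_bound K ?_
          filter_upwards [eventually_ge_atTop 1] with n hn
          have hn' : (1 : ℝ) ≤ n := by exact_mod_cast hn
          have := hK n hn'
          rw [Nat.floor_natCast] at this
          rw [Real.norm_of_nonneg (Finset.sum_nonneg fun n _ => hΛ n), Real.norm_of_nonneg
            (mul_nonneg (by positivity) (Real.log_nonneg hn'))]
          exact this
        refine h1.trans ?_
        have h2 : (fun n : ℕ => Real.log (n : ℝ)) =O[atTop] fun n : ℕ => (n : ℝ) ^ (σ / 2) :=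
          ((isLittleO_log_rpow_atTop (by positivity)).isBigO).comp_tendsto tendsto_natCast_atTop_atTop
        refine ((isBigO_refl (fun n : ℕ => (n : ℝ)) atTop).mul h2).congr' EventuallyEq.rfl ?_
        filter_upwards [eventually_ge_atTop 1] with n hn
        rw [Real.rpow_add (by positivity), Real.rpow_one]
      rw [LSeries_eq_mul_integral_of_nonneg Λ (by positivity) (by simp [hzre]; linarith) hO hΛ,
        mul_div_cancel_left₀ _ hz1]
      have himg : Real.exp '' Set.Ioi 0 = Set.Ioi 1 := by
        ext u
        constructor
        · rintro ⟨t, ht, rfl⟩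
          exact Real.one_lt_exp_iff.2 ht
        · intro hu
          have hu : 1 < u := hu
          exact ⟨Real.log u, Real.log_pos hu, Real.exp_log (by linarith)⟩
      rw [← himg, integral_image_eq_integral_abs_deriv_smul measurableSet_Ioi
        (fun t _ => (Real.hasDerivAt_exp t).hasDerivWithinAt) Real.exp_injective.injOn]
      rw [← integral_indicator measurableSet_Ioi]
      refine integral_congr_ae ?_
      have hne : ∀ᵐ t : ℝ, t ≠ 0 := by simp [ae_iff]
      filter_upwards [hne] with t ht
      rcases lt_or_gt_of_ne ht with ht | ht
      · rw [hneg t ht, Set.indicator_of_notMem (by simpa using ht.le)]; simp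
      · rw [hHpos t ht.le, Set.indicator_of_mem (by simpa using ht), abs_of_pos (Real.exp_pos t)]
        rw [Complex.real_smul, Complex.ofReal_exp, Complex.cpow_def_of_ne_zero (Complex.exp_ne_zero _),
          ← Complex.ofReal_exp, ← Complex.ofReal_log (Real.exp_nonneg _), Real.log_exp]
        simp only [hψ]
        push_cast
        rw [mul_assoc, ← Complex.exp_add, mul_left_comm, ← Complex.exp_add]
        ring_nf
    have hI2 : ∫ t, ((Set.indicator (Set.Ici (0 : ℝ)) (1 : ℝ → ℝ) t : ℝ) : ℂ) * Complex.exp (-z * t) = 1 / z := by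
      have h1 := integral_exp_mul_complex_Ioi (a := -z) (by simp [hzre, hσ]) 0
      have h2 : ∀ t : ℝ, ((Set.indicator (Set.Ici (0 : ℝ)) (1 : ℝ → ℝ) t : ℝ) : ℂ) * Complex.exp (-z * t) =
          Set.indicator (Set.Ici (0:ℝ)) (fun t : ℝ => Complex.exp (-z * t)) t := by
        intro t
        by_cases ht : t ∈ Set.Ici (0 : ℝ) <;> simp [Set.indicator, ht]
      simp_rw [h2]
      rw [integral_indicator measurableSet_Ici, integral_Ici_eq_integral_Ioi, h1]
      simp
    have hsplit : ∀ t : ℝ, (((H t - Set.indicator (Set.Ici 0) 1 t) * Real.exp (-σ * t) : ℝ) : ℂ)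
        * Complex.exp ((y * t : ℝ) * Complex.I) = (H t : ℂ) * Complex.exp (-z * t) -
        ((Set.indicator (Set.Ici (0 : ℝ)) (1 : ℝ → ℝ) t : ℝ) : ℂ) * Complex.exp (-z * t) := by
      intro t
      rw [← hexp]; push_cast; ring
    simp_rw [hsplit]
    rw [integral_sub (hni _ (hintg σ hσ)) (hni _ (hindint σ hσ)), hI1, hI2,
      hGΛ (1 + z) (by simp [hzre, hσ])]
    simp only [hh]
    rw [← hz, add_sub_cancel_left]
    field_simp
    ring
  have hfin := tendsto_of_tendsto_integral_mul_fejerKernel h0 hneg hmono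
    (fun l hl => (tendsto_integral_mul_fejerKernel h0 hneg hmeas hintg h hcont hlap hl).1)
    (fun l hl => (tendsto_integral_mul_fejerKernel h0 hneg hmeas hintg h hcont hlap hl).2)
  refine (hfin.comp Real.tendsto_log_atTop).congr' ?_
  filter_upwards [eventually_ge_atTop 1] with x hx
  have hx0 : 0 < x := by linarith
  rw [Function.comp_apply, hHpos _ (Real.log_nonneg hx), Real.exp_neg, Real.exp_log hx0,
    div_eq_mul_inv]

/-- Beurling's prime number theorem, under a power-saving count of generalized integers. -/
theorem tendsto_sum_div_of_convolution_eq {a Λ : ℕ → ℝ} (ha : ∀ n, 0 ≤ a n) (hΛ : ∀ n, 0 ≤ Λ n)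
    (ha1 : a 1 = 1)
    (hconv : ∀ n, ∑ p ∈ n.divisorsAntidiagonal, a p.1 * Λ p.2 = a n * Real.log n)
    {κ C θ : ℝ} (hκ : 0 < κ) (hθ0 : 0 ≤ θ) (hθ1 : θ < 1)
    (hA : ∀ x : ℝ, 1 ≤ x → |∑ n ∈ Finset.Icc 1 ⌊x⌋₊, a n - κ * x| ≤ C * x ^ θ) :
    Tendsto (fun x : ℝ => (∑ n ∈ Finset.Icc 1 ⌊x⌋₊, Λ n) / x) atTop (𝓝 1) := by
  obtain ⟨Z, hZ, hZL, hZ1⟩ := exists_continuation_of_abs_sub_le ha hθ0 hθ1 hA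
  have hC : 0 ≤ C := by simpa using (abs_nonneg _).trans (hA 1 le_rfl)
  have hΛle : ∀ n, n ≠ 0 → Λ n ≤ a n * Real.log n := by
    intro n hn
    rw [← hconv]
    have := Finset.single_le_sum (f := fun p : ℕ × ℕ => a p.1 * Λ p.2)
      (fun p _ => mul_nonneg (ha _) (hΛ _)) (show (1, n) ∈ n.divisorsAntidiagonal by simp [hn])
    simpa [ha1] using this
  have hsa : ∀ s : ℂ, 1 < s.re → LSeriesSummable (fun n => (a n : ℂ)) s := fun s hs =>
    LSeriesSummable_of_sum_norm_bigO_and_nonneg (isBigO_sum_of_abs_sub_le hθ1 hA) ha zero_le_one hs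
  have habs : ∀ s : ℂ, 1 < s.re → LSeries.abscissaOfAbsConv (fun n => (a n : ℂ)) < s.re := by
    intro s hs
    refine (LSeries.abscissaOfAbsConv_le_of_forall_lt_LSeriesSummable (x := 1) fun y hy => ?_).trans_lt
      (by exact_mod_cast hs)
    exact hsa y (by simpa using hy)
  have hsΛ : ∀ s : ℂ, 1 < s.re → LSeriesSummable (fun n => (Λ n : ℂ)) s := by
    intro s hs
    refine Summable.of_norm_bounded (LSeriesSummable_logMul_of_lt_re (habs s hs)).norm fun n => ?_
    rcases eq_or_ne n 0 with rfl | hn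
    · simp
    rw [LSeries.term_of_ne_zero hn, LSeries.term_of_ne_zero hn, norm_div, norm_div]
    gcongr
    rw [LSeries.logMul, ← Complex.ofReal_natCast, ← Complex.ofReal_log (by positivity),
      ← Complex.ofReal_mul, Complex.norm_real, Complex.norm_real,
      Real.norm_of_nonneg (hΛ n), mul_comm, Real.norm_of_nonneg
      (mul_nonneg (ha n) (Real.log_natCast_nonneg n))]
    exact hΛle n hn
  have hmul : ∀ s : ℂ, 1 < s.re → LSeries (fun n => (a n : ℂ)) s * LSeries (fun n => (Λ n : ℂ)) s =
      LSeries (LSeries.logMul (fun n => (a n : ℂ))) s := by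
    intro s hs
    rw [← LSeries_convolution' (hsa s hs) (hsΛ s hs)]
    congr 1
    rw [LSeries.convolution_def]
    ext n
    rw [LSeries.logMul, ← Complex.ofReal_natCast, ← Complex.ofReal_log (by positivity),
      ← Complex.ofReal_mul, mul_comm, ← hconv]
    push_cast; rfl
  have hd : ∀ s : ℂ, 1 < s.re → (s - 1) * deriv Z s =
      Z s * (1 - (s - 1) * LSeries (fun n => (Λ n : ℂ)) s) := by
    intro s hs
    have hev : Z =ᶠ[𝓝 s] fun s => (s - 1) * LSeries (fun n => (a n : ℂ)) s := by
      filter_upwards [(isOpen_lt continuous_const Complex.continuous_re).mem_nhds hs] with z hz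
      exact hZL z hz
    have h1 := ((hasDerivAt_id s).sub_const 1).mul (LSeries_hasDerivAt (habs s hs))
    have h2 : deriv Z s = _ := hev.deriv_eq.trans h1.deriv
    rw [h2, hZL s hs, ← hmul s hs]
    simp only [id]
    ring
  have hZne := ne_zero_of_continuation hθ1 hΛ hZ (by rw [hZ1]; exact_mod_cast hκ.ne') hsΛ hd
  refine tendsto_sum_div_of_LSeries_sub_continuousOn hΛ (K := κ + C) ?_
    (G := fun s => -(deriv Z s / Z s)) ?_ ?_
  · intro x hx
    calc ∑ n ∈ Finset.Icc 1 ⌊x⌋₊, Λ n ≤ ∑ n ∈ Finset.Icc 1 ⌊x⌋₊, a n * Real.log x := by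
          refine Finset.sum_le_sum fun n hn => ?_
          rw [Finset.mem_Icc] at hn
          refine (hΛle n (by omega)).trans ?_
          have : (n : ℝ) ≤ x := (Nat.le_floor_iff (by linarith)).1 hn.2
          have h0 : (0 : ℝ) < n := by exact_mod_cast hn.1
          have := ha n
          gcongr
      _ = (∑ n ∈ Finset.Icc 1 ⌊x⌋₊, a n) * Real.log x := by rw [Finset.sum_mul]
      _ ≤ ((κ + C) * x) * Real.log x := by
          have := Real.log_nonneg hx
          gcongr
          have h1 := le_of_abs_le (hA x hx)
          have h2 : x ^ θ ≤ x := by simpa using Real.rpow_le_rpow_of_exponent_le hx hθ1.le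
          nlinarith
      _ = _ := by ring
  · have hopen : IsOpen {s : ℂ | θ < s.re} := isOpen_lt continuous_const Complex.continuous_re
    have hAn : AnalyticOnNhd ℂ Z {s : ℂ | θ < s.re} :=
      DifferentiableOn.analyticOnNhd (fun s hs => (hZ s hs).differentiableWithinAt) hopen
    intro s hs
    have hs' : s ∈ {s : ℂ | θ < s.re} := hθ1.trans_le hs
    exact (((hAn s hs').deriv.continuousAt.div (hAn s hs').continuousAt (hZne s hs)).neg).continuousWithinAt
  · intro s hs
    have h1 := hd s hs
    have h2 := hZne s hs.le
    have h3 : s - 1 ≠ 0 := by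
      intro h
      have := congrArg Complex.re h
      simp at this
      linarith
    field_simp
    linear_combination h1

end Beurling

section LatticeCount
open MeasureTheory Module Pointwise

variable {E ι : Type*} [NormedAddCommGroup E] [NormedSpace ℝ E] [MeasurableSpace E] [BorelSpace E]
  [FiniteDimensional ℝ E] [Fintype ι]

/-- The points near which membership in `D` can change by a perturbation of size at most `δ`. -/
def perturbSet (D : Set E) (δ : ℝ) : Set E := {x | ∃ y, ‖y‖ ≤ δ ∧ ¬(x ∈ D ↔ x + y ∈ D)}

lemma measure_floor_preimage (b : Basis ι ℝ E) (μ : Measure E) [μ.IsAddHaarMeasure]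
    {D : Set E} (hD : Bornology.IsBounded D) :
    μ.real {x | (ZSpan.floor b x : E) ∈ D} =
      Nat.card ((Submodule.span ℤ (Set.range b) : Set E) ∩ D : Set E) *
        μ.real (ZSpan.fundamentalDomain b) := by
  have : ProperSpace E := FiniteDimensional.proper ℝ E
  have hfin : ((Submodule.span ℤ (Set.range b) : Set E) ∩ D).Finite := by
    rw [Set.inter_comm]; exact ZSpan.setFinite_inter b hD
  have hset : {x | (ZSpan.floor b x : E) ∈ D} =
      ⋃ l ∈ hfin.toFinset, (l +ᵥ ZSpan.fundamentalDomain b) := by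
    ext x
    simp only [Set.mem_ofPred_eq, Set.Finite.mem_toFinset, Set.mem_iUnion, exists_prop,
      Set.mem_inter_iff, SetLike.mem_coe]
    constructor
    · intro h
      refine ⟨ZSpan.floor b x, ⟨(ZSpan.floor b x).2, h⟩, ?_⟩
      exact Set.mem_vadd_set.2 ⟨ZSpan.fract b x, ZSpan.fract_mem_fundamentalDomain b x, by
        simp [ZSpan.fract_apply]⟩
    · rintro ⟨l, ⟨hl, hlD⟩, hx⟩
      obtain ⟨f, hf, rfl⟩ := Set.mem_vadd_set.1 hx
      have h1 : ZSpan.fract b (l + f) = f := by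
        rw [ZSpan.fract_zSpan_add b f hl, ZSpan.fract_eq_self.2 hf]
      rw [ZSpan.fract_apply] at h1
      have : (ZSpan.floor b (l + f) : E) = l := by
        rw [sub_eq_iff_eq_add] at h1
        rw [add_comm f] at h1
        exact (add_right_cancel h1).symm
      simpa [this] using hlD
  have htop : ∀ l ∈ hfin.toFinset, μ (l +ᵥ ZSpan.fundamentalDomain b) ≠ ⊤ := by
    intro l _
    rw [measure_vadd]
    exact (ZSpan.fundamentalDomain_isBounded b).measure_lt_top.ne
  rw [hset, measureReal_biUnion_finset (h := htop)]
  · simp_rw [measureReal_def, measure_vadd]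
    rw [Finset.sum_const, nsmul_eq_mul, Nat.card_coe_set_eq, Set.ncard_eq_toFinset_card _ hfin]
  · intro l hl m hm hlm
    simp only [Set.Finite.coe_toFinset, Set.mem_inter_iff, SetLike.mem_coe] at hl hm
    refine Set.disjoint_left.2 fun x hx hx' => hlm ?_
    obtain ⟨f, hf, rfl⟩ := Set.mem_vadd_set.1 hx
    obtain ⟨g, hg, hfg⟩ := Set.mem_vadd_set.1 hx'
    have h1 : ZSpan.fract b (l + f) = f := by
      rw [ZSpan.fract_zSpan_add b f hl.1, ZSpan.fract_eq_self.2 hf]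
    have h2 : ZSpan.fract b (m + g) = g := by
      rw [ZSpan.fract_zSpan_add b g hm.1, ZSpan.fract_eq_self.2 hg]
    simp only [vadd_eq_add] at hfg
    have : f = g := by rw [← h1, ← hfg, h2]
    subst this
    exact (add_right_cancel hfg).symm
  · intro l _
    exact (ZSpan.fundamentalDomain_measurableSet b).const_vadd l

/-- Lattice point count in dilates of a bounded set with tame boundary. -/
theorem exists_card_lattice_inter_smul_le [Nontrivial E] (b : Basis ι ℝ E) (μ : Measure E) [μ.IsAddHaarMeasure]
    {D : Set E} (hD : Bornology.IsBounded D) {C δ₀ : ℝ} (hδ₀ : 0 < δ₀)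
    (hC : ∀ δ, 0 < δ → δ ≤ δ₀ → μ (perturbSet D δ) ≤ ENNReal.ofReal (C * √δ)) :
    ∃ C', ∀ t : ℝ, 1 ≤ t →
      |(Nat.card ((Submodule.span ℤ (Set.range b) : Set E) ∩ t • D : Set E) : ℝ) -
        t ^ (finrank ℝ E) * (μ.real D / μ.real (ZSpan.fundamentalDomain b))|
        ≤ C' * (t ^ (finrank ℝ E) / √t) := by
  have : ProperSpace E := FiniteDimensional.proper ℝ E
  set Λ : Set E := (Submodule.span ℤ (Set.range b) : Set E) with hΛ
  set n := finrank ℝ E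
  set F := ZSpan.fundamentalDomain b
  set d : ℝ := ∑ i, ‖b i‖ + 1
  have hd : 0 < d := by positivity
  have hF : 0 < μ.real F := by
    rw [measureReal_def, ENNReal.toReal_pos_iff]
    exact ⟨pos_iff_ne_zero.2 (ZSpan.measure_fundamentalDomain_ne_zero b),
      (ZSpan.fundamentalDomain_isBounded b).measure_lt_top⟩
  set t₀ := max 1 (d / δ₀)
  have hlarge : ∀ t : ℝ, t₀ ≤ t → |(Nat.card (Λ ∩ t • D : Set E) : ℝ) -
        t ^ n * (μ.real D / μ.real F)| ≤ (|C| * √d / μ.real F) * (t ^ n / √t) := by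
    intro t ht
    have ht1 : 1 ≤ t := (le_max_left _ _).trans ht
    have ht0 : 0 < t := by linarith
    have htd : d / t ≤ δ₀ := by
      rw [div_le_iff₀ ht0, mul_comm, ← div_le_iff₀ hδ₀]
      exact (le_max_right _ _).trans ht
    have htD : Bornology.IsBounded (t • D) := hD.smul₀ t
    have hP := measure_floor_preimage b μ htD
    set P := {x | (ZSpan.floor b x : E) ∈ t • D}
    set T := t • perturbSet D (d / t)
    have hT : μ.real T ≤ t ^ n * (|C| * √(d / t)) := by
      rw [measureReal_def]
      refine ENNReal.toReal_le_of_le_ofReal (by positivity) ?_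
      rw [Measure.addHaar_smul, abs_of_pos (by positivity), ENNReal.ofReal_mul (by positivity)]
      gcongr
      exact (hC _ (by positivity) htd).trans (ENNReal.ofReal_le_ofReal (by gcongr; exact le_abs_self C))
    have hTfin : μ T ≠ ⊤ := by
      rw [Measure.addHaar_smul]
      exact ENNReal.mul_ne_top ENNReal.ofReal_ne_top
        ((hC _ (by positivity) htd).trans_lt ENNReal.ofReal_lt_top).ne
    have hsub : ∀ x, ¬ (x ∈ t • D ↔ x ∈ P) → x ∈ T := by
      intro x hx
      rw [Set.mem_smul_set_iff_inv_smul_mem₀ ht0.ne']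
      refine ⟨-(t⁻¹ • ZSpan.fract b x), ?_, ?_⟩
      · rw [norm_neg, norm_smul, norm_inv, Real.norm_of_nonneg ht0.le, div_eq_inv_mul]
        gcongr
        have := ZSpan.norm_fract_le b x
        simp only [d]; linarith
      · have h2 : t⁻¹ • x + -(t⁻¹ • ZSpan.fract b x) = t⁻¹ • (ZSpan.floor b x : E) := by
          rw [← smul_neg, ← smul_add, ZSpan.fract_apply]; congr 1; abel
        rw [h2, ← Set.mem_smul_set_iff_inv_smul_mem₀ ht0.ne',
          ← Set.mem_smul_set_iff_inv_smul_mem₀ ht0.ne']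
        exact hx
    have hDfin : μ (t • D) ≠ ⊤ := htD.measure_lt_top.ne
    have hPsub : P ⊆ t • D ∪ T := fun x hx => by
      by_contra h
      simp only [Set.mem_union, not_or] at h
      exact h.2 (hsub x fun h' => h.1 (h'.2 hx))
    have hDsub : t • D ⊆ P ∪ T := fun x hx => by
      by_contra h
      simp only [Set.mem_union, not_or] at h
      exact h.2 (hsub x fun h' => h.1 (h'.1 hx))
    have hPfin : μ P ≠ ⊤ := ((measure_mono hPsub).trans_lt ((measure_union_le _ _).trans_lt
      (ENNReal.add_lt_top.2 ⟨hDfin.lt_top, hTfin.lt_top⟩))).ne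
    have h1 : μ.real P ≤ μ.real (t • D) + μ.real T :=
      (measureReal_mono hPsub (measure_union_ne_top hDfin hTfin)).trans (measureReal_union_le _ _)
    have h2 : μ.real (t • D) ≤ μ.real P + μ.real T :=
      (measureReal_mono hDsub (measure_union_ne_top hPfin hTfin)).trans (measureReal_union_le _ _)
    have h3 : μ.real (t • D) = t ^ n * μ.real D := by
      rw [measureReal_def, Measure.addHaar_smul, ENNReal.toReal_mul,
        ENNReal.toReal_ofReal (abs_nonneg _), abs_of_pos (by positivity), measureReal_def]
    rw [hP, h3] at h1 h2
    have h4 : |(Nat.card (Λ ∩ t • D : Set E) : ℝ) * μ.real F - t ^ n * μ.real D|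
        ≤ t ^ n * (|C| * √(d / t)) := abs_le.2 ⟨by linarith, by linarith⟩
    have h5 : (Nat.card (Λ ∩ t • D : Set E) : ℝ) - t ^ n * (μ.real D / μ.real F) =
      ((Nat.card (Λ ∩ t • D : Set E) : ℝ) * μ.real F - t ^ n * μ.real D) / μ.real F := by
      field_simp
    rw [h5, abs_div, abs_of_pos hF, div_le_iff₀ hF]
    refine h4.trans (le_of_eq ?_)
    rw [Real.sqrt_div hd.le]
    field_simp
  obtain ⟨R, hR0, hR⟩ := hD.exists_pos_norm_le
  set B : ℝ := (Nat.card (Λ ∩ Metric.closedBall 0 (t₀ * R) : Set E) : ℝ)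
  refine ⟨max (|C| * √d / μ.real F) (B + t₀ ^ n * (μ.real D / μ.real F)), fun t ht => ?_⟩
  have ht0 : 0 < t := by linarith
  by_cases h : t₀ ≤ t
  · refine (hlarge t h).trans ?_
    gcongr
    exact le_max_left _ _
  · push Not at h
    have h1 : (Nat.card (Λ ∩ t • D : Set E) : ℝ) ≤ B := by
      have hfin : (Λ ∩ Metric.closedBall 0 (t₀ * R)).Finite := by
        rw [Set.inter_comm]; exact ZSpan.setFinite_inter b Metric.isBounded_closedBall
      simp only [B, Nat.card_coe_set_eq]
      refine Nat.cast_le.2 (Set.ncard_le_ncard (Set.inter_subset_inter_right _ ?_) hfin)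
      rintro _ ⟨x, hx, rfl⟩
      simp only [mem_closedBall_zero_iff, norm_smul, Real.norm_of_nonneg ht0.le]
      exact mul_le_mul h.le (hR x hx) (norm_nonneg _) (by linarith)
    have h2 : t ^ n * (μ.real D / μ.real F) ≤ t₀ ^ n * (μ.real D / μ.real F) := by gcongr
    have h3 : 0 ≤ t ^ n * (μ.real D / μ.real F) := by positivity
    have hB : 0 ≤ B := Nat.cast_nonneg _
    have h6 : 0 ≤ (Nat.card (Λ ∩ t • D : Set E) : ℝ) := Nat.cast_nonneg _
    have hn : n ≠ 0 := finrank_pos.ne'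
    have h8 : 1 ≤ t ^ n / √t := by
      rw [one_le_div (Real.sqrt_pos.2 ht0)]
      calc √t ≤ t := by
            rw [Real.sqrt_le_left ht0.le]; nlinarith
        _ ≤ t ^ n := le_self_pow₀ ht hn
    calc _ ≤ B + t₀ ^ n * (μ.real D / μ.real F) := abs_le.2 ⟨by linarith, by linarith⟩
      _ ≤ max (|C| * √d / μ.real F) (B + t₀ ^ n * (μ.real D / μ.real F)) * 1 := by
        rw [mul_one]; exact le_max_right _ _
      _ ≤ _ := by
        gcongr

end LatticeCount

section NormLeOne
open MeasureTheory Module Pointwise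
open NumberField.InfinitePlace NumberField.mixedEmbedding NumberField.mixedEmbedding.fundamentalCone
  NumberField.Units NumberField.Units.dirichletUnitTheorem ENNReal

variable (K : Type*) [Field K] [NumberField K]

open scoped Classical in
lemma setLIntegral_pi_exp (I : InfinitePlace K → Set ℝ) (n : ℕ) :
    ∫⁻ x : realSpace K in Set.univ.pi I, ENNReal.ofReal (Real.exp (x w₀ * n)) =
      (∫⁻ t in I w₀, ENNReal.ofReal (Real.exp (t * n))) *
        ∏ j ∈ Finset.univ.erase w₀, volume (I j) := by
  rw [volume_pi, Measure.restrict_pi_pi, lintegral_eq_lmarginal_univ 0,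
    lmarginal_erase' _ (by fun_prop) (Finset.mem_univ w₀)]
  simp_rw [Function.update_self, lmarginal, lintegral_const, Measure.pi_univ,
    Measure.restrict_apply_univ]
  congr 1
  exact Finset.prod_coe_sort (Finset.univ.erase w₀) (fun j => volume (I j))

open scoped Classical in
/-- The volume of the set of points with prescribed coordinates in the basis of fundamental
units. -/
lemma volume_preimage_expMapBasis_image {s : Set (realSpace K)} (hs : MeasurableSet s) :
    volume (normAtAllPlaces ⁻¹' (expMapBasis '' s)) =
      (2 ^ nrRealPlaces K * ENNReal.ofReal (2 * Real.pi) ^ nrComplexPlaces K *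
        ((2 : ℝ≥0∞)⁻¹ ^ nrComplexPlaces K * ENNReal.ofReal (regulator K) * (finrank ℚ K))) *
        ∫⁻ x in s, ENNReal.ofReal (Real.exp (x w₀ * finrank ℚ K)) := by
  have hm : MeasurableSet (normAtAllPlaces ⁻¹' (expMapBasis '' s) : Set (mixedSpace K)) :=
    MeasurableSet.preimage (hs.image_of_continuousOn_injOn
      (continuous_expMapBasis K).continuousOn (injective_expMapBasis K).injOn)
      (continuous_normAtAllPlaces K).measurable
  rw [volume_eq_two_pow_mul_two_pi_pow_mul_integral Set.preimage_image_preimage hm,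
    normAtAllPlaces_image_preimage_expMapBasis, setLIntegral_expMapBasis_image hs (by fun_prop)]
  simp_rw [ENNReal.inv_mul_cancel_right
    (Finset.prod_ne_zero_iff.mpr fun _ _ ↦ ofReal_ne_zero_iff.mpr (expMapBasis_pos _ _))
    (prod_ne_top fun _ _ ↦ ofReal_ne_top)]
  ring

/-- A box in logarithmic coordinates whose `i`-th side is confined to an interval of
radius `η`. -/
def shellBox (i : InfinitePlace K) (c η : ℝ) : Set (realSpace K) :=
  {z | z w₀ ≤ 1 ∧ (∀ j ≠ w₀, z j ∈ Set.Icc (-1 : ℝ) 2) ∧ |z i - c| ≤ η}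

open scoped Classical in
lemma exists_setLIntegral_shellBox_le :
    ∃ C : ℝ, 0 ≤ C ∧ ∀ (i : InfinitePlace K) (c η : ℝ), 0 ≤ η →
      MeasurableSet (shellBox K i c η) ∧
      ∫⁻ x in shellBox K i c η, ENNReal.ofReal (Real.exp (x w₀ * finrank ℚ K)) ≤
        ENNReal.ofReal (C * η) := by
  set n := finrank ℚ K
  have hn : 0 < (n : ℝ) := Nat.cast_pos.2 finrank_pos
  set A : ℝ := Real.exp n + Real.exp n / n + 3
  have hA : 0 < A := by positivity
  set m := Fintype.card (InfinitePlace K)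
  have hlin : ∫⁻ t in Set.Iic (1:ℝ), ENNReal.ofReal (Real.exp (t * n)) ≤ ENNReal.ofReal A := by
    rw [← ofReal_integral_eq_lintegral_ofReal]
    · simp_rw [mul_comm _ (n : ℝ)]
      rw [integral_exp_mul_Iic hn]
      refine ENNReal.ofReal_le_ofReal ?_
      have := Real.exp_pos n
      simp only [A, mul_one]; linarith
    · simp_rw [mul_comm _ (n : ℝ)]
      exact integrableOn_exp_mul_Iic hn _
    · exact Filter.Eventually.of_forall fun _ => (Real.exp_pos _).le
  refine ⟨2 * A * A ^ (m - 1), by positivity, fun i c η hη => ?_⟩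
  set I : InfinitePlace K → Set ℝ := fun j =>
    (if j = w₀ then Set.Iic 1 else Set.Icc (-1) 2) ∩ (if j = i then Set.Icc (c - η) (c + η) else Set.univ)
  have hI : shellBox K i c η = Set.univ.pi I := by
    ext z
    simp only [shellBox, Set.mem_ofPred_eq, Set.mem_univ_pi, I, Set.mem_inter_iff]
    constructor
    · rintro ⟨h0, h1, h2⟩ j
      constructor
      · split_ifs with h
        · subst h; exact h0
        · exact h1 j h
      · split_ifs with h
        · subst h
          rw [abs_le] at h2
          exact ⟨by linarith, by linarith⟩
        · trivial
    · intro h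
      refine ⟨by simpa using (h w₀).1, fun j hj => by simpa [hj] using (h j).1, ?_⟩
      have := (h i).2
      rw [if_pos rfl, Set.mem_Icc] at this
      exact abs_le.2 ⟨by linarith, by linarith⟩
  have hImeas : ∀ j, MeasurableSet (I j) := fun j => by
    simp only [I]
    refine MeasurableSet.inter ?_ ?_ <;> split_ifs <;> measurability
  rw [hI]
  refine ⟨MeasurableSet.univ_pi hImeas, ?_⟩
  rw [setLIntegral_pi_exp]
  set g : InfinitePlace K → ℝ≥0∞ := fun j =>
    if j = w₀ then ∫⁻ t in I w₀, ENNReal.ofReal (Real.exp (t * n)) else volume (I j)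
  have hprod : (∫⁻ t in I w₀, ENNReal.ofReal (Real.exp (t * n))) *
        ∏ j ∈ Finset.univ.erase w₀, volume (I j) = ∏ j, g j := by
    rw [← Finset.mul_prod_erase _ _ (Finset.mem_univ w₀)]
    congr 1
    · simp [g]
    · refine Finset.prod_congr rfl fun j hj => ?_
      simp [g, Finset.ne_of_mem_erase hj]
  rw [hprod]
  have hgA : ∀ j, g j ≤ ENNReal.ofReal A := by
    intro j
    simp only [g]
    split_ifs with h
    · refine le_trans (lintegral_mono_set ?_) hlin
      simp only [I, if_true]
      exact Set.inter_subset_left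
    · calc volume (I j) ≤ volume (Set.Icc (-1:ℝ) 2) := by
            refine measure_mono ?_
            simp only [I, h, if_false]
            exact Set.inter_subset_left
        _ ≤ _ := by
          rw [Real.volume_Icc]
          refine ENNReal.ofReal_le_ofReal ?_
          have := Real.exp_pos n
          have : 0 < Real.exp n / n := by positivity
          simp only [A]; linarith
  have hgi : g i ≤ ENNReal.ofReal (2 * A * η) := by
    have hvol : volume (I i) ≤ ENNReal.ofReal (2 * η) := by
      calc volume (I i) ≤ volume (Set.Icc (c - η) (c + η)) := by
            refine measure_mono ?_
            simp only [I, if_true]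
            exact Set.inter_subset_right
        _ = _ := by rw [Real.volume_Icc]; ring_nf
    simp only [g]
    split_ifs with h
    · calc ∫⁻ t in I w₀, ENNReal.ofReal (Real.exp (t * n))
          ≤ ∫⁻ t in I w₀, ENNReal.ofReal A := by
            refine setLIntegral_mono measurable_const fun t ht => ENNReal.ofReal_le_ofReal ?_
            have ht1 : t ≤ 1 := by
              have := ht.1
              simpa using this
            calc Real.exp (t * n) ≤ Real.exp n := Real.exp_le_exp.2 (by nlinarith)
              _ ≤ A := by
                have : 0 < Real.exp n / n := by positivity
                simp only [A]; linarith
        _ = ENNReal.ofReal A * volume (I w₀) := by rw [setLIntegral_const]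
        _ ≤ ENNReal.ofReal A * ENNReal.ofReal (2 * η) := by
          subst h; gcongr
        _ = _ := by rw [← ENNReal.ofReal_mul hA.le]; ring_nf
    · refine hvol.trans (ENNReal.ofReal_le_ofReal ?_)
      have : 1 ≤ A := by
        have := Real.exp_pos n
        have : 0 < Real.exp n / n := by positivity
        simp only [A]; linarith
      nlinarith
  rw [← Finset.mul_prod_erase _ _ (Finset.mem_univ i)]
  have hrest : ∏ j ∈ Finset.univ.erase i, g j ≤ ENNReal.ofReal (A ^ (m - 1)) := by
    refine (Finset.prod_le_pow_card _ _ _ fun j _ => hgA j).trans ?_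
    rw [Finset.card_erase_of_mem (Finset.mem_univ i), Finset.card_univ, ENNReal.ofReal_pow hA.le]
  calc g i * ∏ j ∈ Finset.univ.erase i, g j
      ≤ ENNReal.ofReal (2 * A * η) * ENNReal.ofReal (A ^ (m - 1)) := by gcongr
    _ = _ := by
      rw [← ENNReal.ofReal_mul (by positivity)]
      ring_nf

open scoped Classical in
lemma exists_volume_shellBox_le :
    ∃ C : ℝ, 0 ≤ C ∧ ∀ (i : InfinitePlace K) (c η : ℝ), 0 ≤ η →
      volume (normAtAllPlaces ⁻¹' (expMapBasis '' shellBox K i c η)) ≤ ENNReal.ofReal (C * η) := by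
  obtain ⟨C, hC0, hC⟩ := exists_setLIntegral_shellBox_le K
  set c₀ : ℝ≥0∞ := 2 ^ nrRealPlaces K * ENNReal.ofReal (2 * Real.pi) ^ nrComplexPlaces K *
        ((2 : ℝ≥0∞)⁻¹ ^ nrComplexPlaces K * ENNReal.ofReal (regulator K) * (finrank ℚ K))
    with hc₀_def
  have hc₀ : c₀ ≠ ⊤ := by finiteness
  refine ⟨c₀.toReal * C, by positivity, fun i c η hη => ?_⟩
  obtain ⟨hm, hle⟩ := hC i c η hη
  rw [volume_preimage_expMapBasis_image K hm, ← hc₀_def]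
  calc _ ≤ ENNReal.ofReal c₀.toReal * ENNReal.ofReal (C * η) := by
        rw [ENNReal.ofReal_toReal hc₀]; gcongr
    _ = _ := by rw [← ENNReal.ofReal_mul (by positivity)]; ring_nf

end NormLeOne

section NormLeOne
open MeasureTheory Module Pointwise
open NumberField.InfinitePlace NumberField.mixedEmbedding NumberField.mixedEmbedding.fundamentalCone
  NumberField.Units NumberField.Units.dirichletUnitTheorem ENNReal

variable (K : Type*) [Field K] [NumberField K]

lemma exists_expMapBasis_bounds :
    ∃ c B : ℝ, 0 < c ∧ 0 < B ∧ ∀ z : realSpace K, (∀ j ≠ w₀, z j ∈ Set.Icc (0 : ℝ) 1) → ∀ w,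
      c * Real.exp (z w₀) ≤ expMapBasis z w ∧ expMapBasis z w ≤ B * Real.exp (z w₀) := by
  classical
  set S : Set (realSpace K) := Set.univ.pi fun w ↦ if w = w₀ then {0} else Set.Icc 0 1
  have hS : IsCompact S := isCompact_univ_pi fun w => by
    split_ifs
    · exact isCompact_singleton
    · exact isCompact_Icc
  have hne : S.Nonempty := Set.univ_pi_nonempty_iff.2 fun w => by
    split_ifs
    · exact Set.singleton_nonempty _
    · exact Set.nonempty_Icc.2 zero_le_one
  have hcont : ∀ w, ContinuousOn (fun z => expMapBasis (K := K) z w) S := fun w =>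
    ((continuous_apply w).comp (continuous_expMapBasis K)).continuousOn
  choose a ha hamin using fun w => hS.exists_isMinOn hne (hcont w)
  choose b hb hbmax using fun w => hS.exists_isMaxOn hne (hcont w)
  obtain ⟨w1, -, hw1⟩ := Finset.univ.exists_min_image (fun w => expMapBasis (a w) w)
    ⟨w₀, Finset.mem_univ _⟩
  obtain ⟨w2, -, hw2⟩ := Finset.univ.exists_max_image (fun w => expMapBasis (b w) w)
    ⟨w₀, Finset.mem_univ _⟩
  refine ⟨_, _, expMapBasis_pos (a w1) w1, expMapBasis_pos (b w2) w2, fun z hz w => ?_⟩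
  rw [expMapBasis_apply'' z, Pi.smul_apply, smul_eq_mul, mul_comm _ (Real.exp _), mul_comm _ (Real.exp _)]
  have hmem : (fun i => if i = w₀ then 0 else z i) ∈ S := by
    intro i _
    by_cases h : i = w₀
    · simp [h]
    · simpa [h] using hz i h
  constructor
  · gcongr
    exact (hw1 w (Finset.mem_univ _)).trans (hamin w hmem)
  · gcongr
    exact (hbmax w hmem).trans (hw2 w (Finset.mem_univ _))

lemma exists_completeBasis_equivFun_le :
    ∃ M : ℝ, 0 < M ∧ ∀ (u : realSpace K) (ε : ℝ), 0 ≤ ε → (∀ w, |u w| ≤ ε) → ∀ i,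
      |(completeBasis K).equivFun u i| ≤ M * ε := by
  refine ⟨‖((completeBasis K).equivFunL : realSpace K →L[ℝ] realSpace K)‖ + 1, by positivity,
    fun u ε hε hu i => ?_⟩
  have h1 : ‖u‖ ≤ ε := (pi_norm_le_iff_of_nonneg hε).2 hu
  calc |(completeBasis K).equivFun u i| ≤ ‖(completeBasis K).equivFun u‖ :=
        norm_le_pi_norm (f := (completeBasis K).equivFun u) i
    _ ≤ ‖((completeBasis K).equivFunL : realSpace K →L[ℝ] realSpace K)‖ * ‖u‖ :=
        ((completeBasis K).equivFunL : realSpace K →L[ℝ] realSpace K).le_opNorm u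
    _ ≤ _ := by gcongr; linarith

variable {K}

open scoped Classical in
lemma normAtPlace_le_norm (w : InfinitePlace K) (x : mixedSpace K) : normAtPlace w x ≤ ‖x‖ := by
  rw [norm_eq_sup'_normAtPlace]
  exact Finset.le_sup' (fun w => normAtPlace w x) (Finset.mem_univ w)

open scoped Classical in
lemma abs_normAtPlace_sub_le (w : InfinitePlace K) (x y : mixedSpace K) :
    |normAtPlace w x - normAtPlace w y| ≤ ‖x - y‖ := by
  rw [abs_le]
  have h1 := normAtPlace_add_le w (x - y) y
  have h2 := normAtPlace_add_le w (y - x) x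
  have h3 := normAtPlace_le_norm w (x - y)
  have h4 := normAtPlace_le_norm w (y - x)
  rw [norm_sub_rev] at h4
  simp only [sub_add_cancel] at h1 h2
  constructor <;> linarith

lemma mem_normLeOne_iff_symm_mem {x : mixedSpace K} (hx : ∀ w, 0 < normAtPlace w x) :
    x ∈ normLeOne K ↔ expMapBasis.symm (normAtAllPlaces x) ∈ paramSet K := by
  have h : expMapBasis (expMapBasis.symm (normAtAllPlaces x)) = normAtAllPlaces x :=
    expMapBasis.right_inv (Set.mem_univ_pi.mpr hx)
  rw [normLeOne_eq_preimage, Set.mem_preimage]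
  conv_lhs => rw [← h]
  exact (injective_expMapBasis K).mem_set_image

lemma abs_log_sub_log_le {a b m : ℝ} (hm : 0 < m) (ha : m ≤ a) (hb : m ≤ b) :
    |Real.log a - Real.log b| ≤ |a - b| / m := by
  have key : ∀ a b : ℝ, m ≤ a → m ≤ b → Real.log a - Real.log b ≤ |a - b| / m := by
    intro a b ha hb
    have ha0 := hm.trans_le ha
    have hb0 := hm.trans_le hb
    rw [← Real.log_div ha0.ne' hb0.ne']
    calc Real.log (a / b) ≤ a / b - 1 := Real.log_le_sub_one_of_pos (by positivity)
      _ = (a - b) / b := by field_simp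
      _ ≤ |a - b| / b := by gcongr; exact le_abs_self _
      _ ≤ _ := by gcongr
  rw [abs_le]
  refine ⟨?_, key a b ha hb⟩
  have := key b a hb ha
  rw [abs_sub_comm] at this
  linarith

variable (K)

open scoped Classical in
lemma exists_shellBox_of_close :
    ∃ B M δ₀ : ℝ, 0 < B ∧ 0 < M ∧ 0 < δ₀ ∧ ∀ δ, 0 < δ → δ ≤ δ₀ → ∀ z z' : mixedSpace K,
      ‖z - z'‖ ≤ δ → z ∈ normLeOne K → z' ∉ normLeOne K → ‖z‖ ≤ B * √δ ∨
      ∃ i, ∃ c ∈ ({0, 1} : Finset ℝ),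
        z ∈ normAtAllPlaces ⁻¹' (expMapBasis '' shellBox K i c (M * √δ)) ∧
        z' ∈ normAtAllPlaces ⁻¹' (expMapBasis '' shellBox K i c (M * √δ)) := by
  obtain ⟨c, B, hc, hB, hcB⟩ := exists_expMapBasis_bounds K
  obtain ⟨M₀, hM₀, hM⟩ := exists_completeBasis_equivFun_le K
  set M := M₀ * (4 / c)
  have hMpos : 0 < M := by positivity
  refine ⟨B, M, (min (c / 2) (1 / M)) ^ 2, hB, hMpos, by positivity,
    fun δ hδ hδ' z z' hzz' hz hz' => ?_⟩
  have hsq : √δ ≤ min (c / 2) (1 / M) := by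
    rw [Real.sqrt_le_left (by positivity)]; exact hδ'
  have hsq1 : √δ ≤ c / 2 := hsq.trans (min_le_left _ _)
  have hsq2 : M * √δ ≤ 1 := by
    have := hsq.trans (min_le_right _ _)
    rwa [le_div_iff₀ hMpos, mul_comm] at this
  have hs0 : 0 < √δ := Real.sqrt_pos.2 hδ
  have hss : √δ * √δ = δ := Real.mul_self_sqrt hδ.le
  have hzpos : ∀ w, 0 < normAtPlace w z := fun w => normAtPlace_pos_of_mem hz.1 w
  set q := expMapBasis.symm (normAtAllPlaces z) with hq
  have hqz : expMapBasis q = normAtAllPlaces z :=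
    expMapBasis.right_inv (Set.mem_univ_pi.mpr hzpos)
  have hqmem : q ∈ paramSet K := (mem_normLeOne_iff_symm_mem hzpos).1 hz
  have hq0 : q w₀ ≤ 0 := by simpa using hqmem w₀ (Set.mem_univ _)
  have hqj : ∀ j ≠ w₀, q j ∈ Set.Ico (0 : ℝ) 1 := fun j hj => by
    simpa [hj] using hqmem j (Set.mem_univ _)
  have hbd := hcB q fun j hj => ⟨(hqj j hj).1, (hqj j hj).2.le⟩
  rw [hqz] at hbd
  by_cases hsmall : Real.exp (q w₀) ≤ √δ
  · left
    rw [norm_eq_sup'_normAtPlace]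
    refine Finset.sup'_le _ _ fun w _ => ((hbd w).2.trans ?_)
    gcongr
  right
  push Not at hsmall
  have hlow : ∀ w, c * √δ ≤ normAtPlace w z := fun w => le_trans (by gcongr) (hbd w).1
  have hdiff : ∀ w, |normAtPlace w z' - normAtPlace w z| ≤ δ := fun w =>
    (abs_normAtPlace_sub_le w z' z).trans (by rw [norm_sub_rev]; exact hzz')
  have hlow' : ∀ w, c / 2 * √δ ≤ normAtPlace w z' := fun w => by
    have h1 := (abs_le.1 (hdiff w)).1
    have h2 := hlow w
    nlinarith
  have hz'pos : ∀ w, 0 < normAtPlace w z' := fun w => lt_of_lt_of_le (by positivity) (hlow' w)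
  set q' := expMapBasis.symm (normAtAllPlaces z') with hq'
  have hqz' : expMapBasis q' = normAtAllPlaces z' :=
    expMapBasis.right_inv (Set.mem_univ_pi.mpr hz'pos)
  have hqmem' : q' ∉ paramSet K := fun h => hz' ((mem_normLeOne_iff_symm_mem hz'pos).2 h)
  have hqq : ∀ i, |q' i - q i| ≤ M * √δ := by
    intro i
    have h1 : q' - q = (completeBasis K).equivFun
        (expMap.symm (normAtAllPlaces z') - expMap.symm (normAtAllPlaces z)) := by
      rw [map_sub]; rfl
    have h2 := hM (expMap.symm (normAtAllPlaces z') - expMap.symm (normAtAllPlaces z))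
      (4 / c * √δ) (by positivity) (fun w => by
        rw [Pi.sub_apply, expMap_symm_apply, expMap_symm_apply, ← mul_sub, abs_mul, Nat.abs_cast]
        have hm : (w.mult : ℝ) ≤ 2 := by
          rw [mult]; split_ifs <;> norm_num
        have hl := abs_log_sub_log_le (m := c / 2 * √δ) (by positivity) (hlow' w)
          ((by nlinarith : c / 2 * √δ ≤ c * √δ).trans (hlow w))
        calc (w.mult : ℝ) * |Real.log (normAtPlace w z') - Real.log (normAtPlace w z)|
            ≤ 2 * (δ / (c / 2 * √δ)) := by
              gcongr
              exact hl.trans (by gcongr; exact hdiff w)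
          _ = 4 / c * √δ := by
              nth_rewrite 1 [← hss]; field_simp; norm_num) i
    rw [← h1, ← mul_assoc] at h2
    exact h2
  obtain ⟨i, hi⟩ : ∃ i, q' i ∉ (if i = w₀ then Set.Iic (0:ℝ) else Set.Ico 0 1) := by
    simpa [paramSet, Set.mem_univ_pi] using hqmem'
  have hbox : ∀ b : ℝ, |q i - b| ≤ M * √δ → |q' i - b| ≤ M * √δ →
      z ∈ normAtAllPlaces ⁻¹' (expMapBasis '' shellBox K i b (M * √δ)) ∧
      z' ∈ normAtAllPlaces ⁻¹' (expMapBasis '' shellBox K i b (M * √δ)) := by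
    intro b hb hb'
    refine ⟨⟨q, ⟨by linarith, fun j hj => ⟨by linarith [(hqj j hj).1], by linarith [(hqj j hj).2]⟩,
      hb⟩, hqz⟩, ⟨q', ⟨?_, fun j hj => ?_, hb'⟩, hqz'⟩⟩
    · have := abs_le.1 (hqq w₀); linarith [this.2]
    · have h1 := abs_le.1 (hqq j)
      have h2 := hqj j hj
      exact ⟨by linarith [h1.1, h2.1], by linarith [h1.2, h2.2]⟩
  have hqi := abs_le.1 (hqq i)
  refine ⟨i, ?_⟩
  by_cases h : i = w₀
  · subst h
    simp only [if_true, Set.mem_Iic, not_le] at hi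
    exact ⟨0, by simp, hbox 0 (abs_le.2 ⟨by linarith [hqi.2], by linarith⟩)
      (abs_le.2 ⟨by linarith, by linarith [hqi.2]⟩)⟩
  · have hi' := hqj i h
    simp only [h, if_false, Set.mem_Ico, not_and_or, not_le, not_lt] at hi
    rcases hi with hi | hi
    · exact ⟨0, by simp, hbox 0 (abs_le.2 ⟨by linarith [hi'.1], by linarith [hqi.1]⟩)
        (abs_le.2 ⟨by linarith [hi'.1, hqi.1], by linarith⟩)⟩
    · exact ⟨1, by simp, hbox 1 (abs_le.2 ⟨by linarith [hqi.2], by linarith [hi'.2]⟩)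
        (abs_le.2 ⟨by linarith, by linarith [hi'.2, hqi.2]⟩)⟩

end NormLeOne

section NormLeOne
open MeasureTheory Module Pointwise
open NumberField.InfinitePlace NumberField.mixedEmbedding NumberField.mixedEmbedding.fundamentalCone
  NumberField.Units NumberField.Units.dirichletUnitTheorem ENNReal

variable (K : Type*) [Field K] [NumberField K]

open scoped Classical in
lemma exists_volume_perturbSet_normLeOne_le :
    ∃ C δ₀ : ℝ, 0 < δ₀ ∧ ∀ δ, 0 < δ → δ ≤ δ₀ →
      volume (perturbSet (normLeOne K) δ) ≤ ENNReal.ofReal (C * √δ) := by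
  obtain ⟨B, M, δ₀, hB, hM, hδ₀, h⟩ := exists_shellBox_of_close K
  obtain ⟨C, hC0, hC⟩ := exists_volume_shellBox_le K
  set V : ℝ := (volume (Metric.ball (0 : mixedSpace K) 1)).toReal
  have hV : 0 ≤ V := ENNReal.toReal_nonneg
  have hVfin : volume (Metric.ball (0 : mixedSpace K) 1) ≠ ⊤ := measure_ball_lt_top.ne
  set n := finrank ℝ (mixedSpace K) with hn
  have hn0 : n ≠ 0 := finrank_pos.ne'
  set m : ℝ := (Fintype.card (InfinitePlace K) : ℝ)
  refine ⟨(B + 1) ^ n * V + 2 * m * (C * M), min δ₀ 1, by positivity, fun δ hδ hδ' => ?_⟩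
  have hs0 : 0 < √δ := Real.sqrt_pos.2 hδ
  have hs1 : √δ ≤ 1 := by
    rw [Real.sqrt_le_left zero_le_one, one_pow]; exact hδ'.trans (min_le_right _ _)
  have hδs : δ ≤ √δ := by
    have := Real.mul_self_sqrt hδ.le
    nlinarith
  have hsub : perturbSet (normLeOne K) δ ⊆ Metric.closedBall 0 ((B + 1) * √δ) ∪
      ⋃ i ∈ (Finset.univ : Finset (InfinitePlace K)), ⋃ c ∈ ({0, 1} : Finset ℝ),
        normAtAllPlaces ⁻¹' (expMapBasis '' shellBox K i c (M * √δ)) := by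
    rintro x ⟨y, hy, hxy⟩
    by_cases hx : x ∈ normLeOne K
    · have hx' : x + y ∉ normLeOne K := fun h' => hxy ⟨fun _ => h', fun _ => hx⟩
      rcases h δ hδ (hδ'.trans (min_le_left _ _)) x (x + y) (by simpa using hy) hx hx' with
        h1 | ⟨i, c, hc, h1, -⟩
      · left
        rw [mem_closedBall_zero_iff]
        nlinarith
      · right
        simp only [Set.mem_iUnion]
        exact ⟨i, Finset.mem_univ _, c, hc, h1⟩
    · have hx' : x + y ∈ normLeOne K := by
        by_contra h'
        exact hxy ⟨fun h => absurd h hx, fun h => absurd h h'⟩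
      rcases h δ hδ (hδ'.trans (min_le_left _ _)) (x + y) x (by simpa using hy) hx' hx with
        h1 | ⟨i, c, hc, -, h1⟩
      · left
        rw [mem_closedBall_zero_iff]
        have : ‖x‖ ≤ ‖x + y‖ + ‖y‖ := by
          have := norm_sub_le (x + y) y
          simpa using this
        nlinarith
      · right
        simp only [Set.mem_iUnion]
        exact ⟨i, Finset.mem_univ _, c, hc, h1⟩
  refine (measure_mono hsub).trans ((measure_union_le _ _).trans ?_)
  rw [add_mul ((B + 1) ^ n * V), ENNReal.ofReal_add (by positivity) (by positivity)]
  refine add_le_add ?_ ?_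
  · rw [Measure.addHaar_closedBall _ _ (by positivity)]
    rw [← ENNReal.ofReal_toReal hVfin, ← ENNReal.ofReal_mul (by positivity)]
    refine ENNReal.ofReal_le_ofReal ?_
    rw [mul_pow]
    have : √δ ^ n ≤ √δ := pow_le_of_le_one hs0.le hs1 hn0
    calc (B + 1) ^ n * √δ ^ n * V ≤ (B + 1) ^ n * √δ * V := by gcongr
      _ = _ := by ring
  · calc _ ≤ ∑ i ∈ (Finset.univ : Finset (InfinitePlace K)), ∑ c ∈ ({0, 1} : Finset ℝ),
        volume (normAtAllPlaces ⁻¹' (expMapBasis '' shellBox K i c (M * √δ))) := by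
          refine (measure_biUnion_finset_le _ _).trans (Finset.sum_le_sum fun i _ => ?_)
          exact measure_biUnion_finset_le _ _
      _ ≤ ∑ i ∈ (Finset.univ : Finset (InfinitePlace K)), ∑ c ∈ ({0, 1} : Finset ℝ),
        ENNReal.ofReal (C * (M * √δ)) := by
          gcongr with i _ c _
          exact hC i c _ (by positivity)
      _ = _ := by
        simp only [Finset.sum_const, nsmul_eq_mul, Finset.card_univ]
        rw [Finset.card_pair (by norm_num), ← ENNReal.ofReal_natCast, ← ENNReal.ofReal_natCast,
          ← ENNReal.ofReal_mul (by positivity), ← ENNReal.ofReal_mul (by positivity)]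
        congr 1
        push_cast
        ring

end NormLeOne

section IdealCount
open MeasureTheory Module Pointwise
open NumberField.InfinitePlace NumberField.mixedEmbedding NumberField.mixedEmbedding.fundamentalCone
  NumberField.Units NumberField.Units.dirichletUnitTheorem nonZeroDivisors

variable (K : Type*) [Field K] [NumberField K]

variable {K} in
lemma card_mk0_eq_card_isPrincipal {C : ClassGroup (𝓞 K)} {J : (Ideal (𝓞 K))⁰} {s : ℝ}
    (hJ : ClassGroup.mk0 J = C⁻¹) :
    Nat.card {I : (Ideal (𝓞 K))⁰ // Ideal.absNorm (I : Ideal (𝓞 K)) ≤ s ∧ ClassGroup.mk0 I = C}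
      = Nat.card {I : (Ideal (𝓞 K))⁰ // (J : Ideal (𝓞 K)) ∣ I ∧
        Submodule.IsPrincipal (I : Ideal (𝓞 K)) ∧
        Ideal.absNorm (I : Ideal (𝓞 K)) ≤ s * Ideal.absNorm (J : Ideal (𝓞 K))} := by
  simp_rw [← nonZeroDivisors_dvd_iff_dvd_coe]
  refine Nat.card_congr ?_
  refine ((Equiv.dvd J).subtypeEquiv fun I ↦ ?_).trans
    (Equiv.subtypeSubtypeEquivSubtypeInter (fun I : (Ideal (𝓞 K))⁰ ↦ J ∣ I) _)
  rw [← ClassGroup.mk0_eq_one_iff (SetLike.coe_mem _)]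
  simp_rw [Equiv.dvd_apply, Submonoid.coe_mul, ← Submonoid.mul_def, _root_.map_mul, hJ,
    inv_mul_eq_one, Nat.cast_mul, mul_comm s, eq_comm, and_comm, and_congr_left_iff]
  exact fun _ ↦ (mul_le_mul_iff_of_pos_left
    (Nat.cast_pos.mpr (Ideal.absNorm_pos_of_nonZeroDivisors J))).symm

lemma mem_smul_normLeOne_iff {t : ℝ} (ht : 0 < t) (x : mixedSpace K) :
    x ∈ t • normLeOne K ↔
      x ∈ fundamentalCone K ∧ mixedEmbedding.norm x ≤ t ^ finrank ℚ K := by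
  rw [Set.mem_smul_set_iff_inv_smul_mem₀ ht.ne', mem_normLeOne, smul_mem_iff_mem (inv_ne_zero ht.ne'),
    mixedEmbedding.norm_smul, abs_of_pos (inv_pos.2 ht), inv_pow, inv_mul_le_iff₀ (by positivity),
    mul_one]

open scoped Classical in
lemma exists_card_class_sub_le (C : ClassGroup (𝓞 K)) :
    ∃ κ B : ℝ, ∀ s : ℝ, 1 ≤ s →
      |(Nat.card {I : (Ideal (𝓞 K))⁰ // Ideal.absNorm (I : Ideal (𝓞 K)) ≤ s ∧
        ClassGroup.mk0 I = C} : ℝ) - κ * s| ≤ B * s ^ (1 - 1 / (2 * (finrank ℚ K : ℝ))) := by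
  obtain ⟨J, hJ⟩ := ClassGroup.mk0_surjective C⁻¹
  obtain ⟨D, δ₀, hδ₀, hD⟩ := exists_volume_perturbSet_normLeOne_le K
  have : Nontrivial (mixedSpace K) := inferInstance
  obtain ⟨C', hC'⟩ := exists_card_lattice_inter_smul_le
    (fractionalIdealLatticeBasis K (FractionalIdeal.mk0 K J)) volume
    (isBounded_normLeOne K) hδ₀ hD
  rw [mixedEmbedding.finrank] at hC'
  set n := finrank ℚ K
  have hn : 0 < n := finrank_pos
  have hn' : (0 : ℝ) < n := Nat.cast_pos.2 hn
  set v : ℝ := volume.real (normLeOne K) / volume.real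
    (ZSpan.fundamentalDomain (fractionalIdealLatticeBasis K (FractionalIdeal.mk0 K J)))
  set N : ℝ := (Ideal.absNorm (J : Ideal (𝓞 K)) : ℝ)
  have hN : 1 ≤ N := by
    exact Nat.one_le_cast.2 (Nat.one_le_iff_ne_zero.2
      (Ideal.absNorm_ne_zero_of_nonZeroDivisors J))
  have hw : (0 : ℝ) < torsionOrder K := Nat.cast_pos.2 (torsionOrder_pos K)
  refine ⟨N * v / torsionOrder K, C' * N ^ (1 - 1 / (2 * (n : ℝ))) / torsionOrder K,
    fun s hs => ?_⟩
  have hsN : 1 ≤ s * N := one_le_mul_of_one_le_of_one_le hs hN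
  set t : ℝ := (s * N) ^ (1 / (n : ℝ))
  have ht1 : 1 ≤ t := Real.one_le_rpow hsN (by positivity)
  have ht0 : 0 < t := by linarith
  have htn : t ^ n = s * N := by
    rw [← Real.rpow_natCast, ← Real.rpow_mul (by linarith), one_div, inv_mul_cancel₀ hn'.ne',
      Real.rpow_one]
  have htsq : t ^ n / √t = s ^ (1 - 1 / (2 * (n : ℝ))) * N ^ (1 - 1 / (2 * (n : ℝ))) := by
    rw [htn, Real.sqrt_eq_rpow, ← Real.rpow_mul (by linarith), ← Real.mul_rpow (by linarith)
      (by linarith), Real.rpow_sub (by linarith), Real.rpow_one]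
    congr 2
    field_simp
  have hcard : Nat.card (((Submodule.span ℤ (Set.range
      (fractionalIdealLatticeBasis K (FractionalIdeal.mk0 K J))) : Set (mixedSpace K))) ∩
        t • normLeOne K : Set (mixedSpace K)) =
      Nat.card {I : (Ideal (𝓞 K))⁰ // Ideal.absNorm (I : Ideal (𝓞 K)) ≤ s ∧
        ClassGroup.mk0 I = C} * torsionOrder K := by
    rw [card_mk0_eq_card_isPrincipal hJ, card_isPrincipal_dvd_norm_le]
    refine Nat.card_congr ((Equiv.subtypeEquivProp ?_).trans
      (Equiv.subtypeSubtypeEquivSubtypeInter _ (mixedEmbedding.norm · ≤ s * N)).symm)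
    ext x
    rw [span_idealLatticeBasis, Set.mem_inter_iff, mem_smul_normLeOne_iff K ht0, htn,
      SetLike.mem_coe, idealSet, Set.mem_inter_iff, SetLike.mem_coe]
    tauto
  have key := hC' t ht1
  rw [hcard, htsq, htn] at key
  push_cast at key
  set c : ℝ := (Nat.card {I : (Ideal (𝓞 K))⁰ // Ideal.absNorm (I : Ideal (𝓞 K)) ≤ s ∧
        ClassGroup.mk0 I = C} : ℝ)
  have h5 : c - N * v / torsionOrder K * s = (c * torsionOrder K - s * N * v) / torsionOrder K := by
    field_simp
  rw [h5, abs_div, abs_of_pos hw, div_le_iff₀ hw]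
  refine key.trans (le_of_eq ?_)
  field_simp

/-- Counting ideals of bounded norm with a power-saving error term. -/
theorem exists_card_ideal_sub_le :
    ∃ κ B : ℝ, 0 < κ ∧ ∀ s : ℝ, 1 ≤ s →
      |(Nat.card {I : (Ideal (𝓞 K))⁰ // Ideal.absNorm (I : Ideal (𝓞 K)) ≤ s} : ℝ) - κ * s|
        ≤ B * s ^ (1 - 1 / (2 * (finrank ℚ K : ℝ))) := by
  classical
  choose κ B hB using exists_card_class_sub_le K
  have hn' : (0 : ℝ) < finrank ℚ K := Nat.cast_pos.2 finrank_pos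
  have hmain : ∀ s : ℝ, 1 ≤ s →
      |(Nat.card {I : (Ideal (𝓞 K))⁰ // Ideal.absNorm (I : Ideal (𝓞 K)) ≤ s} : ℝ) -
        (∑ C, κ C) * s| ≤ (∑ C, B C) * s ^ (1 - 1 / (2 * (finrank ℚ K : ℝ))) := by
    intro s hs
    have hs0 : 0 ≤ s := by linarith
    have : Fintype {I : (Ideal (𝓞 K))⁰ // Ideal.absNorm (I : Ideal (𝓞 K)) ≤ s} := by
      simp_rw [← Nat.le_floor_iff hs0]
      exact @Fintype.ofFinite _ (Ideal.finite_setOfPred_absNorm_le₀ ⌊s⌋₊)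
    have hsum : (Nat.card {I : (Ideal (𝓞 K))⁰ // Ideal.absNorm (I : Ideal (𝓞 K)) ≤ s} : ℝ) =
        ∑ C, (Nat.card {I : (Ideal (𝓞 K))⁰ // Ideal.absNorm (I : Ideal (𝓞 K)) ≤ s ∧
        ClassGroup.mk0 I = C} : ℝ) := by
      let e := fun C : ClassGroup (𝓞 K) ↦ Equiv.subtypeSubtypeEquivSubtypeInter
        (fun I : (Ideal (𝓞 K))⁰ ↦ (Ideal.absNorm I.1 : ℝ) ≤ s) (fun I ↦ ClassGroup.mk0 I = C)
      simp_rw [← Nat.card_congr (e _), Nat.card_eq_fintype_card, Fintype.subtype_card]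
      rw [Fintype.card, Finset.card_eq_sum_card_fiberwise (f := fun I ↦ ClassGroup.mk0 I.1)
        (t := Finset.univ) (fun _ _ ↦ Finset.mem_univ _), Nat.cast_sum]
    rw [hsum, Finset.sum_mul, Finset.sum_mul, ← Finset.sum_sub_distrib]
    exact (Finset.abs_sum_le_sum_abs _ _).trans (Finset.sum_le_sum fun C _ => hB C s hs)
  refine ⟨∑ C, κ C, ∑ C, B C, ?_, hmain⟩
  have hlim := Ideal.tendsto_norm_le_div_atTop₀ K
  have hlim2 : Tendsto (fun s : ℝ => (Nat.card {I : (Ideal (𝓞 K))⁰ //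
      Ideal.absNorm (I : Ideal (𝓞 K)) ≤ s} : ℝ) / s) atTop (𝓝 (∑ C, κ C)) := by
    rw [tendsto_iff_norm_sub_tendsto_zero]
    have h0 : Tendsto (fun s : ℝ => (∑ C, B C) * s ^ (-(1 / (2 * (finrank ℚ K : ℝ))))) atTop (𝓝 0) := by
      simpa using (tendsto_rpow_neg_atTop (y := 1 / (2 * (finrank ℚ K : ℝ)))
        (by positivity)).const_mul (∑ C, B C)
    refine squeeze_zero' (Eventually.of_forall fun _ => norm_nonneg _) ?_ h0
    filter_upwards [eventually_ge_atTop 1] with s hs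
    have hs0 : 0 < s := by linarith
    have h1 := hmain s hs
    rw [Real.norm_eq_abs]
    set c : ℝ := (Nat.card {I : (Ideal (𝓞 K))⁰ // Ideal.absNorm (I : Ideal (𝓞 K)) ≤ s} : ℝ)
    have : c / s - ∑ C, κ C = (c - (∑ C, κ C) * s) / s := by field_simp
    rw [this, abs_div, abs_of_pos hs0, div_le_iff₀ hs0, mul_assoc, ← Real.rpow_add_one hs0.ne']
    rwa [neg_add_eq_sub]
  rw [tendsto_nhds_unique hlim2 hlim]
  have h1 := regulator_pos K
  have h2 : (0 : ℝ) < classNumber K := Nat.cast_pos.2 (classNumber_pos K)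
  have h3 : (0 : ℝ) < torsionOrder K := Nat.cast_pos.2 (torsionOrder_pos K)
  have h4 : (0 : ℝ) < |(discr K : ℝ)| := abs_pos.2 (Int.cast_ne_zero.2 (discr_ne_zero K))
  positivity

end IdealCount

section PrimeIdealTheorem
open scoped Classical

variable (K : Type*) [Field K] [NumberField K]

/-- The nonzero ideals of norm at most `x`. -/
def idealsLE (x : ℝ) : Finset (Ideal (𝓞 K)) :=
  ((Ideal.finite_setOfPred_absNorm_le (S := 𝓞 K) ⌊x⌋₊).subset
    (Set.inter_subset_left (t := {I | I ≠ ⊥ ∧ (Ideal.absNorm I : ℝ) ≤ x}))).toFinset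

/-- The nonzero prime ideals of norm at most `x`. -/
def primesLE (x : ℝ) : Finset (Ideal (𝓞 K)) := (idealsLE K x).filter (·.IsPrime)

variable {K}

lemma mem_idealsLE {x : ℝ} {I : Ideal (𝓞 K)} :
    I ∈ idealsLE K x ↔ I ≠ ⊥ ∧ (Ideal.absNorm I : ℝ) ≤ x := by
  simp only [idealsLE, Set.Finite.mem_toFinset, Set.mem_inter_iff, Set.mem_ofPred_eq,
    and_iff_right_iff_imp]
  exact fun h => Nat.le_floor h.2

lemma mem_primesLE {x : ℝ} {I : Ideal (𝓞 K)} :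
    I ∈ primesLE K x ↔ I ≠ ⊥ ∧ (Ideal.absNorm I : ℝ) ≤ x ∧ I.IsPrime := by
  rw [primesLE, Finset.mem_filter, mem_idealsLE, and_assoc]

lemma one_le_absNorm {I : Ideal (𝓞 K)} (hI : I ≠ ⊥) : 1 ≤ Ideal.absNorm I :=
  Nat.one_le_iff_ne_zero.2 (by rwa [Ne, Ideal.absNorm_eq_zero_iff])

lemma two_le_absNorm {P : Ideal (𝓞 K)} (hP : P ≠ ⊥) (hP1 : P ≠ ⊤) : 2 ≤ Ideal.absNorm P := by
  have h1 := one_le_absNorm hP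
  have h2 : Ideal.absNorm P ≠ 1 := by rwa [Ne, Ideal.absNorm_eq_one_iff]
  omega

/-- The von Mangoldt function on ideals. -/
def idealVonMangoldt (D : Ideal (𝓞 K)) : ℝ :=
  if IsPrimePow D then Real.log (Ideal.absNorm D.radical) else 0

lemma idealVonMangoldt_pow {P : Ideal (𝓞 K)} (hP : Prime P) {m : ℕ} (hm : m ≠ 0) :
    idealVonMangoldt (P ^ m) = Real.log (Ideal.absNorm P) := by
  rw [idealVonMangoldt, if_pos (hP.isPrimePow.pow hm), Ideal.radical_pow _ hm,
    (Ideal.isPrime_of_prime hP).radical]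

lemma idealVonMangoldt_nonneg (D : Ideal (𝓞 K)) : 0 ≤ idealVonMangoldt D := by
  rw [idealVonMangoldt]
  split_ifs
  · exact Real.log_natCast_nonneg _
  · exact le_rfl

lemma idealVonMangoldt_one : idealVonMangoldt (1 : Ideal (𝓞 K)) = 0 :=
  if_neg not_isPrimePow_one

lemma finite_setOf_dvd {I : Ideal (𝓞 K)} (hI : I ≠ 0) : {D | D ∣ I}.Finite :=
  have := UniqueFactorizationMonoid.fintypeSubtypeDvd I hI
  Set.finite_coe_iff.1 (inferInstanceAs (Finite {D // D ∣ I}))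

lemma finsum_idealVonMangoldt {I : Ideal (𝓞 K)} (hI : I ≠ 0) :
    ∑ᶠ D ∈ {D | D ∣ I}, idealVonMangoldt D = Real.log (Ideal.absNorm I) := by
  revert hI
  refine UniqueFactorizationMonoid.induction_on_coprime
    (P := fun I => I ≠ 0 → ∑ᶠ D ∈ {D | D ∣ I}, idealVonMangoldt D = Real.log (Ideal.absNorm I))
    I ?_ ?_ ?_ ?_
  · intro h; exact absurd rfl h
  · intro u hu _
    rw [Ideal.isUnit_iff] at hu
    subst hu
    have : {D : Ideal (𝓞 K) | D ∣ ⊤} = {1} := by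
      ext D; simp [← Ideal.one_eq_top, Ideal.isUnit_iff, ← isUnit_iff_dvd_one]
    rw [this, finsum_mem_singleton, idealVonMangoldt_one]
    simp
  · intro P m hP _
    have : {D : Ideal (𝓞 K) | D ∣ P ^ m} = ((Finset.range (m + 1)).image (P ^ ·) : Finset _) := by
      ext D
      simp only [Set.mem_ofPred_eq, dvd_prime_pow hP, associated_iff_eq, Finset.coe_image,
        Finset.coe_range, Set.mem_image, Set.mem_Iio]
      constructor
      · rintro ⟨i, hi, rfl⟩; exact ⟨i, by omega, rfl⟩
      · rintro ⟨i, hi, rfl⟩; exact ⟨i, by omega, rfl⟩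
    have hinj : Function.Injective (P ^ · : ℕ → Ideal (𝓞 K)) :=
      pow_injective_of_not_isUnit hP.not_isUnit hP.ne_zero
    rw [this, finsum_mem_coe_finset, Finset.sum_image hinj.injOn, Finset.sum_range_succ', pow_zero,
      idealVonMangoldt_one, add_zero, Finset.sum_congr rfl
        (fun i _ => idealVonMangoldt_pow hP (Nat.succ_ne_zero i))]
    simp
  · intro x y hxy hx hy hxy0
    have hx0 : x ≠ 0 := fun h => hxy0 (by simp [h])
    have hy0 : y ≠ 0 := fun h => hxy0 (by simp [h])
    rw [map_mul, Nat.cast_mul, Real.log_mul (Nat.cast_ne_zero.2 (Nat.one_le_iff_ne_zero.1 (one_le_absNorm hx0)))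
      (Nat.cast_ne_zero.2 (Nat.one_le_iff_ne_zero.1 (one_le_absNorm hy0))),
      ← hx hx0, ← hy hy0]
    have hset : {D | D ∣ x * y} ∩ Function.support idealVonMangoldt =
        {D | D ∣ x} ∩ Function.support idealVonMangoldt ∪
          {D | D ∣ y} ∩ Function.support idealVonMangoldt := by
      ext D
      simp only [Set.mem_inter_iff, Set.mem_ofPred_eq, Set.mem_union, ← or_and_right]
      refine and_congr_left fun hD => ⟨fun h => ?_, ?_⟩
      · have hpp : IsPrimePow D := by
          by_contra h
          exact hD (if_neg h)
        obtain ⟨P, m, hP, hm, rfl⟩ := hpp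
        by_cases hPx : P ∣ x
        · refine Or.inl (hP.pow_dvd_of_dvd_mul_right m (fun hPy => hP.not_isUnit (hxy hPx hPy)) h)
        · exact Or.inr (hP.pow_dvd_of_dvd_mul_left m hPx h)
      · rintro (h | h)
        · exact h.mul_right y
        · exact h.mul_left x
    rw [← finsum_mem_inter_support _ {D | D ∣ x * y}, ← finsum_mem_inter_support _ {D | D ∣ x},
      ← finsum_mem_inter_support _ {D | D ∣ y}, hset, finsum_mem_union]
    · rw [Set.disjoint_left]
      rintro D ⟨h1, h2⟩ ⟨h3, -⟩
      have : IsUnit D := hxy h1 h3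
      rw [isUnit_iff_eq_one] at this
      exact h2 (this ▸ idealVonMangoldt_one)
    · exact (finite_setOf_dvd hx0).inter_of_left _
    · exact (finite_setOf_dvd hy0).inter_of_left _

end PrimeIdealTheorem

section PrimeIdealTheorem
open scoped Classical nonZeroDivisors

variable (K : Type*) [Field K] [NumberField K]

/-- The ideals of norm `n`. -/
def idealsEq (n : ℕ) : Finset (Ideal (𝓞 K)) :=
  (Ideal.finite_setOfPred_absNorm_eq (S := 𝓞 K) n).toFinset

variable {K}

lemma mem_idealsEq {n : ℕ} {I : Ideal (𝓞 K)} : I ∈ idealsEq K n ↔ Ideal.absNorm I = n := by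
  simp [idealsEq]

lemma idealsEq_one : idealsEq K 1 = {1} := by
  ext I; simp [mem_idealsEq, Ideal.absNorm_eq_one_iff, Ideal.one_eq_top]

lemma sum_idealsEq (f : Ideal (𝓞 K) → ℝ) (x : ℝ) :
    ∑ n ∈ Finset.Icc 1 ⌊x⌋₊, ∑ I ∈ idealsEq K n, f I = ∑ I ∈ idealsLE K x, f I := by
  rw [← Finset.sum_fiberwise_of_maps_to (s := idealsLE K x) (t := Finset.Icc 1 ⌊x⌋₊)
    (g := fun I => Ideal.absNorm I)]
  · refine Finset.sum_congr rfl fun n hn => Finset.sum_congr ?_ fun _ _ => rfl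
    rw [Finset.mem_Icc] at hn
    ext I
    rw [mem_idealsEq, Finset.mem_filter, mem_idealsLE]
    refine ⟨fun h => ⟨⟨?_, ?_⟩, h⟩, fun h => h.2⟩
    · rintro rfl
      rw [Ideal.absNorm_bot] at h
      omega
    · rw [h]
      exact (Nat.le_floor_iff' (by omega)).1 hn.2
  · intro I hI
    rw [mem_idealsLE] at hI
    exact Finset.mem_Icc.2 ⟨one_le_absNorm hI.1, Nat.le_floor hI.2⟩

lemma sum_idealsEq_conv (n : ℕ) :
    ∑ p ∈ n.divisorsAntidiagonal, ((idealsEq K p.1).card : ℝ) *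
      ∑ D ∈ idealsEq K p.2, idealVonMangoldt D = (idealsEq K n).card * Real.log n := by
  rcases Nat.eq_zero_or_pos n with rfl | hn
  · simp
  have hI0 : ∀ {m : ℕ} {I : Ideal (𝓞 K)}, 0 < m → I ∈ idealsEq K m → I ≠ 0 := by
    rintro m I hm hI rfl
    rw [mem_idealsEq, Ideal.zero_eq_bot, Ideal.absNorm_bot] at hI
    omega
  let d : Ideal (𝓞 K) → Finset (Ideal (𝓞 K)) := fun I =>
    if h : I ≠ 0 then (finite_setOf_dvd h).toFinset else ∅
  have hd : ∀ {I D : Ideal (𝓞 K)}, I ≠ 0 → (D ∈ d I ↔ D ∣ I) := by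
    intro I D h
    simp only [d, dif_pos h, Set.Finite.mem_toFinset, Set.mem_ofPred_eq]
  have hR : ∀ I ∈ idealsEq K n, ∑ D ∈ d I, idealVonMangoldt D = Real.log n := by
    intro I hI
    have h0 := hI0 hn hI
    rw [← mem_idealsEq.1 hI, ← finsum_idealVonMangoldt h0, ← finsum_mem_coe_finset]
    congr 1
    simp only [d, dif_pos h0, Set.Finite.coe_toFinset]
  rw [← nsmul_eq_mul, ← Finset.sum_const, ← Finset.sum_congr rfl hR, Finset.sum_sigma']
  have hL : ∀ p ∈ n.divisorsAntidiagonal, ((idealsEq K p.1).card : ℝ) *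
      ∑ D ∈ idealsEq K p.2, idealVonMangoldt D =
      ∑ q ∈ idealsEq K p.1 ×ˢ idealsEq K p.2, idealVonMangoldt q.2 := by
    intro p _
    simp only [Finset.sum_product, Finset.sum_const, nsmul_eq_mul]
  rw [Finset.sum_congr rfl hL, Finset.sum_sigma']
  refine Finset.sum_bij (fun x _ => ⟨x.2.1 * x.2.2, x.2.2⟩) ?_ ?_ ?_ ?_
  · rintro ⟨p, J, D⟩ h
    simp only [Finset.mem_sigma, Nat.mem_divisorsAntidiagonal, Finset.mem_product,
      mem_idealsEq] at h ⊢
    have h1 : J * D ∈ idealsEq K n := by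
      rw [mem_idealsEq, map_mul, h.2.1, h.2.2, h.1.1]
    exact ⟨mem_idealsEq.1 h1, (hd (hI0 hn h1)).2 (dvd_mul_left _ _)⟩
  · rintro ⟨⟨p1, p2⟩, J, D⟩ h ⟨⟨q1, q2⟩, J', D'⟩ h' he
    simp only [Finset.mem_sigma, Nat.mem_divisorsAntidiagonal, Finset.mem_product,
      mem_idealsEq, Sigma.mk.injEq, heq_eq_eq] at h h' he ⊢
    obtain ⟨h1, rfl⟩ := he
    have hD : D ≠ 0 := by
      refine hI0 (m := p2) ?_ (mem_idealsEq.2 h.2.2)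
      exact Nat.pos_of_ne_zero fun h0 => h.1.2 (by rw [← h.1.1, h0, mul_zero])
    obtain rfl := mul_right_cancel₀ hD h1
    simp [← h.2.1, ← h.2.2, ← h'.2.1, ← h'.2.2]
  · rintro ⟨I, D⟩ h
    rw [Finset.mem_sigma] at h
    dsimp only at h
    obtain ⟨J, rfl⟩ := (hd (hI0 hn h.1)).1 h.2
    have h1 := mem_idealsEq.1 h.1
    refine ⟨⟨(Ideal.absNorm J, Ideal.absNorm D), J, D⟩, ?_, ?_⟩
    · simp only [Finset.mem_sigma, Nat.mem_divisorsAntidiagonal, Finset.mem_product, mem_idealsEq,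
        and_self, and_true]
      exact ⟨by rw [mul_comm, ← map_mul]; exact h1, hn.ne'⟩
    · simp [mul_comm]
  · intros; rfl

variable (K) in
lemma exists_card_idealsLE_sub_le : ∃ κ B θ : ℝ, 0 < κ ∧ 0 ≤ θ ∧ θ < 1 ∧
    ∀ x : ℝ, 1 ≤ x → |((idealsLE K x).card : ℝ) - κ * x| ≤ B * x ^ θ := by
  obtain ⟨κ, B, hκ, h⟩ := exists_card_ideal_sub_le K
  have hn : (1 : ℝ) ≤ Module.finrank ℚ K := Nat.one_le_cast.2 Module.finrank_pos
  refine ⟨κ, B, 1 - 1 / (2 * (Module.finrank ℚ K : ℝ)), hκ, ?_, ?_, fun x hx => ?_⟩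
  · rw [sub_nonneg, div_le_one (by positivity)]; linarith
  · have : 0 < 1 / (2 * (Module.finrank ℚ K : ℝ)) := by positivity
    linarith
  · convert h x hx using 4
    rw [← Nat.card_eq_finsetCard]
    refine Nat.card_congr ⟨fun I => ⟨⟨I, mem_nonZeroDivisors_iff_ne_zero.2 (mem_idealsLE.1 I.2).1⟩,
      (mem_idealsLE.1 I.2).2⟩, fun I => ⟨I, mem_idealsLE.2 ⟨nonZeroDivisors.ne_zero I.1.2, I.2⟩⟩,
      fun _ => rfl, fun _ => rfl⟩

variable (K) in
lemma tendsto_sum_idealVonMangoldt :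
    Tendsto (fun x : ℝ => (∑ I ∈ idealsLE K x, idealVonMangoldt I) / x) atTop (𝓝 1) := by
  obtain ⟨κ, B, θ, hκ, h0, h1, h⟩ := exists_card_idealsLE_sub_le K
  have := tendsto_sum_div_of_convolution_eq (a := fun n => ((idealsEq K n).card : ℝ))
    (Λ := fun n => ∑ I ∈ idealsEq K n, idealVonMangoldt I) (fun _ => Nat.cast_nonneg _)
    (fun _ => Finset.sum_nonneg fun _ _ => idealVonMangoldt_nonneg _)
    (by simp [idealsEq_one]) sum_idealsEq_conv hκ h0 h1 (C := B) (fun x hx => by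
      have := sum_idealsEq (K := K) (fun _ => 1) x
      simp only [Finset.sum_const, nsmul_eq_mul, mul_one] at this
      rw [this]
      exact h x hx)
  simpa only [sum_idealsEq] using this

end PrimeIdealTheorem

section PrimeIdealTheorem
open scoped Classical nonZeroDivisors

variable {K : Type*} [Field K] [NumberField K]

variable (K) in
lemma exists_card_idealsLE_le :
    ∃ C : ℝ, 0 < C ∧ ∀ x : ℝ, 1 ≤ x → ((idealsLE K x).card : ℝ) ≤ C * x := by
  obtain ⟨κ, B, θ, hκ, h0, h1, h⟩ := exists_card_idealsLE_sub_le K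
  refine ⟨κ + |B|, by positivity, fun x hx => ?_⟩
  have h2 := (abs_le.1 (h x hx)).2
  have h3 : x ^ θ ≤ x := Real.rpow_le_self_of_one_le hx h1.le
  have h4 : B * x ^ θ ≤ |B| * x :=
    mul_le_mul (le_abs_self B) h3 (by positivity) (abs_nonneg B)
  linarith

lemma prime_of_isPrime {P : Ideal (𝓞 K)} (h : P.IsPrime) (h0 : P ≠ ⊥) : Prime P :=
  Ideal.prime_of_isPrime h0 h

lemma idealVonMangoldt_of_isPrime {P : Ideal (𝓞 K)} (h : P.IsPrime) (h0 : P ≠ ⊥) :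
    idealVonMangoldt P = Real.log (Ideal.absNorm P) := by
  simpa using idealVonMangoldt_pow (prime_of_isPrime h h0) one_ne_zero

lemma log_absNorm_pos {P : Ideal (𝓞 K)} (h : P.IsPrime) (h0 : P ≠ ⊥) :
    0 < Real.log (Ideal.absNorm P) :=
  Real.log_pos (by exact_mod_cast two_le_absNorm h0 h.ne_top)

lemma sum_idealVonMangoldt_not_isPrime_le {x : ℝ} (hx : 1 ≤ x) :
    ∑ D ∈ (idealsLE K x).filter (¬ ·.IsPrime), idealVonMangoldt D ≤
      (idealsLE K √x).card * Real.log x := by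
  have hx0 : 0 < x := by linarith
  rw [← Finset.sum_filter_of_ne (p := IsPrimePow) (fun D _ h => by
    by_contra h1; exact h (if_neg h1))]
  set T := Finset.filter IsPrimePow ((idealsLE K x).filter (¬ ·.IsPrime))
  have hT : ∀ D ∈ T, ∃ P : Ideal (𝓞 K), Prime P ∧ ∃ m : ℕ, 2 ≤ m ∧ D = P ^ m ∧ D.radical = P ∧
      (Ideal.absNorm P : ℝ) ^ m ≤ x := by
    intro D hD
    simp only [T, Finset.mem_filter, mem_idealsLE] at hD
    obtain ⟨⟨⟨-, hDx⟩, hDp⟩, P, m, hP, hm, rfl⟩ := hD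
    refine ⟨P, hP, m, ?_, rfl, ?_, ?_⟩
    · by_contra h
      obtain rfl : m = 1 := by omega
      exact hDp (by rw [pow_one]; exact Ideal.isPrime_of_prime hP)
    · rw [Ideal.radical_pow _ hm.ne', (Ideal.isPrime_of_prime hP).radical]
    · simpa using hDx
  have hmaps : ∀ D ∈ T, D.radical ∈ primesLE K √x := by
    intro D hD
    obtain ⟨P, hP, m, hm, -, hr, hle⟩ := hT D hD
    rw [hr, mem_primesLE]
    refine ⟨hP.ne_zero, Real.le_sqrt_of_sq_le ?_, Ideal.isPrime_of_prime hP⟩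
    exact (pow_le_pow_right₀ (by exact_mod_cast one_le_absNorm hP.ne_zero) hm).trans hle
  rw [← Finset.sum_fiberwise_of_maps_to hmaps]
  calc _ ≤ ∑ P ∈ primesLE K √x, Real.log x := Finset.sum_le_sum fun P hP => ?_
    _ ≤ _ := by
      rw [Finset.sum_const, nsmul_eq_mul]
      gcongr
      · exact Real.log_nonneg hx
      · exact Finset.filter_subset _ _
  rw [mem_primesLE] at hP
  have hlog := log_absNorm_pos hP.2.2 hP.1
  have hN : (0 : ℝ) < Ideal.absNorm P := by exact_mod_cast one_le_absNorm hP.1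
  have hsub : T.filter (·.radical = P) ⊆
      (Finset.Icc 1 ⌊Real.log x / Real.log (Ideal.absNorm P)⌋₊).image (P ^ ·) := by
    intro D hD
    rw [Finset.mem_filter] at hD
    obtain ⟨Q, hQ, m, hm, rfl, hr, hle⟩ := hT D hD.1
    obtain rfl : Q = P := hr.symm.trans hD.2
    refine Finset.mem_image.2 ⟨m, Finset.mem_Icc.2 ⟨by omega, Nat.le_floor ?_⟩, rfl⟩
    rw [le_div_iff₀ hlog, ← Real.log_pow]
    exact Real.log_le_log (by positivity) hle
  calc _ ≤ ∑ D ∈ (Finset.Icc 1 ⌊Real.log x / Real.log (Ideal.absNorm P)⌋₊).image (P ^ ·),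
        idealVonMangoldt D :=
        Finset.sum_le_sum_of_subset_of_nonneg hsub fun _ _ _ => idealVonMangoldt_nonneg _
    _ ≤ ∑ m ∈ Finset.Icc 1 ⌊Real.log x / Real.log (Ideal.absNorm P)⌋₊, idealVonMangoldt (P ^ m) :=
        Finset.sum_image_le_of_nonneg fun _ _ => idealVonMangoldt_nonneg _
    _ = ∑ m ∈ Finset.Icc 1 ⌊Real.log x / Real.log (Ideal.absNorm P)⌋₊,
          Real.log (Ideal.absNorm P) := Finset.sum_congr rfl fun m hm =>
        idealVonMangoldt_pow (prime_of_isPrime hP.2.2 hP.1) (by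
          rw [Finset.mem_Icc] at hm; omega)
    _ = ⌊Real.log x / Real.log (Ideal.absNorm P)⌋₊ * Real.log (Ideal.absNorm P) := by
        rw [Finset.sum_const, nsmul_eq_mul, Nat.card_Icc, Nat.add_sub_cancel]
    _ ≤ Real.log x / Real.log (Ideal.absNorm P) * Real.log (Ideal.absNorm P) := by
        gcongr
        exact Nat.floor_le (div_nonneg (Real.log_nonneg hx) hlog.le)
    _ = Real.log x := div_mul_cancel₀ _ hlog.ne'

lemma tendsto_log_div_sqrt : Tendsto (fun x : ℝ => Real.log x / √x) atTop (𝓝 0) := by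
  simp only [Real.sqrt_eq_rpow]
  exact (isLittleO_log_rpow_atTop (by norm_num : (0 : ℝ) < 1 / 2)).tendsto_div_nhds_zero

variable (K) in
/-- The prime ideal theorem. -/
theorem tendsto_sum_log_primesLE :
    Tendsto (fun x : ℝ => (∑ P ∈ primesLE K x, Real.log (Ideal.absNorm P)) / x) atTop (𝓝 1) := by
  obtain ⟨C, hC0, hC⟩ := exists_card_idealsLE_le K
  have h1 : Tendsto (fun x : ℝ => (∑ D ∈ (idealsLE K x).filter (¬ ·.IsPrime),
      idealVonMangoldt D) / x) atTop (𝓝 0) := by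
    refine squeeze_zero' ?_ ?_ (g := fun x => C * (Real.log x / √x))
      (by simpa using tendsto_log_div_sqrt.const_mul C)
    · filter_upwards [eventually_ge_atTop 0] with x hx
      exact div_nonneg (Finset.sum_nonneg fun _ _ => idealVonMangoldt_nonneg _) hx
    · filter_upwards [eventually_ge_atTop 1] with x hx
      have hx0 : 0 < x := by linarith
      have hs : 0 < √x := Real.sqrt_pos.2 hx0
      rw [div_le_iff₀ hx0]
      refine (sum_idealVonMangoldt_not_isPrime_le hx).trans ?_
      have h2 : C * (Real.log x / √x) * x = C * √x * Real.log x := by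
        nth_rewrite 3 [← Real.mul_self_sqrt hx0.le]
        field_simp
      rw [h2]
      exact mul_le_mul_of_nonneg_right (hC _ (Real.one_le_sqrt.2 hx)) (Real.log_nonneg hx)
  refine (by simpa using (tendsto_sum_idealVonMangoldt K).sub h1 :
    Tendsto _ atTop (𝓝 (1 : ℝ))).congr fun x => ?_
  rw [← sub_div, ← Finset.sum_filter_add_sum_filter_not (idealsLE K x) (·.IsPrime),
    add_sub_cancel_right]
  congr 1
  refine Finset.sum_congr rfl fun P hP => ?_
  rw [mem_primesLE] at hP
  exact idealVonMangoldt_of_isPrime hP.2.2 hP.1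

end PrimeIdealTheorem

section QuadraticSplitting

variable {K M : Type*} [Field K] [NumberField K] [Field M] [NumberField M] [Algebra K M]

lemma absNorm_map_of_finrank_eq_two (hM : Module.finrank K M = 2) (P : Ideal (𝓞 K)) :
    Ideal.absNorm (P.map (algebraMap (𝓞 K) (𝓞 M))) = Ideal.absNorm P ^ 2 := by
  rw [Ideal.absNorm_algebraMap (R := 𝓞 K) (S := 𝓞 M) P, ← IsFractionRing.finrank_eq (𝓞 K) K (𝓞 M) M, hM]

variable {P : Ideal (𝓞 K)}

omit [NumberField K] [NumberField M] in
lemma map_ne_bot (hP0 : P ≠ ⊥) : P.map (algebraMap (𝓞 K) (𝓞 M)) ≠ ⊥ := by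
  rwa [Ne, Ideal.map_eq_bot_iff_of_injective (FaithfulSMul.algebraMap_injective (𝓞 K) (𝓞 M))]

lemma absNorm_eq_or_of_dvd_map (hM : Module.finrank K M = 2) (hP : P.IsPrime) (hP0 : P ≠ ⊥)
    {Q : Ideal (𝓞 M)} (hQ : Q.IsPrime) (h : Q ∣ P.map (algebraMap (𝓞 K) (𝓞 M))) :
    Ideal.absNorm Q = Ideal.absNorm P ∨ Ideal.absNorm Q = Ideal.absNorm P ^ 2 := by
  have : P.IsMaximal := hP.isMaximal hP0
  have : Q.LiesOver P := (Ideal.liesOver_iff_dvd_map hQ.ne_top).2 h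
  have h1 := Ideal.absNorm_pow_inertiaDeg P Q
  have h2 := Ideal.inertiaDeg_pos Q (𝓞 K)
  have h3 : Ideal.absNorm Q ∣ Ideal.absNorm P ^ 2 := by
    rw [← absNorm_map_of_finrank_eq_two hM]
    exact map_dvd _ h
  rw [← h1] at h3
  have h4 : Q.inertiaDeg (𝓞 K) ≤ 2 :=
    (Nat.pow_dvd_pow_iff_le_right (two_le_absNorm hP0 hP.ne_top)).1 h3
  rw [← h1]
  interval_cases Q.inertiaDeg (𝓞 K)
  · left; rw [pow_one]
  · right; rfl

lemma isPrime_of_mul_eq_map (hM : Module.finrank K M = 2) (hP : P.IsPrime) (hP0 : P ≠ ⊥)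
    {I J : Ideal (𝓞 M)} (h : P.map (algebraMap (𝓞 K) (𝓞 M)) = I * J) (hI : I ≠ ⊤) (hJ : J ≠ ⊤) :
    I.IsPrime ∧ Ideal.absNorm I = Ideal.absNorm P := by
  have hne := map_ne_bot (M := M) hP0
  have hI0 : I ≠ ⊥ := by rintro rfl; exact hne (by simpa using h)
  have hJ0 : J ≠ ⊥ := by rintro rfl; exact hne (by simpa using h)
  have hp := two_le_absNorm hP0 hP.ne_top
  have key : ∀ {I' : Ideal (𝓞 M)}, I' ≠ ⊤ → I' ≠ ⊥ → I' ∣ P.map (algebraMap (𝓞 K) (𝓞 M)) →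
      ∃ Q : Ideal (𝓞 M), Q.IsPrime ∧ Q ∣ I' ∧ Ideal.absNorm P ≤ Ideal.absNorm Q ∧
        Ideal.absNorm Q ≤ Ideal.absNorm I' := by
    intro I' h1 h0 h2
    obtain ⟨Q, hQ, hle⟩ := Ideal.exists_le_maximal I' h1
    have hdvd : Q ∣ I' := Ideal.dvd_iff_le.2 hle
    refine ⟨Q, hQ.isPrime, hdvd, ?_, Nat.le_of_dvd (one_le_absNorm h0) (map_dvd _ hdvd)⟩
    rcases absNorm_eq_or_of_dvd_map hM hP hP0 hQ.isPrime (hdvd.trans h2) with h3 | h3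
    · exact h3.ge
    · rw [h3]; nlinarith
  obtain ⟨Q, hQ, hQI, hQ1, hQ2⟩ := key hI hI0 (h ▸ dvd_mul_right _ _)
  obtain ⟨R', -, -, hR1, hR2⟩ := key hJ hJ0 (h ▸ dvd_mul_left _ _)
  have hmul : Ideal.absNorm I * Ideal.absNorm J = Ideal.absNorm P ^ 2 := by
    rw [← map_mul, ← h, absNorm_map_of_finrank_eq_two hM]
  have hIP : Ideal.absNorm I = Ideal.absNorm P := by
    have : Ideal.absNorm P ≤ Ideal.absNorm I := hQ1.trans hQ2
    have : Ideal.absNorm P ≤ Ideal.absNorm J := hR1.trans hR2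
    nlinarith
  have hQI' : Ideal.absNorm Q = Ideal.absNorm I := by omega
  obtain ⟨R, rfl⟩ := hQI
  rw [map_mul] at hQI'
  have hR : Ideal.absNorm R = 1 := by
    have : 0 < Ideal.absNorm Q := by omega
    nlinarith
  rw [Ideal.absNorm_eq_one_iff] at hR
  refine ⟨?_, hIP⟩
  rwa [hR, Ideal.mul_top]

lemma trace_eq_zero_of_sq_eq {α : M} {d : K}
    (hα : α ^ 2 = algebraMap K M d) (hd : ¬IsSquare d) : Algebra.trace K M α = 0 := by
  have : Irreducible (Polynomial.X ^ 2 - Polynomial.C d) :=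
    X_pow_sub_C_irreducible_of_prime Nat.prime_two fun b hb => hd ⟨b, by rw [← hb, sq]⟩
  have hmin : minpoly K α = Polynomial.X ^ 2 - Polynomial.C d :=
    (minpoly.eq_of_irreducible_of_monic this (by simp [hα])
      (Polynomial.monic_X_pow_sub_C d two_ne_zero)).symm
  rw [trace_eq_finrank_mul_minpoly_nextCoeff, hmin, Polynomial.nextCoeff_of_natDegree_pos
    (by rw [Polynomial.natDegree_X_pow_sub_C]; norm_num), Polynomial.natDegree_X_pow_sub_C]
  simp [Polynomial.coeff_X_pow]

lemma intTrace_mem_of_mem_map {x : 𝓞 M} (hx : x ∈ P.map (algebraMap (𝓞 K) (𝓞 M))) :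
    Algebra.intTrace (𝓞 K) (𝓞 M) x ∈ P := by
  have hx' : x ∈ (P • ⊤ : Submodule (𝓞 K) (𝓞 M)) := by
    rwa [Ideal.smul_top_eq_map]
  refine Submodule.smul_induction_on hx' (fun p hp y _ => ?_) (fun x y hx hy => ?_)
  · rw [map_smul, smul_eq_mul]
    exact P.mul_mem_right _ hp
  · rw [map_add]
    exact P.add_mem hx hy

/-- If `d` is a nonzero square modulo an odd prime `P`, then `P` splits in `K(√d)`. -/
lemma exists_map_eq_mul_of_sq_sub_mem (hM : Module.finrank K M = 2) {α : 𝓞 M} {d : 𝓞 K}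
    (hα : α ^ 2 = algebraMap (𝓞 K) (𝓞 M) d) (hd : ¬IsSquare (d : K))
    (hP : P.IsPrime) (hP0 : P ≠ ⊥) {a : 𝓞 K} (ha : d - a ^ 2 ∈ P) (h2a : 2 * a ∉ P) :
    ∃ I J : Ideal (𝓞 M), I ≠ J ∧ I.IsPrime ∧ J.IsPrime ∧
      P.map (algebraMap (𝓞 K) (𝓞 M)) = I * J ∧
      Ideal.absNorm I = Ideal.absNorm P ∧ Ideal.absNorm J = Ideal.absNorm P := by
  set φ := algebraMap (𝓞 K) (𝓞 M)
  have : P.IsMaximal := hP.isMaximal hP0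
  set I : Ideal (𝓞 M) := P.map φ ⊔ Ideal.span {α - φ a}
  set J : Ideal (𝓞 M) := P.map φ ⊔ Ideal.span {α + φ a}
  have hsup : I ⊔ J = ⊤ := by
    obtain ⟨y, p, hp, hyp⟩ := Ideal.IsMaximal.exists_inv ‹P.IsMaximal› h2a
    rw [Ideal.eq_top_iff_one, ← map_one φ, ← hyp, map_add]
    refine add_mem ?_ (Ideal.mem_sup_left (Ideal.mem_sup_left (Ideal.mem_map_of_mem φ hp)))
    rw [map_mul]
    refine Ideal.mul_mem_left _ _ ?_
    have : φ (2 * a) = -(α - φ a) + (α + φ a) := by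
      rw [map_mul, map_ofNat]; ring
    rw [this]
    exact add_mem (Ideal.mem_sup_left (neg_mem (Ideal.mem_sup_right
      (Ideal.mem_span_singleton_self _)))) (Ideal.mem_sup_right (Ideal.mem_sup_right
      (Ideal.mem_span_singleton_self _)))
  have hmul : P.map φ = I * J := by
    apply le_antisymm
    · rw [Ideal.mul_eq_inf_of_coprime hsup]
      exact le_inf le_sup_left le_sup_left
    · rw [Ideal.sup_mul]
      refine sup_le Ideal.mul_le_left ?_
      rw [Ideal.mul_sup, Ideal.span_singleton_mul_span_singleton]
      refine sup_le Ideal.mul_le_right ?_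
      rw [Ideal.span_singleton_le_iff_mem]
      have : (α - φ a) * (α + φ a) = φ (d - a ^ 2) := by
        rw [map_sub, map_pow, ← hα]; ring
      rw [this]
      exact Ideal.mem_map_of_mem φ ha
  have htr : ∀ ε : 𝓞 K, ε = 1 ∨ ε = -1 → α + φ (ε * a) ∉ P.map φ := by
    intro ε hε h
    have h1 := intTrace_mem_of_mem_map h
    have h2 : Algebra.intTrace (𝓞 K) (𝓞 M) (α + φ (ε * a)) = ε * (2 * a) := by
      apply FaithfulSMul.algebraMap_injective (𝓞 K) K
      rw [Algebra.algebraMap_intTrace (L := M), map_add, map_add,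
        trace_eq_zero_of_sq_eq (d := (d : K)) _ hd, zero_add]
      · have : algebraMap (𝓞 M) M (φ (ε * a)) = algebraMap K M ((ε * a : 𝓞 K) : K) := rfl
        rw [this, Algebra.trace_algebraMap, hM, two_smul]
        simp only [map_mul, map_ofNat]
        ring
      · rw [← map_pow, hα]
        rfl
    rw [h2] at h1
    rcases hε with rfl | rfl
    · exact h2a (by simpa using h1)
    · exact h2a (by simpa using h1)
  have hI : I ≠ ⊤ := by
    intro h
    rw [h, Ideal.top_mul] at hmul
    refine htr 1 (Or.inl rfl) ?_
    rw [hmul, one_mul]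
    exact Ideal.mem_sup_right (Ideal.mem_span_singleton_self _)
  have hJ : J ≠ ⊤ := by
    intro h
    rw [h, Ideal.mul_top] at hmul
    refine htr (-1) (Or.inr rfl) ?_
    rw [hmul, neg_one_mul, map_neg, ← sub_eq_add_neg]
    exact Ideal.mem_sup_right (Ideal.mem_span_singleton_self _)
  obtain ⟨h1, h2⟩ := isPrime_of_mul_eq_map hM hP hP0 hmul hI hJ
  obtain ⟨h3, h4⟩ := isPrime_of_mul_eq_map hM hP hP0 (hmul.trans (mul_comm _ _)) hJ hI
  refine ⟨I, J, fun h => hI ?_, h1, h3, hmul, h2, h4⟩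
  rw [← hsup, ← h, sup_idem]

/-- If `d` is not a square modulo `P`, then `P` has residue degree two in `K(√d)`. -/
lemma absNorm_eq_sq_of_forall_sq_sub_notMem (hM : Module.finrank K M = 2) {α : 𝓞 M} {d : 𝓞 K}
    (hα : α ^ 2 = algebraMap (𝓞 K) (𝓞 M) d) (hP : P.IsPrime) (hP0 : P ≠ ⊥)
    (hP' : ∀ a : 𝓞 K, d - a ^ 2 ∉ P) {Q : Ideal (𝓞 M)} (hQ : Q.IsPrime)
    (h : Q ∣ P.map (algebraMap (𝓞 K) (𝓞 M))) : Ideal.absNorm Q = Ideal.absNorm P ^ 2 := by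
  refine (absNorm_eq_or_of_dvd_map hM hP hP0 hQ h).resolve_left fun hN => ?_
  have : P.IsMaximal := hP.isMaximal hP0
  have : Q.LiesOver P := (Ideal.liesOver_iff_dvd_map hQ.ne_top).2 h
  have hbij : Function.Bijective (algebraMap (𝓞 K ⧸ P) (𝓞 M ⧸ Q)) := by
    have : Finite (𝓞 M ⧸ Q) := Ideal.finiteQuotientOfFreeOfNeBot Q (ne_zero_of_dvd_ne_zero
      (map_ne_bot hP0) h)
    rw [Nat.bijective_iff_injective_and_card]
    refine ⟨FaithfulSMul.algebraMap_injective _ _, hN.symm⟩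
  obtain ⟨b, hb⟩ := hbij.2 (Ideal.Quotient.mk Q α)
  obtain ⟨a, rfl⟩ := Ideal.Quotient.mk_surjective b
  refine hP' a ?_
  rw [← Ideal.Quotient.eq_zero_iff_mem]
  apply hbij.1
  rw [map_zero, map_sub, map_pow, map_sub, map_pow, hb, ← map_pow, hα]
  exact sub_self _

end QuadraticSplitting

section QuadraticSplitting
open scoped Classical

variable {K M : Type*} [Field K] [NumberField K] [Field M] [NumberField M] [Algebra K M]

/-- The quadratic residue symbol of `d` modulo `P`. -/
def idealQuadraticChar (d : 𝓞 K) (P : Ideal (𝓞 K)) : ℝ :=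
  if d ∈ P then 0 else if ∃ a, d - a ^ 2 ∈ P then 1 else -1

omit [NumberField K] in
lemma abs_idealQuadraticChar_le (d : 𝓞 K) (P : Ideal (𝓞 K)) : |idealQuadraticChar d P| ≤ 1 := by
  unfold idealQuadraticChar
  split_ifs <;> norm_num

/-- The primes of norm at most `x` of `M` above `P`. -/
def primesOverLE (M : Type*) [Field M] [NumberField M] [Algebra K M] (P : Ideal (𝓞 K)) (x : ℝ) :
    Finset (Ideal (𝓞 M)) :=
  (primesLE M x).filter (· ∣ P.map (algebraMap (𝓞 K) (𝓞 M)))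

variable {P : Ideal (𝓞 K)}

lemma absNorm_le_of_dvd_map (hM : Module.finrank K M = 2) (hP : P.IsPrime) (hP0 : P ≠ ⊥)
    {Q : Ideal (𝓞 M)} (hQ : Q.IsPrime) (h : Q ∣ P.map (algebraMap (𝓞 K) (𝓞 M))) :
    Ideal.absNorm P ≤ Ideal.absNorm Q := by
  rcases absNorm_eq_or_of_dvd_map hM hP hP0 hQ h with h3 | h3
  · exact h3.ge
  · rw [h3]
    nlinarith [one_le_absNorm hP0]

lemma card_primesOverLE_le (hM : Module.finrank K M = 2) (hP : P.IsPrime) (hP0 : P ≠ ⊥) (x : ℝ) :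
    (primesOverLE M P x).card ≤ 2 := by
  have hT : ∀ Q ∈ primesOverLE M P x, Prime Q ∧ Q ∣ P.map (algebraMap (𝓞 K) (𝓞 M)) := by
    intro Q hQ
    rw [primesOverLE, Finset.mem_filter, mem_primesLE] at hQ
    exact ⟨prime_of_isPrime hQ.1.2.2 hQ.1.1, hQ.2⟩
  have h1 : ∏ Q ∈ primesOverLE M P x, Q ∣ P.map (algebraMap (𝓞 K) (𝓞 M)) :=
    Finset.prod_primes_dvd _ (fun Q hQ => (hT Q hQ).1) fun Q hQ => (hT Q hQ).2
  have h2 := map_dvd Ideal.absNorm h1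
  rw [absNorm_map_of_finrank_eq_two hM, map_prod] at h2
  have h3 := Nat.le_of_dvd (pow_pos (one_le_absNorm hP0) 2) h2
  have h4 : Ideal.absNorm P ^ (primesOverLE M P x).card ≤
      ∏ Q ∈ primesOverLE M P x, Ideal.absNorm Q := by
    rw [← Finset.prod_const]
    exact Finset.prod_le_prod' fun Q hQ =>
      absNorm_le_of_dvd_map hM hP hP0 (Ideal.isPrime_of_prime (hT Q hQ).1) (hT Q hQ).2
  exact (Nat.pow_le_pow_iff_right (two_le_absNorm hP0 hP.ne_top)).1 (h4.trans h3)

lemma abs_sum_primesOverLE_sub_le_two_mul_log (hM : Module.finrank K M = 2) (d : 𝓞 K) {x : ℝ}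
    (hP : P ∈ primesLE K x) :
    |∑ Q ∈ primesOverLE M P x, Real.log (Ideal.absNorm Q) -
      (1 + idealQuadraticChar d P) * Real.log (Ideal.absNorm P)| ≤ 2 * Real.log x := by
  rw [mem_primesLE] at hP
  obtain ⟨hP0, hPx, hP⟩ := hP
  have hN : (1 : ℝ) ≤ Ideal.absNorm P := by exact_mod_cast one_le_absNorm hP0
  have h0 : 0 ≤ Real.log x := Real.log_nonneg (hN.trans hPx)
  have h1 : ∑ Q ∈ primesOverLE M P x, Real.log (Ideal.absNorm Q) ≤ 2 * Real.log x := by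
    calc _ ≤ (primesOverLE M P x).card • Real.log x := by
          refine Finset.sum_le_card_nsmul _ _ _ fun Q hQ => ?_
          rw [primesOverLE, Finset.mem_filter, mem_primesLE] at hQ
          exact Real.log_le_log (by exact_mod_cast one_le_absNorm hQ.1.1) hQ.1.2.1
      _ ≤ _ := by
          rw [nsmul_eq_mul]
          gcongr
          exact_mod_cast card_primesOverLE_le hM hP hP0 x
  have h2 : 0 ≤ ∑ Q ∈ primesOverLE M P x, Real.log (Ideal.absNorm Q) :=
    Finset.sum_nonneg fun Q _ => Real.log_natCast_nonneg _
  have h3 := abs_le.1 (abs_idealQuadraticChar_le d P)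
  have h4 : Real.log (Ideal.absNorm P) ≤ Real.log x := Real.log_le_log (by linarith) hPx
  have h5 : 0 ≤ Real.log (Ideal.absNorm P) := Real.log_natCast_nonneg _
  have h6 : (1 + idealQuadraticChar d P) * Real.log (Ideal.absNorm P) ≤ 2 * Real.log x :=
    mul_le_mul (by linarith) h4 h5 (by norm_num)
  have h7 : 0 ≤ (1 + idealQuadraticChar d P) * Real.log (Ideal.absNorm P) :=
    mul_nonneg (by linarith) h5
  exact abs_le.2 ⟨by linarith, by linarith⟩

lemma sum_primesOverLE_eq (hM : Module.finrank K M = 2) {α : 𝓞 M} {d : 𝓞 K}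
    (hα : α ^ 2 = algebraMap (𝓞 K) (𝓞 M) d) (hd : ¬IsSquare (d : K)) {x : ℝ}
    (hP : P ∈ primesLE K x) (hPx : √x < Ideal.absNorm P) (h2d : 2 * d ∉ P) :
    ∑ Q ∈ primesOverLE M P x, Real.log (Ideal.absNorm Q) =
      (1 + idealQuadraticChar d P) * Real.log (Ideal.absNorm P) := by
  rw [mem_primesLE] at hP
  obtain ⟨hP0, hPx', hP⟩ := hP
  have hdP : d ∉ P := fun h => h2d (P.mul_mem_left _ h)
  by_cases hsq : ∃ a, d - a ^ 2 ∈ P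
  · rw [idealQuadraticChar, if_neg hdP, if_pos hsq]
    obtain ⟨a, ha⟩ := hsq
    have h2a : 2 * a ∉ P := by
      intro h
      apply h2d
      have : 2 * d = 2 * (d - a ^ 2) + 2 * a * a := by ring
      rw [this]
      exact add_mem (P.mul_mem_left _ ha) (P.mul_mem_right _ h)
    obtain ⟨I, J, hIJ, hI, hJ, hmul, hNI, hNJ⟩ :=
      exists_map_eq_mul_of_sq_sub_mem hM hα hd hP hP0 ha h2a
    have hne := map_ne_bot (M := M) hP0
    have hI0 : I ≠ ⊥ := by rintro rfl; exact hne (by simpa using hmul)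
    have hJ0 : J ≠ ⊥ := by rintro rfl; exact hne (by simpa using hmul)
    have : primesOverLE M P x = {I, J} := by
      ext Q
      rw [primesOverLE, Finset.mem_filter, mem_primesLE, hmul, Finset.mem_insert,
        Finset.mem_singleton]
      constructor
      · rintro ⟨⟨hQ0, -, hQ⟩, h⟩
        have hQ' := prime_of_isPrime hQ hQ0
        rcases hQ'.dvd_or_dvd h with h | h
        · exact Or.inl ((prime_dvd_prime_iff_eq hQ' (prime_of_isPrime hI hI0)).1 h)
        · exact Or.inr ((prime_dvd_prime_iff_eq hQ' (prime_of_isPrime hJ hJ0)).1 h)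
      · rintro (rfl | rfl)
        · exact ⟨⟨hI0, by rwa [hNI], hI⟩, dvd_mul_right _ _⟩
        · exact ⟨⟨hJ0, by rwa [hNJ], hJ⟩, dvd_mul_left _ _⟩
    rw [this, Finset.sum_pair hIJ, hNI, hNJ]
    ring
  · rw [idealQuadraticChar, if_neg hdP, if_neg hsq]
    push Not at hsq
    have : primesOverLE M P x = ∅ := by
      refine Finset.eq_empty_of_forall_notMem fun Q hQ => ?_
      rw [primesOverLE, Finset.mem_filter, mem_primesLE] at hQ
      have h1 := absNorm_eq_sq_of_forall_sq_sub_notMem hM hα hP hP0 hsq hQ.1.2.2 hQ.2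
      have h2 := hQ.1.2.1
      rw [h1, Nat.cast_pow] at h2
      exact absurd (Real.le_sqrt_of_sq_le h2) (not_le.2 hPx)
    rw [this]
    simp

lemma sum_primesLE_eq_sum_primesOverLE (hM : Module.finrank K M = 2) (f : Ideal (𝓞 M) → ℝ)
    (x : ℝ) :
    ∑ Q ∈ primesLE M x, f Q = ∑ P ∈ primesLE K x, ∑ Q ∈ primesOverLE M P x, f Q := by
  have hunder : ∀ Q ∈ primesLE M x, Q.under (𝓞 K) ≠ ⊥ ∧ (Q.under (𝓞 K)).IsPrime ∧
      Q ∣ (Q.under (𝓞 K)).map (algebraMap (𝓞 K) (𝓞 M)) := by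
    intro Q hQ
    rw [mem_primesLE] at hQ
    have := hQ.2.2
    have h0 : Q.under (𝓞 K) ≠ ⊥ := Ideal.IsIntegral.comap_ne_bot (𝓞 K) hQ.1
    refine ⟨h0, inferInstance, ?_⟩
    rw [Ideal.dvd_iff_le]
    exact Ideal.map_comap_le
  rw [← Finset.sum_fiberwise_of_maps_to (s := primesLE M x) (t := primesLE K x)
    (g := fun Q => Q.under (𝓞 K))]
  · refine Finset.sum_congr rfl fun P hP => Finset.sum_congr ?_ fun _ _ => rfl
    rw [primesOverLE]
    refine Finset.filter_congr fun Q hQ => ?_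
    rw [mem_primesLE] at hP
    have : P.IsMaximal := hP.2.2.isMaximal hP.1
    have h2 := hunder Q hQ
    rw [mem_primesLE] at hQ
    constructor
    · rintro rfl; exact h2.2.2
    · intro h
      have := (Ideal.liesOver_iff_dvd_map hQ.2.2.ne_top).2 h
      exact (Ideal.over_def Q P).symm
  · intro Q hQ
    obtain ⟨h0, h1, h2⟩ := hunder Q hQ
    rw [mem_primesLE] at hQ ⊢
    refine ⟨h0, le_trans ?_ hQ.2.1, h1⟩
    exact_mod_cast absNorm_le_of_dvd_map hM h1 h0 hQ.2.2 h2

theorem tendsto_sum_idealQuadraticChar_aux (hM : Module.finrank K M = 2) {α : 𝓞 M} {d : 𝓞 K}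
    (hα : α ^ 2 = algebraMap (𝓞 K) (𝓞 M) d) (hd : ¬IsSquare (d : K)) :
    Tendsto (fun x : ℝ => (∑ P ∈ primesLE K x,
      idealQuadraticChar d P * Real.log (Ideal.absNorm P)) / x) atTop (𝓝 0) := by
  have h2d : Ideal.span {2 * d} ≠ 0 := by
    rw [Ne, Ideal.zero_eq_bot, Ideal.span_singleton_eq_bot]
    refine mul_ne_zero two_ne_zero ?_
    rintro rfl
    exact hd (by simp)
  set B := (finite_setOf_dvd h2d).toFinset
  obtain ⟨C, hC0, hC⟩ := exists_card_idealsLE_le K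
  have hbound : ∀ x : ℝ, 1 ≤ x → |(∑ Q ∈ primesLE M x, Real.log (Ideal.absNorm Q)) -
      (∑ P ∈ primesLE K x, Real.log (Ideal.absNorm P)) - ∑ P ∈ primesLE K x,
        idealQuadraticChar d P * Real.log (Ideal.absNorm P)| ≤
      (B.card + C * √x) * (2 * Real.log x) := by
    intro x hx
    rw [sum_primesLE_eq_sum_primesOverLE (K := K) hM, ← Finset.sum_sub_distrib,
      ← Finset.sum_sub_distrib]
    calc _ ≤ ∑ P ∈ primesLE K x, |∑ Q ∈ primesOverLE M P x, Real.log (Ideal.absNorm Q) -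
          (1 + idealQuadraticChar d P) * Real.log (Ideal.absNorm P)| := by
          refine (Finset.abs_sum_le_sum_abs _ _).trans (le_of_eq ?_)
          refine Finset.sum_congr rfl fun P _ => ?_
          congr 1
          ring
      _ = ∑ P ∈ (primesLE K x).filter (· ∈ B ∪ idealsLE K √x),
          |∑ Q ∈ primesOverLE M P x, Real.log (Ideal.absNorm Q) -
          (1 + idealQuadraticChar d P) * Real.log (Ideal.absNorm P)| := by
          refine (Finset.sum_filter_of_ne fun P hP h => ?_).symm
          by_contra hPB
          rw [Finset.mem_union, not_or, Set.Finite.mem_toFinset, Set.mem_ofPred_eq,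
            Ideal.dvd_span_singleton, mem_idealsLE, not_and, not_le] at hPB
          refine h ?_
          rw [sum_primesOverLE_eq hM hα hd hP (hPB.2 (mem_primesLE.1 hP).1) hPB.1, sub_self,
            abs_zero]
      _ ≤ ((primesLE K x).filter (· ∈ B ∪ idealsLE K √x)).card • (2 * Real.log x) :=
          Finset.sum_le_card_nsmul _ _ _ fun P hP =>
            abs_sum_primesOverLE_sub_le_two_mul_log hM d (Finset.mem_filter.1 hP).1
      _ ≤ _ := by
          rw [nsmul_eq_mul]
          have := Real.log_nonneg hx
          gcongr
          calc _ ≤ (((B ∪ idealsLE K √x).card : ℕ) : ℝ) := by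
                refine Nat.cast_le.2 (Finset.card_le_card fun P hP => (Finset.mem_filter.1 hP).2)
            _ ≤ (B.card : ℝ) + (idealsLE K √x).card := by
                exact_mod_cast Finset.card_union_le _ _
            _ ≤ _ := by
                gcongr
                exact hC _ (Real.one_le_sqrt.2 hx)
  have h1 := (tendsto_sum_log_primesLE M).sub (tendsto_sum_log_primesLE K)
  rw [sub_self] at h1
  have h2 : Tendsto (fun x : ℝ => (2 * B.card : ℝ) * (Real.log x / x) + 2 * C * (Real.log x / √x))
      atTop (𝓝 0) := by
    have h3 : Tendsto (fun x : ℝ => Real.log x / x) atTop (𝓝 0) :=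
      Real.isLittleO_log_id_atTop.tendsto_div_nhds_zero
    simpa using (h3.const_mul (2 * B.card : ℝ)).add (tendsto_log_div_sqrt.const_mul (2 * C))
  have h3 : Tendsto (fun x : ℝ => ((∑ Q ∈ primesLE M x, Real.log (Ideal.absNorm Q)) -
      (∑ P ∈ primesLE K x, Real.log (Ideal.absNorm P)) - ∑ P ∈ primesLE K x,
        idealQuadraticChar d P * Real.log (Ideal.absNorm P)) / x) atTop (𝓝 0) := by
    refine squeeze_zero_norm' ?_ h2
    filter_upwards [eventually_ge_atTop 1] with x hx
    have hx0 : 0 < x := by linarith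
    rw [Real.norm_eq_abs, abs_div, abs_of_pos hx0, div_le_iff₀ hx0]
    refine (hbound x hx).trans (le_of_eq ?_)
    have : Real.log x / √x * x = Real.log x * √x := by
      nth_rewrite 3 [← Real.mul_self_sqrt hx0.le]
      have := Real.sqrt_pos.2 hx0
      field_simp
    have h4 := div_mul_cancel₀ (Real.log x) hx0.ne'
    linear_combination (-2 * B.card : ℝ) * h4 - 2 * C * this
  refine (by simpa using h1.sub h3 : Tendsto _ atTop (𝓝 (0 : ℝ))).congr fun x => ?_
  ring

end QuadraticSplitting

section QuadraticGenerators
open scoped IntermediateField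

lemma finrank_adjoin_of_sq_eq {F E : Type*} [Field F] [Field E] [Algebra F E] {β : E} {d : F}
    (hβ : β ^ 2 = algebraMap F E d) (hd : ¬IsSquare d) : Module.finrank F F⟮β⟯ = 2 := by
  have : Irreducible (Polynomial.X ^ 2 - Polynomial.C d) :=
    X_pow_sub_C_irreducible_of_prime Nat.prime_two fun b hb => hd ⟨b, by rw [← hb, sq]⟩
  have hmin : minpoly F β = Polynomial.X ^ 2 - Polynomial.C d :=
    (minpoly.eq_of_irreducible_of_monic this (by simp [hβ])
      (Polynomial.monic_X_pow_sub_C d two_ne_zero)).symm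
  have hintg : IsIntegral F β :=
    ⟨_, Polynomial.monic_X_pow_sub_C d two_ne_zero, by simp [hβ]⟩
  rw [IntermediateField.adjoin.finrank hintg, hmin, Polynomial.natDegree_X_pow_sub_C]

variable {K : Type*} [Field K] [NumberField K]

/-- A quadratic extension is generated by the square root of an algebraic integer. -/
lemma exists_sq_eq_of_finrank_eq_two {M : Type*} [Field M] [Algebra K M]
    (hM : Module.finrank K M = 2) :
    ∃ (α : 𝓞 M) (d : 𝓞 K), α ^ 2 = algebraMap (𝓞 K) (𝓞 M) d ∧ ¬IsSquare (d : K) := by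
  have : FiniteDimensional K M := Module.finite_of_finrank_pos (by omega)
  have hx : ∃ x : M, x ∉ (algebraMap K M).range := by
    by_contra! h
    have : Function.Surjective (algebraMap K M) := fun x => h x
    have := (LinearEquiv.ofBijective (Algebra.linearMap K M)
      ⟨(algebraMap K M).injective, this⟩).finrank_eq
    rw [Module.finrank_self, hM] at this
    omega
  obtain ⟨x, hx⟩ := hx
  have hdeg : (minpoly K x).natDegree = 2 := by
    have hintg := IsIntegral.of_finite K x
    have h1 := minpoly.natDegree_le (A := K) x
    have h2 := minpoly.natDegree_pos hintg
    have h3 : (minpoly K x).natDegree ≠ 1 := fun h => hx (minpoly.natDegree_eq_one_iff.1 h)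
    omega
  have hroot := minpoly.aeval K x
  have hmon := minpoly.monic (IsIntegral.of_finite K x)
  rw [Polynomial.aeval_eq_sum_range, hdeg, Finset.sum_range_succ, Finset.sum_range_succ,
    Finset.sum_range_one, ← hdeg, hmon.coeff_natDegree, hdeg] at hroot
  simp only [Algebra.smul_def, pow_zero, mul_one, pow_one, map_one, one_mul] at hroot
  set b := (minpoly K x).coeff 1
  set c := (minpoly K x).coeff 0
  obtain ⟨m, n, hn, hmn⟩ := IsFractionRing.div_surjective (A := 𝓞 K) (b ^ 2 - 4 * c)
  have hn0 : (n : K) ≠ 0 := by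
    simpa using nonZeroDivisors.ne_zero hn
  set β : M := algebraMap K M n * (2 * x + algebraMap K M b)
  have hβ : β ^ 2 = algebraMap K M ((m * n : 𝓞 K) : K) := by
    have h1 : (m : K) = (b ^ 2 - 4 * c) * n := by
      rw [← hmn, div_mul_cancel₀ _ hn0]
    rw [show ((m * n : 𝓞 K) : K) = (m : K) * n from map_mul _ _ _, h1]
    simp only [β, map_mul, map_sub, map_pow, map_ofNat]
    linear_combination (4 * (algebraMap K M n) ^ 2) * hroot
  have hβint : IsIntegral ℤ β := by
    refine IsIntegral.of_pow (n := 2) two_pos ?_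
    rw [hβ]
    exact (RingOfIntegers.isIntegral_coe _).map ((algebraMap K M).toIntAlgHom)
  refine ⟨⟨β, hβint⟩, m * n, RingOfIntegers.ext hβ, ?_⟩
  rintro ⟨e, he⟩
  have h2 : (β - algebraMap K M e) * (β + algebraMap K M e) = 0 := by
    have : β ^ 2 = algebraMap K M e * algebraMap K M e := by rw [hβ, he, map_mul]
    linear_combination this
  have h3 : ∀ e : K, β ≠ algebraMap K M e := by
    intro e he
    refine hx ⟨(e / n - b) / 2, ?_⟩
    have hn0' : algebraMap K M n ≠ 0 := by simpa using hn0
    rw [map_div₀, map_sub, map_div₀, map_ofNat, ← he]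
    simp only [β]
    have : (2 : M) ≠ 0 := by
      rw [← map_ofNat (algebraMap K M) 2]
      exact (map_ne_zero_iff _ (algebraMap K M).injective).2 two_ne_zero
    field_simp
    ring
  rcases mul_eq_zero.1 h2 with h | h
  · exact h3 e (sub_eq_zero.1 h)
  · exact h3 (-e) (by rw [map_neg]; exact eq_neg_of_add_eq_zero_left h)

theorem tendsto_sum_idealQuadraticChar {d : 𝓞 K} (hd : ¬IsSquare (d : K)) :
    Tendsto (fun x : ℝ => (∑ P ∈ primesLE K x,
      idealQuadraticChar d P * Real.log (Ideal.absNorm P)) / x) atTop (𝓝 0) := by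
  obtain ⟨β, hβ⟩ := IsAlgClosed.exists_pow_nat_eq (algebraMap K (AlgebraicClosure K) d) two_pos
  have hfin := finrank_adjoin_of_sq_eq hβ hd
  have : FiniteDimensional K K⟮β⟯ := Module.finite_of_finrank_pos (by omega)
  have : NumberField K⟮β⟯ := NumberField.of_module_finite K _
  set γ : K⟮β⟯ := IntermediateField.AdjoinSimple.gen K β
  have hγ : γ ^ 2 = algebraMap K K⟮β⟯ d := Subtype.ext hβ
  have hγint : IsIntegral ℤ γ := by
    refine IsIntegral.of_pow (n := 2) two_pos ?_
    rw [hγ]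
    exact (RingOfIntegers.isIntegral_coe _).map ((algebraMap K K⟮β⟯).toIntAlgHom)
  exact tendsto_sum_idealQuadraticChar_aux (α := ⟨γ, hγint⟩) hfin (RingOfIntegers.ext hγ) hd

lemma finrank_iSup_finset_le {F E : Type*} [Field F] [Field E] [Algebra F E] {ι : Type*}
    (L : ι → IntermediateField F E) (hL : ∀ i, Module.finrank F (L i) = 2) (s : Finset ι) :
    Module.finrank F (⨆ i ∈ s, L i : IntermediateField F E) ≤ 2 ^ s.card := by
  classical
  induction s using Finset.induction_on with
  | empty =>
    have : (⨆ i ∈ (∅ : Finset ι), L i) = ⊥ := by simp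
    rw [this, IntermediateField.finrank_bot, Finset.card_empty, pow_zero]
  | insert a s ha ih =>
    rw [Finset.iSup_insert, Finset.card_insert_of_notMem ha, pow_succ']
    exact (IntermediateField.finrank_sup_le _ _).trans (Nat.mul_le_mul (hL a).le ih)

lemma not_isSquare_prod {F E : Type*} [Field F] [Field E] [Algebra F E] {r : ℕ}
    (L : Fin r → IntermediateField F E) (hquad : ∀ i, Module.finrank F (L i) = 2)
    (hcomp : Module.finrank F (⨆ i, L i : IntermediateField F E) = 2 ^ r)
    {β : Fin r → E} (hβL : ∀ i, β i ∈ L i) {d : Fin r → F} (hβ : ∀ i, β i ^ 2 = algebraMap F E (d i))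
    (hd : ∀ i, ¬IsSquare (d i)) {A : Finset (Fin r)} (hA : A.Nonempty) :
    ¬IsSquare (∏ i ∈ A, d i) := by
  classical
  rintro ⟨c, hc⟩
  obtain ⟨j, hj⟩ := hA
  have hadj : ∀ i, F⟮β i⟯ = L i := by
    intro i
    have : FiniteDimensional F (L i) := Module.finite_of_finrank_pos (by rw [hquad]; omega)
    exact IntermediateField.eq_of_le_of_finrank_eq (by simpa using hβL i)
      ((finrank_adjoin_of_sq_eq (hβ i) (hd i)).trans (hquad i).symm)
  set T : IntermediateField F E := ⨆ i ∈ Finset.univ.erase j, L i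
  have hT : ∀ i, i ≠ j → β i ∈ T := fun i hi =>
    (le_iSup₂ (f := fun i (_ : i ∈ Finset.univ.erase j) => L i) i (by simp [hi])) (hβL i)
  have hβ0 : ∀ i, β i ≠ 0 := by
    intro i h
    have h1 := hβ i
    rw [h, zero_pow two_ne_zero, eq_comm, map_eq_zero] at h1
    exact hd i (h1 ▸ IsSquare.zero)
  have hprod : ∏ i ∈ A.erase j, β i ∈ T := prod_mem fun i hi => hT i (Finset.ne_of_mem_erase hi)
  have hprod0 : ∏ i ∈ A.erase j, β i ≠ 0 := Finset.prod_ne_zero_iff.2 fun i _ => hβ0 i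
  have hsq : (β j * ∏ i ∈ A.erase j, β i) ^ 2 = algebraMap F E c ^ 2 := by
    rw [Finset.mul_prod_erase A β hj, ← Finset.prod_pow, Finset.prod_congr rfl fun i _ => hβ i,
      ← map_prod, hc, map_mul, sq]
  have hmem : β j ∈ T := by
    have h1 : β j * ∏ i ∈ A.erase j, β i ∈ T := by
      rcases sq_eq_sq_iff_eq_or_eq_neg.1 hsq with h | h
      · rw [h]; exact T.algebraMap_mem c
      · rw [h]; exact neg_mem (T.algebraMap_mem c)
    rw [eq_div_of_mul_eq (a := β j) hprod0 rfl]
    exact div_mem h1 hprod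
  have htop : (⨆ i, L i) = T := by
    refine le_antisymm (iSup_le fun i => ?_) (iSup₂_le fun i _ => le_iSup L i)
    rw [← hadj, IntermediateField.adjoin_simple_le_iff]
    by_cases hi : i = j
    · rwa [hi]
    · exact hT i hi
  have h1 := finrank_iSup_finset_le L hquad (Finset.univ.erase j)
  rw [show (⨆ i ∈ Finset.univ.erase j, L i) = ⨆ i, L i from htop.symm, hcomp,
    Finset.card_erase_of_mem (Finset.mem_univ j), Finset.card_univ,
    Fintype.card_fin, Nat.pow_le_pow_iff_right (by norm_num)] at h1
  have := j.pos
  omega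

end QuadraticGenerators

section NonsplitPrimes
open scoped Classical

variable {K : Type*} [Field K] [NumberField K]

lemma exists_monoidHom_idealQuadraticChar {P : Ideal (𝓞 K)} (hP : P.IsPrime) (hP0 : P ≠ ⊥) :
    ∃ f : 𝓞 K →* ℝ, ∀ d, idealQuadraticChar d P = f d := by
  have : P.IsMaximal := hP.isMaximal hP0
  let _ := Ideal.Quotient.field P
  have : Finite (𝓞 K ⧸ P) := Ideal.finiteQuotientOfFreeOfNeBot P hP0
  let _ := Fintype.ofFinite (𝓞 K ⧸ P)
  refine ⟨((Int.castRingHom ℝ : ℤ →* ℝ).comp (quadraticChar (𝓞 K ⧸ P)).toMonoidHom).comp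
    (Ideal.Quotient.mk P : 𝓞 K →* 𝓞 K ⧸ P), fun d => ?_⟩
  have h : (∃ a, d - a ^ 2 ∈ P) ↔ IsSquare (Ideal.Quotient.mk P d) := by
    constructor
    · rintro ⟨a, ha⟩
      rw [← Ideal.Quotient.eq_zero_iff_mem, map_sub, map_pow, sub_eq_zero] at ha
      exact ⟨_, ha.trans (sq _)⟩
    · rintro ⟨b, hb⟩
      obtain ⟨a, rfl⟩ := Ideal.Quotient.mk_surjective b
      exact ⟨a, by rw [← Ideal.Quotient.eq_zero_iff_mem, map_sub, map_pow, hb, sq, sub_self]⟩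
  have h2 : (((Int.castRingHom ℝ : ℤ →* ℝ).comp (quadraticChar (𝓞 K ⧸ P)).toMonoidHom).comp
    (Ideal.Quotient.mk P : 𝓞 K →* 𝓞 K ⧸ P)) d =
      ((quadraticCharFun (𝓞 K ⧸ P) (Ideal.Quotient.mk P d) : ℤ) : ℝ) := rfl
  rw [h2, idealQuadraticChar, quadraticCharFun, h]
  simp only [Ideal.Quotient.eq_zero_iff_mem]
  split_ifs <;> simp

lemma exists_map_eq_mul_iff {M : Type*} [Field M] [NumberField M] [Algebra K M]
    (hM : Module.finrank K M = 2) {α : 𝓞 M} {d : 𝓞 K}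
    (hα : α ^ 2 = algebraMap (𝓞 K) (𝓞 M) d) (hd : ¬IsSquare (d : K)) {P : Ideal (𝓞 K)}
    (hP : P.IsPrime) (hP0 : P ≠ ⊥) (h2d : 2 * d ∉ P) :
    (∃ I J : Ideal (𝓞 M), I ≠ J ∧ I.IsPrime ∧ J.IsPrime ∧
      Ideal.map (algebraMap (𝓞 K) (𝓞 M)) P = I * J) ↔ ∃ a, d - a ^ 2 ∈ P := by
  constructor
  · rintro ⟨I, J, -, hI, hJ, h⟩
    by_contra! hsq
    have h1 := absNorm_eq_sq_of_forall_sq_sub_notMem hM hα hP hP0 hsq hI (h ▸ dvd_mul_right _ _)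
    have h2 := absNorm_eq_sq_of_forall_sq_sub_notMem hM hα hP hP0 hsq hJ (h ▸ dvd_mul_left _ _)
    have h3 := absNorm_map_of_finrank_eq_two hM P
    rw [h, map_mul, h1, h2] at h3
    have h4 := two_le_absNorm hP0 hP.ne_top
    nlinarith [pow_pos (by omega : 0 < Ideal.absNorm P) 2]
  · rintro ⟨a, ha⟩
    have h2a : 2 * a ∉ P := by
      intro h
      apply h2d
      have : 2 * d = 2 * (d - a ^ 2) + 2 * a * a := by ring
      rw [this]
      exact add_mem (P.mul_mem_left _ ha) (P.mul_mem_right _ h)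
    obtain ⟨I, J, hIJ, hI, hJ, hmul, -, -⟩ :=
      exists_map_eq_mul_of_sq_sub_mem hM hα hd hP hP0 ha h2a
    exact ⟨I, J, hIJ, hI, hJ, hmul⟩

/-- The primes of norm at most `x` split in no `L i`. -/
def nonsplitLE {r : ℕ} (L : Fin r → IntermediateField K (AlgebraicClosure K)) (x : ℝ) :
    Finset (Ideal (𝓞 K)) :=
  (primesLE K x).filter fun P => ∀ i, ¬SplitsIn K P (L i)

lemma prod_one_sub_idealQuadraticChar {r : ℕ} (d : Fin r → 𝓞 K) {P : Ideal (𝓞 K)}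
    (hP : P.IsPrime) (hP0 : P ≠ ⊥) :
    ∏ i, (1 - idealQuadraticChar (d i) P) =
      ∑ A ∈ Finset.univ.powerset, (-1) ^ A.card * idealQuadraticChar (∏ i ∈ A, d i) P := by
  obtain ⟨f, hf⟩ := exists_monoidHom_idealQuadraticChar hP hP0
  simp only [hf, sub_eq_add_neg, Finset.prod_one_add, map_prod]
  refine Finset.sum_congr rfl fun A _ => ?_
  rw [Finset.prod_neg]

lemma tendsto_sum_prod_one_sub {r : ℕ} {d : Fin r → 𝓞 K}
    (hd : ∀ A : Finset (Fin r), A.Nonempty → ¬IsSquare ((∏ i ∈ A, d i : 𝓞 K) : K)) :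
    Tendsto (fun x : ℝ => (∑ P ∈ primesLE K x, (∏ i, (1 - idealQuadraticChar (d i) P)) *
      Real.log (Ideal.absNorm P)) / x) atTop (𝓝 1) := by
  have h : ∀ A ∈ (Finset.univ : Finset (Fin r)).powerset, Tendsto (fun x : ℝ => (-1) ^ A.card *
      ((∑ P ∈ primesLE K x, idealQuadraticChar (∏ i ∈ A, d i) P *
        Real.log (Ideal.absNorm P)) / x)) atTop (𝓝 (if A = ∅ then 1 else 0)) := by
    intro A _
    split_ifs with hA
    · subst hA
      refine (tendsto_sum_log_primesLE K).congr fun x => ?_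
      rw [Finset.card_empty, pow_zero, one_mul]
      congr 1
      refine Finset.sum_congr rfl fun P hP => ?_
      rw [mem_primesLE] at hP
      obtain ⟨f, hf⟩ := exists_monoidHom_idealQuadraticChar hP.2.2 hP.1
      rw [Finset.prod_empty, hf, map_one, one_mul]
    · simpa using (tendsto_sum_idealQuadraticChar
        (hd A (Finset.nonempty_iff_ne_empty.2 hA))).const_mul ((-1 : ℝ) ^ A.card)
  have h2 := tendsto_finsetSum _ h
  rw [Finset.sum_ite_eq' _ ∅, if_pos (Finset.empty_mem_powerset _)] at h2
  refine h2.congr fun x => ?_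
  simp only [← mul_div_assoc, ← Finset.sum_div, Finset.mul_sum]
  rw [Finset.sum_comm]
  congr 1
  refine Finset.sum_congr rfl fun P hP => ?_
  rw [mem_primesLE] at hP
  rw [prod_one_sub_idealQuadraticChar d hP.2.2 hP.1, Finset.sum_mul]
  simp only [mul_assoc]

/-- The primes that split in no `L i` have density `2⁻ʳ`. -/
theorem tendsto_sum_log_nonsplitLE {r : ℕ} (L : Fin r → IntermediateField K (AlgebraicClosure K))
    (hquad : ∀ i, Module.finrank K (L i) = 2)
    (hcomp : Module.finrank K (⨆ i, L i : IntermediateField K (AlgebraicClosure K)) = 2 ^ r) :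
    Tendsto (fun x : ℝ => (∑ P ∈ nonsplitLE L x, Real.log (Ideal.absNorm P)) / x) atTop
      (𝓝 ((2 ^ r)⁻¹)) := by
  have : ∀ i, FiniteDimensional K (L i) := fun i =>
    Module.finite_of_finrank_pos (by rw [hquad]; omega)
  have : ∀ i, NumberField (L i) := fun i => NumberField.of_module_finite K _
  choose α d hα hd using fun i => exists_sq_eq_of_finrank_eq_two (hquad i)
  have hA : ∀ A : Finset (Fin r), A.Nonempty → ¬IsSquare ((∏ i ∈ A, d i : 𝓞 K) : K) := by
    intro A hA
    have := not_isSquare_prod L hquad hcomp (β := fun i => ((α i : L i) : AlgebraicClosure K))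
      (d := fun i => (d i : K)) (fun i => (α i : L i).2) (fun i => ?_) hd hA
    · rwa [show ((∏ i ∈ A, d i : 𝓞 K) : K) = ∏ i ∈ A, (d i : K) from map_prod (algebraMap (𝓞 K) K) _ _]
    · have := congrArg (fun z : 𝓞 (L i) => ((z : L i) : AlgebraicClosure K)) (hα i)
      exact this
  have h1 := (tendsto_sum_prod_one_sub hA).const_mul ((2 ^ r : ℝ)⁻¹)
  rw [mul_one] at h1
  have h2 : Ideal.span {2 * ∏ i, d i} ≠ 0 := by
    rw [Ne, Ideal.zero_eq_bot, Ideal.span_singleton_eq_bot]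
    refine mul_ne_zero two_ne_zero (Finset.prod_ne_zero_iff.2 fun i _ h => hd i ?_)
    simp [h]
  set B := (finite_setOf_dvd h2).toFinset
  have hB : ∀ P, P ∉ B → ∀ i, 2 * d i ∉ P := by
    intro P hP i h
    rw [Set.Finite.mem_toFinset, Set.mem_ofPred_eq, Ideal.dvd_span_singleton] at hP
    refine hP ?_
    rw [← Finset.mul_prod_erase _ d (Finset.mem_univ i), ← mul_assoc]
    exact P.mul_mem_right _ h
  set g : Ideal (𝓞 K) → ℝ := fun P => (2 ^ r : ℝ)⁻¹ * ∏ i, (1 - idealQuadraticChar (d i) P)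
  have hg : ∀ P : Ideal (𝓞 K), P.IsPrime → P ≠ ⊥ → P ∉ B →
      (if ∀ i, ¬SplitsIn K P (L i) then 1 else 0) = g P := by
    intro P hP hP0 hPB
    have hiff : ∀ i, SplitsIn K P (L i) ↔ ∃ a, d i - a ^ 2 ∈ P := fun i =>
      exists_map_eq_mul_iff (hquad i) (hα i) (hd i) hP hP0 (hB P hPB i)
    have hdP : ∀ i, d i ∉ P := fun i h => hB P hPB i (P.mul_mem_left _ h)
    simp only [g, idealQuadraticChar, if_neg (hdP _), ← hiff]
    split_ifs with h
    · rw [Finset.prod_congr rfl fun i _ => by rw [if_neg (h i)]]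
      rw [Finset.prod_const, Finset.card_univ, Fintype.card_fin]
      norm_num
    · push Not at h
      obtain ⟨i, hi⟩ := h
      rw [Finset.prod_eq_zero (Finset.mem_univ i) (by rw [if_pos hi, sub_self]), mul_zero]
  have h3 : Tendsto (fun x : ℝ => (∑ P ∈ primesLE K x,
      ((if ∀ i, ¬SplitsIn K P (L i) then 1 else 0) - g P) * Real.log (Ideal.absNorm P)) / x)
      atTop (𝓝 0) := by
    refine squeeze_zero_norm' (a := fun x => (∑ P ∈ B,
      |((if ∀ i, ¬SplitsIn K P (L i) then 1 else 0) - g P) * Real.log (Ideal.absNorm P)|) / x)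
      ?_ (tendsto_const_nhds.div_atTop tendsto_id)
    filter_upwards [eventually_gt_atTop 0] with x hx
    rw [Real.norm_eq_abs, abs_div, abs_of_pos hx]
    gcongr
    rw [← Finset.sum_filter_of_ne (p := (· ∈ B))]
    · refine (Finset.abs_sum_le_sum_abs _ _).trans
        (Finset.sum_le_sum_of_subset_of_nonneg ?_ fun _ _ _ => abs_nonneg _)
      exact fun P hP => (Finset.mem_filter.1 hP).2
    · intro P hP h
      rw [mem_primesLE] at hP
      by_contra hPB
      exact h (by rw [hg P hP.2.2 hP.1 hPB, sub_self, zero_mul])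
  have h4 := h3.add h1
  rw [zero_add] at h4
  refine h4.congr fun x => ?_
  rw [← mul_div_assoc, ← add_div, Finset.mul_sum, ← Finset.sum_add_distrib, nonsplitLE,
    Finset.sum_filter]
  congr 1
  refine Finset.sum_congr rfl fun P _ => ?_
  simp only [g]
  split_ifs <;> ring

end NonsplitPrimes

section GeneralizedPrimes
open scoped Classical

/-- A system of generalized primes, with norms at least `2` and finitely many products of
distinct primes of bounded norm. -/
structure GenPrimes (ι : Type*) where
  norm : ι → ℝ
  two_le : ∀ i, 2 ≤ norm i
  primes : ℝ → Finset ι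
  mem_primes : ∀ {x i}, i ∈ primes x ↔ norm i ≤ x
  sqfree : ℝ → Finset (Finset ι)
  mem_sqfree : ∀ {x s}, s ∈ sqfree x ↔ ∏ i ∈ s, norm i ≤ x

namespace GenPrimes

variable {ι : Type*} (G : GenPrimes ι)

/-- The norm of a squarefree product of generalized primes. -/
def prodNorm (s : Finset ι) : ℝ := ∏ i ∈ s, G.norm i

/-- The Chebyshev function of a system of generalized primes. -/
def theta (x : ℝ) : ℝ := ∑ p ∈ G.primes x, Real.log (G.norm p)

/-- The summatory function of the multiplicative function with values `c` at the primes,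
supported on the squarefree elements. -/
def summatory (c : ι → ℝ) (x : ℝ) : ℝ := ∑ s ∈ G.sqfree x, ∏ i ∈ s, c i

variable {G}

lemma mem_sqfree_iff {x : ℝ} {s : Finset ι} : s ∈ G.sqfree x ↔ G.prodNorm s ≤ x := G.mem_sqfree

lemma norm_pos (i : ι) : 0 < G.norm i := two_pos.trans_le (G.two_le i)

lemma log_norm_pos (i : ι) : 0 < Real.log (G.norm i) :=
  Real.log_pos (one_lt_two.trans_le (G.two_le i))

lemma one_le_prodNorm (s : Finset ι) : 1 ≤ G.prodNorm s :=
  Finset.prod_induction _ (1 ≤ ·) (fun _ _ => one_le_mul_of_one_le_of_one_le) le_rfl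
    fun i _ => one_le_two.trans (G.two_le i)

lemma prodNorm_pos (s : Finset ι) : 0 < G.prodNorm s := one_pos.trans_le (one_le_prodNorm s)

lemma prodNorm_erase_mul {s : Finset ι} {p : ι} (hp : p ∈ s) :
    G.prodNorm (s.erase p) * G.norm p = G.prodNorm s :=
  Finset.prod_erase_mul s G.norm hp

lemma norm_le_prodNorm {s : Finset ι} {p : ι} (hp : p ∈ s) : G.norm p ≤ G.prodNorm s := by
  rw [← prodNorm_erase_mul hp]
  exact le_mul_of_one_le_left (norm_pos p).le (one_le_prodNorm _)

lemma log_prodNorm (s : Finset ι) : Real.log (G.prodNorm s) = ∑ p ∈ s, Real.log (G.norm p) :=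
  Real.log_prod fun i _ => (norm_pos i).ne'

lemma sqfree_mono {x y : ℝ} (h : x ≤ y) : G.sqfree x ⊆ G.sqfree y := fun _ hs =>
  mem_sqfree_iff.2 ((mem_sqfree_iff.1 hs).trans h)

lemma primes_mono {x y : ℝ} (h : x ≤ y) : G.primes x ⊆ G.primes y := fun _ hs =>
  G.mem_primes.2 ((G.mem_primes.1 hs).trans h)

lemma summatory_mono {c : ι → ℝ} (hc : ∀ i, 0 ≤ c i) {x y : ℝ} (h : x ≤ y) :
    G.summatory c x ≤ G.summatory c y :=
  Finset.sum_le_sum_of_subset_of_nonneg (sqfree_mono h) fun _ _ _ =>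
    Finset.prod_nonneg fun i _ => hc i

lemma abs_summatory_le (c : ι → ℝ) (x : ℝ) :
    |G.summatory c x| ≤ G.summatory (fun i => |c i|) x := by
  refine (Finset.abs_sum_le_sum_abs _ _).trans (le_of_eq ?_)
  exact Finset.sum_congr rfl fun s _ => Finset.abs_prod s c

lemma sum_filter_mem (c : ι → ℝ) (x : ℝ) (p : ι) :
    ∑ s ∈ G.sqfree x with p ∈ s, ∏ i ∈ s, c i =
      c p * ∑ t ∈ G.sqfree (x / G.norm p) with p ∉ t, ∏ i ∈ t, c i := by
  rw [Finset.mul_sum]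
  refine Finset.sum_bij' (fun s _ => s.erase p) (fun t _ => insert p t) ?_ ?_ ?_ ?_ ?_
  · intro s hs
    simp only [Finset.mem_filter, mem_sqfree_iff] at hs ⊢
    refine ⟨?_, Finset.notMem_erase p s⟩
    rw [le_div_iff₀ (norm_pos p), prodNorm_erase_mul hs.2]
    exact hs.1
  · intro t ht
    simp only [Finset.mem_filter, mem_sqfree_iff] at ht ⊢
    refine ⟨?_, Finset.mem_insert_self p t⟩
    rw [prodNorm, Finset.prod_insert ht.2, mul_comm, ← le_div_iff₀ (norm_pos p)]
    exact ht.1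
  · intro s hs
    exact Finset.insert_erase (Finset.mem_filter.1 hs).2
  · intro t ht
    exact Finset.erase_insert (Finset.mem_filter.1 ht).2
  · intro s hs
    exact (Finset.mul_prod_erase s c (Finset.mem_filter.1 hs).2).symm

lemma sum_mul_log_prodNorm (c : ι → ℝ) (x : ℝ) :
    ∑ s ∈ G.sqfree x, (∏ i ∈ s, c i) * Real.log (G.prodNorm s) =
      ∑ p ∈ G.primes x, Real.log (G.norm p) * ∑ s ∈ G.sqfree x with p ∈ s, ∏ i ∈ s, c i := by
  simp_rw [log_prodNorm, Finset.mul_sum]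
  rw [Finset.sum_comm' (t' := G.primes x) (s' := fun p => (G.sqfree x).filter (p ∈ ·))]
  · simp_rw [mul_comm]
  · intro s p
    simp only [Finset.mem_filter, G.mem_primes, mem_sqfree_iff]
    exact ⟨fun h => ⟨h, (norm_le_prodNorm h.2).trans h.1⟩, fun h => h.1⟩

/-- The convolution identity behind Wirsing's theorem, with the error from repeated primes. -/
lemma abs_sum_mul_log_prodNorm_sub_le (c : ι → ℝ) (x : ℝ) :
    |∑ s ∈ G.sqfree x, (∏ i ∈ s, c i) * Real.log (G.prodNorm s) -
      ∑ t ∈ G.sqfree x, (∏ i ∈ t, c i) *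
        ∑ p ∈ G.primes (x / G.prodNorm t), c p * Real.log (G.norm p)| ≤
      ∑ p ∈ G.primes x, Real.log (G.norm p) *
        (|c p| ^ 2 * G.summatory (fun i => |c i|) (x / G.norm p ^ 2)) := by
  have h1 : ∑ t ∈ G.sqfree x, (∏ i ∈ t, c i) *
        ∑ p ∈ G.primes (x / G.prodNorm t), c p * Real.log (G.norm p) =
      ∑ p ∈ G.primes x, Real.log (G.norm p) *
        (c p * ∑ t ∈ G.sqfree (x / G.norm p), ∏ i ∈ t, c i) := by
    simp_rw [Finset.mul_sum]
    rw [Finset.sum_comm' (t' := G.primes x) (s' := fun p => G.sqfree (x / G.norm p))]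
    · exact Finset.sum_congr rfl fun p _ => Finset.sum_congr rfl fun s _ => by ring
    · intro t p
      simp only [G.mem_primes, mem_sqfree_iff]
      rw [le_div_iff₀ (prodNorm_pos t), le_div_iff₀ (norm_pos p), mul_comm]
      have h2 : G.norm p ≤ G.prodNorm t * G.norm p :=
        le_mul_of_one_le_left (norm_pos p).le (one_le_prodNorm _)
      have h3 : G.prodNorm t ≤ G.prodNorm t * G.norm p :=
        le_mul_of_one_le_right (prodNorm_pos t).le (one_le_two.trans (G.two_le p))
      exact ⟨fun h => ⟨h.2, h2.trans h.2⟩, fun h => ⟨h3.trans h.1, h.1⟩⟩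
  rw [h1, sum_mul_log_prodNorm, ← Finset.sum_sub_distrib]
  refine (Finset.abs_sum_le_sum_abs _ _).trans (Finset.sum_le_sum fun p _ => ?_)
  rw [← mul_sub, abs_mul, abs_of_pos (log_norm_pos p)]
  refine mul_le_mul_of_nonneg_left ?_ (log_norm_pos p).le
  have h4 := Finset.sum_filter_add_sum_filter_not (G.sqfree (x / G.norm p)) (p ∈ ·)
    fun t => ∏ i ∈ t, c i
  rw [sum_filter_mem, ← h4, ← mul_sub, sub_add_cancel_right, sum_filter_mem, abs_mul, abs_neg,
    abs_mul, ← mul_assoc, ← sq, div_div, ← sq]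
  refine mul_le_mul_of_nonneg_left ?_ (sq_nonneg _)
  refine (Finset.abs_sum_le_sum_abs _ _).trans ?_
  simp_rw [Finset.abs_prod]
  exact Finset.sum_le_sum_of_subset_of_nonneg (Finset.filter_subset _ _) fun _ _ _ =>
    Finset.prod_nonneg fun i _ => abs_nonneg _

end GenPrimes
end GeneralizedPrimes

section PartialSummation
open scoped Classical
open MeasureTheory Set

/-- Partial summation with explicit error term: `L` approximates the counting function of the
weights up to `E`, and `M`, `R` are primitives of `L * g`, `E * g`. -/
theorem abs_sum_mul_sub_sub_le {α : Type*} {F : Finset α} {a τ : α → ℝ} {x : ℝ}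
    (hτ : ∀ i ∈ F, 1 ≤ τ i ∧ τ i ≤ x) (hx : 1 ≤ x) {g Φ L M E R : ℝ → ℝ}
    (hg : ContinuousOn g (Icc 1 x)) (hL : ContinuousOn L (Icc 1 x))
    (hE : ContinuousOn E (Icc 1 x)) (hg0 : ∀ u ∈ Icc 1 x, 0 ≤ g u)
    (hΦ : ∀ u ∈ Icc 1 x, HasDerivAt Φ (g u) u) (hM : ∀ u ∈ Icc 1 x, HasDerivAt M (L u * g u) u)
    (hR : ∀ u ∈ Icc 1 x, HasDerivAt R (E u * g u) u)
    (hA : ∀ u ∈ Icc 1 x, |∑ i ∈ F with τ i ≤ u, a i - L u| ≤ E u) :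
    |∑ i ∈ F, a i * (Φ x - Φ (τ i)) - (M x - M 1)| ≤ R x - R 1 := by
  have key : ∀ {f f' : ℝ → ℝ} {c : ℝ}, 1 ≤ c → c ≤ x → ContinuousOn f' (Icc 1 x) →
      (∀ u ∈ Icc 1 x, HasDerivAt f (f' u) u) → ∫ u in Icc c x, f' u = f x - f c := by
    intro f f' c hc hcx hf' hf
    have hsub : Icc c x ⊆ Icc 1 x := Icc_subset_Icc_left hc
    rw [integral_Icc_eq_integral_Ioc, ← intervalIntegral.integral_of_le hcx]
    refine intervalIntegral.integral_eq_sub_of_hasDerivAt (fun u hu => hf u ?_) ?_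
    · rw [uIcc_of_le hcx] at hu
      exact hsub hu
    · exact (hf'.mono (by rwa [uIcc_of_le hcx])).intervalIntegrable
  have hintg : ∀ i ∈ F, IntegrableOn (fun u => (Ici (τ i)).indicator (fun _ => a i) u * g u)
      (Icc 1 x) := by
    intro i _
    have : (fun u => (Ici (τ i)).indicator (fun _ => a i) u * g u) =
        (Ici (τ i)).indicator (fun u => a i * g u) := by
      ext u
      simp only [indicator]
      split_ifs <;> simp
    rw [this]
    exact ((hg.integrableOn_Icc).const_mul (a i)).indicator measurableSet_Ici
  have hsum : ∀ u, ∑ i ∈ F with τ i ≤ u, a i = ∑ i ∈ F, (Ici (τ i)).indicator (fun _ => a i) u := by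
    intro u
    rw [Finset.sum_filter]
    rfl
  have hAg : (fun u => (∑ i ∈ F with τ i ≤ u, a i) * g u) =
      fun u => ∑ i ∈ F, (Ici (τ i)).indicator (fun _ => a i) u * g u := by
    ext u
    rw [hsum, Finset.sum_mul]
  have h1 : ∫ u in Icc 1 x, (∑ i ∈ F with τ i ≤ u, a i) * g u =
      ∑ i ∈ F, a i * (Φ x - Φ (τ i)) := by
    rw [hAg, integral_finsetSum _ hintg]
    refine Finset.sum_congr rfl fun i hi => ?_
    have : (fun u => (Ici (τ i)).indicator (fun _ => a i) u * g u) =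
        (Ici (τ i)).indicator (fun u => a i * g u) := by
      ext u
      simp only [indicator]
      split_ifs <;> simp
    rw [this, setIntegral_indicator measurableSet_Ici, show Icc 1 x ∩ Ici (τ i) = Icc (τ i) x by
        ext u; simp only [mem_inter_iff, mem_Icc, mem_Ici]; have := (hτ i hi).1; grind,
      integral_const_mul, key (hτ i hi).1 (hτ i hi).2 hg hΦ]
  have hAint : IntegrableOn (fun u => (∑ i ∈ F with τ i ≤ u, a i) * g u) (Icc 1 x) := by
    rw [hAg]
    exact integrable_finsetSum _ hintg
  have h2 := key le_rfl hx (hL.mul hg) hM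
  have h3 := key le_rfl hx (hE.mul hg) hR
  rw [← h1, ← h2, ← h3, ← integral_sub hAint (hL.mul hg).integrableOn_Icc]
  rw [← Real.norm_eq_abs]
  refine norm_integral_le_of_norm_le (hE.mul hg).integrableOn_Icc ?_
  refine (ae_restrict_iff' measurableSet_Icc).2 (Eventually.of_forall fun u hu => ?_)
  rw [Pi.mul_apply, Pi.mul_apply, ← sub_mul, Real.norm_eq_abs, abs_mul, abs_of_nonneg (hg0 u hu)]
  exact mul_le_mul_of_nonneg_right (hA u hu) (hg0 u hu)

/-- Logarithmic partial summation. -/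
lemma abs_sum_mul_log_div_le {α : Type*} {F : Finset α} {a τ : α → ℝ} {x : ℝ}
    (hτ : ∀ i ∈ F, 1 ≤ τ i ∧ τ i ≤ x) (hx : 1 ≤ x) {B C : ℝ}
    (hA : ∀ u ∈ Icc 1 x, |∑ i ∈ F with τ i ≤ u, a i| ≤ B + C * u) :
    |∑ i ∈ F, a i * Real.log (x / τ i)| ≤ B * Real.log x + C * (x - 1) := by
  have hne : ∀ u ∈ Icc 1 x, u ≠ 0 := fun u hu => (one_pos.trans_le hu.1).ne'
  have := abs_sum_mul_sub_sub_le hτ hx (g := fun u => u⁻¹) (Φ := Real.log) (L := fun _ => 0)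
    (M := fun _ => 0) (E := fun u => B + C * u) (R := fun u => B * Real.log u + C * u)
    (a := a) (continuousOn_id.inv₀ hne) continuousOn_const (by fun_prop)
    (fun u hu => inv_nonneg.2 (zero_le_one.trans hu.1))
    (fun u hu => Real.hasDerivAt_log (hne u hu)) (fun u _ => by simpa using hasDerivAt_const u _)
    (fun u hu => by
      have := hne u hu
      exact (((Real.hasDerivAt_log this).const_mul B).fun_add
        ((hasDerivAt_id' u).const_mul C)).congr_deriv (by field_simp)) (by simpa using hA)
  simp only [sub_zero, Real.log_one] at this
  convert this using 2
  · exact Finset.sum_congr rfl fun i hi => by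
      rw [Real.log_div (by linarith) (by linarith [(hτ i hi).1])]
  · ring

end PartialSummation

section Mertens
open scoped Classical
open Set
namespace GenPrimes

variable {ι : Type*} {G : GenPrimes ι} {δ : ℝ}

lemma filter_primes {x u : ℝ} (h : u ≤ x) : (G.primes x).filter (G.norm · ≤ u) = G.primes u := by
  ext p
  simp only [Finset.mem_filter, G.mem_primes]
  exact ⟨fun hp => hp.2, fun hp => ⟨hp.trans h, hp⟩⟩

lemma filter_sqfree {x u : ℝ} (h : u ≤ x) :
    (G.sqfree x).filter (G.prodNorm · ≤ u) = G.sqfree u := by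
  ext p
  simp only [Finset.mem_filter, mem_sqfree_iff]
  exact ⟨fun hp => hp.2, fun hp => ⟨hp.trans h, hp⟩⟩

lemma theta_nonneg (x : ℝ) : 0 ≤ G.theta x := Finset.sum_nonneg fun p _ => (log_norm_pos p).le

lemma theta_mono {x y : ℝ} (h : x ≤ y) : G.theta x ≤ G.theta y :=
  Finset.sum_le_sum_of_subset_of_nonneg (primes_mono h) fun p _ _ => (log_norm_pos p).le

lemma exists_abs_theta_sub_le (hθ : Tendsto (fun x => G.theta x / x) atTop (𝓝 δ)) {η : ℝ}
    (hη : 0 < η) : ∃ B, 0 ≤ B ∧ ∀ x, 1 ≤ x → |G.theta x - δ * x| ≤ η * x + B := by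
  obtain ⟨x₀, h₀⟩ := eventually_atTop.1 (hθ.eventually (Metric.ball_mem_nhds δ hη))
  set y := max x₀ 1
  have hy : 1 ≤ y := le_max_right _ _
  refine ⟨G.theta y + |δ| * y, by have := theta_nonneg (G := G) y; positivity, fun x hx => ?_⟩
  rcases le_total y x with h | h
  · have h1 := h₀ x ((le_max_left _ _).trans h)
    rw [Real.dist_eq] at h1
    have hx0 : 0 < x := by linarith
    have h2 : |G.theta x - δ * x| = |G.theta x / x - δ| * x := by
      have : G.theta x - δ * x = (G.theta x / x - δ) * x := by field_simp
      rw [this, abs_mul, abs_of_pos hx0]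
    rw [h2]
    have := theta_nonneg (G := G) y
    have : |G.theta x / x - δ| * x ≤ η * x := by gcongr
    have : 0 ≤ |δ| * y := by positivity
    linarith
  · have h1 : |G.theta x - δ * x| ≤ |G.theta x| + |δ * x| := abs_sub _ _
    rw [abs_of_nonneg (theta_nonneg x), abs_mul, abs_of_pos (by linarith : 0 < x)] at h1
    have := theta_mono (G := G) h
    have : |δ| * x ≤ |δ| * y := by gcongr
    have : 0 ≤ η * x := by positivity
    linarith

/-- Mertens' theorem for generalized primes. -/
lemma exists_abs_sum_log_div_sub_le (hθ : Tendsto (fun x => G.theta x / x) atTop (𝓝 δ)) {η : ℝ}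
    (hη : 0 < η) : ∃ B, 0 ≤ B ∧ ∀ x, 1 ≤ x →
      |∑ p ∈ G.primes x, Real.log (G.norm p) / G.norm p - δ * Real.log x| ≤
        η * Real.log x + B := by
  obtain ⟨B, hB, h⟩ := exists_abs_theta_sub_le hθ hη
  refine ⟨2 * B + |δ| + η, by positivity, fun x hx => ?_⟩
  have hne : ∀ u ∈ Icc 1 x, u ≠ 0 := fun u hu => (one_pos.trans_le hu.1).ne'
  have key := abs_sum_mul_sub_sub_le (F := G.primes x) (τ := G.norm)
    (a := fun p => Real.log (G.norm p))
    (fun i hi => ⟨one_le_two.trans (G.two_le i), G.mem_primes.1 hi⟩) hx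
    (g := fun u => (u ^ 2)⁻¹) (Φ := fun u => -u⁻¹) (L := fun u => δ * u)
    (M := fun u => δ * Real.log u) (E := fun u => η * u + B)
    (R := fun u => η * Real.log u - B * u⁻¹)
    ((by fun_prop : ContinuousOn (fun u : ℝ => u ^ 2) _).inv₀ fun u hu => pow_ne_zero 2 (hne u hu))
    (by fun_prop) (by fun_prop) (fun u _ => by positivity)
    (fun u hu => (hasDerivAt_inv (hne u hu)).fun_neg.congr_deriv (neg_neg _))
    (fun u hu => by
      have := hne u hu
      exact ((Real.hasDerivAt_log this).const_mul δ).congr_deriv (by field_simp))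
    (fun u hu => by
      have := hne u hu
      exact (((Real.hasDerivAt_log this).const_mul η).fun_sub
        ((hasDerivAt_inv this).const_mul B)).congr_deriv (by field_simp; ring))
    (fun u hu => by
      rw [filter_primes hu.2]
      exact h u hu.1)
  have hx0 : 0 < x := by linarith
  have h1 : ∑ p ∈ G.primes x, Real.log (G.norm p) * (-x⁻¹ - -(G.norm p)⁻¹) =
      ∑ p ∈ G.primes x, Real.log (G.norm p) / G.norm p - G.theta x / x := by
    rw [theta, Finset.sum_div, ← Finset.sum_sub_distrib]
    exact Finset.sum_congr rfl fun p _ => by ring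
  rw [h1] at key
  simp only [Real.log_one, mul_zero, sub_zero, inv_one, mul_one, zero_sub] at key
  have h2 : |G.theta x / x| ≤ |δ| + η + B := by
    have h3 : |G.theta x / x - δ| ≤ η + B := by
      have : G.theta x / x - δ = (G.theta x - δ * x) / x := by field_simp
      rw [this, abs_div, abs_of_pos hx0, div_le_iff₀ hx0]
      nlinarith [h x hx]
    have := abs_add_le (G.theta x / x - δ) δ
    rw [sub_add_cancel] at this
    linarith
  have h3 : 0 ≤ B * x⁻¹ := by positivity
  rw [abs_le] at key h2 ⊢
  constructor <;> linarith

lemma exists_sum_log_div_sq_le (hθ : Tendsto (fun x => G.theta x / x) atTop (𝓝 δ)) :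
    ∃ F, 0 ≤ F ∧ ∀ x, ∑ p ∈ G.primes x, Real.log (G.norm p) / G.norm p ^ 2 ≤ F := by
  obtain ⟨B, hB, h⟩ := exists_abs_theta_sub_le hθ one_pos
  set C := |δ| + 1 + B
  have hC0 : 0 ≤ C := by positivity
  have hC : ∀ x, 1 ≤ x → G.theta x ≤ C * x := by
    intro x hx
    have h1 := (abs_le.1 (h x hx)).2
    have h2 : δ * x ≤ |δ| * x := by gcongr; exact le_abs_self δ
    have h3 : B ≤ B * x := le_mul_of_one_le_right hB hx
    simp only [C]
    linarith
  refine ⟨3 * C, by positivity, fun x => ?_⟩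
  rcases lt_or_ge x 1 with hx | hx
  · rw [Finset.sum_eq_zero fun p hp => ?_]
    · positivity
    · linarith [G.mem_primes.1 hp, G.two_le p]
  have hne : ∀ u ∈ Icc 1 x, u ≠ 0 := fun u hu => (one_pos.trans_le hu.1).ne'
  have key := abs_sum_mul_sub_sub_le (F := G.primes x) (τ := G.norm)
    (a := fun p => Real.log (G.norm p))
    (fun i hi => ⟨one_le_two.trans (G.two_le i), G.mem_primes.1 hi⟩) hx
    (g := fun u => 2 * (u ^ 3)⁻¹) (Φ := fun u => -(u ^ 2)⁻¹) (L := fun u => 0)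
    (M := fun u => 0) (E := fun u => C * u)
    (R := fun u => - (2 * C * u⁻¹))
    (continuousOn_const.mul
      ((by fun_prop : ContinuousOn (fun u : ℝ => u ^ 3) _).inv₀ fun u hu =>
        pow_ne_zero 3 (hne u hu)))
    (by fun_prop) (by fun_prop)
    (fun u hu => by have := zero_le_one.trans hu.1; positivity)
    (fun u hu => by
      have := hne u hu
      exact ((hasDerivAt_pow 2 u).fun_inv (pow_ne_zero 2 this)).fun_neg.congr_deriv
        (by field_simp; push_cast; ring))
    (fun u _ => by simpa using hasDerivAt_const u _)
    (fun u hu => by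
      have := hne u hu
      exact ((hasDerivAt_inv this).const_mul (2 * C)).fun_neg.congr_deriv (by field_simp))
    (fun u hu => by
      rw [filter_primes hu.2, sub_zero]
      change |G.theta u| ≤ _
      rw [abs_of_nonneg (theta_nonneg u)]
      exact hC u hu.1)
  have hx0 : 0 < x := by linarith
  have h1 : ∑ p ∈ G.primes x, Real.log (G.norm p) * (-(x ^ 2)⁻¹ - -(G.norm p ^ 2)⁻¹) =
      ∑ p ∈ G.primes x, Real.log (G.norm p) / G.norm p ^ 2 - G.theta x / x ^ 2 := by
    rw [theta, Finset.sum_div, ← Finset.sum_sub_distrib]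
    exact Finset.sum_congr rfl fun p _ => by ring
  rw [h1] at key
  have h2 : G.theta x / x ^ 2 ≤ C := by
    rw [div_le_iff₀ (by positivity)]
    refine (hC x hx).trans ?_
    gcongr
    nlinarith
  have h3 : 0 ≤ 2 * C * x⁻¹ := by positivity
  have := (abs_le.1 key).2
  simp only [inv_one, mul_one, sub_zero] at this
  linarith

end GenPrimes
end Mertens

section Wirsing
open scoped Classical
open Set
namespace GenPrimes

variable {ι : Type*} {G : GenPrimes ι} {δ ε : ℝ}

/-- The sum of `ε ^ |s|` over squarefree products `s` of norm at most `x`. -/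
def signSum (G : GenPrimes ι) (ε x : ℝ) : ℝ := G.summatory (fun _ => ε) x

/-- The sum of `ε ^ |s| / N(s)` over squarefree products `s` of norm at most `x`. -/
def signLogSum (G : GenPrimes ι) (ε x : ℝ) : ℝ := G.summatory (fun i => ε / G.norm i) x

lemma prod_div_norm (ε : ℝ) (s : Finset ι) :
    ∏ i ∈ s, ε / G.norm i = (∏ _i ∈ s, ε) / G.prodNorm s := Finset.prod_div_distrib _ _

lemma signSum_one (x : ℝ) : G.signSum 1 x = (G.sqfree x).card := by
  simp [signSum, summatory]

lemma abs_prod_sign (hε : |ε| = 1) (s : Finset ι) : |∏ _i ∈ s, ε| = 1 := by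
  rw [Finset.abs_prod, hε, Finset.prod_const_one]

lemma sqfree_eq_empty {x : ℝ} (hx : x < 1) : G.sqfree x = ∅ :=
  Finset.eq_empty_of_forall_notMem fun s hs =>
    absurd ((one_le_prodNorm s).trans (mem_sqfree_iff.1 hs)) hx.not_ge

lemma signSum_one_le {C : ℝ} (hC0 : 0 ≤ C) (hC : ∀ x, 1 ≤ x → ((G.sqfree x).card : ℝ) ≤ C * x)
    {x : ℝ} (hx : 0 ≤ x) : G.signSum 1 x ≤ C * x := by
  rw [signSum_one]
  rcases lt_or_ge x 1 with h | h
  · rw [sqfree_eq_empty h]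
    simpa using mul_nonneg hC0 hx
  · exact hC x h

lemma signLogSum_one_nonneg (x : ℝ) : 0 ≤ G.signLogSum 1 x :=
  Finset.sum_nonneg fun _ _ => Finset.prod_nonneg fun i _ => by
    have := norm_pos (G := G) i
    positivity

lemma signLogSum_one_mono {x y : ℝ} (h : x ≤ y) : G.signLogSum 1 x ≤ G.signLogSum 1 y :=
  summatory_mono (fun i => by have := norm_pos (G := G) i; positivity) h

lemma signLogSum_one (x : ℝ) : G.signLogSum 1 x = ∑ s ∈ G.sqfree x, (G.prodNorm s)⁻¹ := by
  simp [signLogSum, summatory, prodNorm]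

lemma abs_sign_div (hε : |ε| = 1) : (fun i => |ε / G.norm i|) = fun i => 1 / G.norm i := by
  ext i
  rw [abs_div, hε, abs_of_pos (norm_pos i)]

lemma abs_signLogSum_le (hε : |ε| = 1) (x : ℝ) : |G.signLogSum ε x| ≤ G.signLogSum 1 x := by
  have := abs_summatory_le (G := G) (fun i => ε / G.norm i) x
  rwa [abs_sign_div hε] at this

lemma exists_abs_log_mul_signSum_sub_le (hθ : Tendsto (fun x => G.theta x / x) atTop (𝓝 δ))
    {C : ℝ} (hC0 : 0 ≤ C) (hC : ∀ x, 1 ≤ x → ((G.sqfree x).card : ℝ) ≤ C * x) (hε : |ε| = 1)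
    {η : ℝ} (hη : 0 < η) : ∃ B, 0 ≤ B ∧ ∀ x, 1 ≤ x →
      |Real.log x * G.signSum ε x - ε * δ * x * G.signLogSum ε x| ≤
        η * x * G.signLogSum 1 x + B * x := by
  obtain ⟨F, hF0, hF⟩ := exists_sum_log_div_sq_le hθ
  obtain ⟨B, hB0, hB⟩ := exists_abs_theta_sub_le hθ hη
  refine ⟨C + B * C + C * F, by positivity, fun x hx => ?_⟩
  have hx0 : 0 < x := one_pos.trans_le hx
  have hle : ∀ s ∈ G.sqfree x, 1 ≤ x / G.prodNorm s := fun s hs => by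
    rw [one_le_div (prodNorm_pos s)]
    exact mem_sqfree_iff.1 hs
  set A := ∑ s ∈ G.sqfree x, (∏ _i ∈ s, ε) * Real.log (G.prodNorm s)
  have h1 : |Real.log x * G.signSum ε x - A| ≤ C * x := by
    have e : Real.log x * G.signSum ε x - A =
        ∑ s ∈ G.sqfree x, (∏ _i ∈ s, ε) * Real.log (x / G.prodNorm s) := by
      simp only [A, signSum, summatory]
      rw [Finset.mul_sum, ← Finset.sum_sub_distrib]
      refine Finset.sum_congr rfl fun s _ => ?_
      rw [Real.log_div hx0.ne' (prodNorm_pos s).ne']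
      ring
    have a := abs_sum_mul_log_div_le (F := G.sqfree x) (a := fun _ => 1) (τ := G.prodNorm)
      (fun s hs => ⟨one_le_prodNorm s, mem_sqfree_iff.1 hs⟩) hx (B := 0) (C := C)
      (fun u hu => by
        rw [filter_sqfree hu.2]
        simpa using hC u hu.1)
    rw [e]
    refine (Finset.abs_sum_le_sum_abs _ _).trans ?_
    have b := (le_abs_self _).trans a
    refine le_trans (le_of_eq ?_) (b.trans (by linarith))
    refine Finset.sum_congr rfl fun s hs => ?_
    rw [abs_mul, abs_prod_sign hε, abs_of_nonneg (Real.log_nonneg (hle s hs))]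
  have h2 := abs_sum_mul_log_prodNorm_sub_le (G := G) (fun _ => ε) x
  have h3 : ∑ p ∈ G.primes x, Real.log (G.norm p) *
      (|ε| ^ 2 * G.summatory (fun _ => |ε|) (x / G.norm p ^ 2)) ≤ C * F * x := by
    rw [hε]
    calc _ ≤ ∑ p ∈ G.primes x, C * x * (Real.log (G.norm p) / G.norm p ^ 2) := by
          refine Finset.sum_le_sum fun p _ => ?_
          have h := signSum_one_le hC0 hC (x := x / G.norm p ^ 2) (by positivity)
          rw [one_pow, one_mul]
          refine (mul_le_mul_of_nonneg_left h (log_norm_pos p).le).trans (le_of_eq ?_)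
          ring
      _ = C * x * ∑ p ∈ G.primes x, Real.log (G.norm p) / G.norm p ^ 2 := by rw [Finset.mul_sum]
      _ ≤ C * x * F := by gcongr; exact hF x
      _ = _ := by ring
  set M := ∑ t ∈ G.sqfree x, (∏ _i ∈ t, ε) *
        ∑ p ∈ G.primes (x / G.prodNorm t), ε * Real.log (G.norm p)
  have h4 : |M - ε * δ * x * G.signLogSum ε x| ≤ η * x * G.signLogSum 1 x + B * C * x := by
    have e : M - ε * δ * x * G.signLogSum ε x = ∑ t ∈ G.sqfree x, (∏ _i ∈ t, ε) *
        (ε * (G.theta (x / G.prodNorm t) - δ * (x / G.prodNorm t))) := by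
      simp only [M, signLogSum, summatory]
      rw [Finset.mul_sum, ← Finset.sum_sub_distrib]
      refine Finset.sum_congr rfl fun s _ => ?_
      rw [prod_div_norm, theta, ← Finset.mul_sum]
      ring
    rw [e]
    refine (Finset.abs_sum_le_sum_abs _ _).trans ?_
    calc _ ≤ ∑ t ∈ G.sqfree x, (η * (x / G.prodNorm t) + B) := by
          refine Finset.sum_le_sum fun s hs => ?_
          rw [abs_mul, abs_prod_sign hε, abs_mul, hε, one_mul, one_mul]
          exact hB _ (hle s hs)
      _ = η * x * G.signLogSum 1 x + B * G.signSum 1 x := by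
          rw [Finset.sum_add_distrib, signLogSum_one, signSum_one, Finset.mul_sum]
          simp only [Finset.sum_const, nsmul_eq_mul]
          rw [mul_comm B]
          congr 1
          exact Finset.sum_congr rfl fun s _ => by ring
      _ ≤ _ := by
          have := mul_le_mul_of_nonneg_left (signSum_one_le hC0 hC hx0.le) hB0
          linarith
  have h5 := h2.trans h3
  rw [abs_le] at h1 h5 h4 ⊢
  constructor <;> linarith

lemma exists_abs_log_mul_signLogSum_sub_le (hθ : Tendsto (fun x => G.theta x / x) atTop (𝓝 δ))
    (hε : |ε| = 1) {η : ℝ} (hη : 0 < η) : ∃ B, 0 ≤ B ∧ ∀ x, 1 ≤ x →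
      |Real.log x * G.signLogSum ε x - (1 + ε * δ) * ∑ s ∈ G.sqfree x,
        (∏ i ∈ s, ε / G.norm i) * Real.log (x / G.prodNorm s)| ≤
        (η * Real.log x + B) * G.signLogSum 1 x := by
  obtain ⟨F, hF0, hF⟩ := exists_sum_log_div_sq_le hθ
  obtain ⟨B, hB0, hB⟩ := exists_abs_sum_log_div_sub_le hθ hη
  refine ⟨B + F, by positivity, fun x hx => ?_⟩
  have hx0 : 0 < x := one_pos.trans_le hx
  have hle : ∀ s ∈ G.sqfree x, 1 ≤ x / G.prodNorm s := fun s hs => by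
    rw [one_le_div (prodNorm_pos s)]
    exact mem_sqfree_iff.1 hs
  set J := ∑ s ∈ G.sqfree x, (∏ i ∈ s, ε / G.norm i) * Real.log (x / G.prodNorm s)
  set A := ∑ s ∈ G.sqfree x, (∏ i ∈ s, ε / G.norm i) * Real.log (G.prodNorm s)
  have h1 : Real.log x * G.signLogSum ε x - A = J := by
    simp only [A, J, signLogSum, summatory]
    rw [Finset.mul_sum, ← Finset.sum_sub_distrib]
    refine Finset.sum_congr rfl fun s _ => ?_
    rw [Real.log_div hx0.ne' (prodNorm_pos s).ne']
    ring
  have h2 := abs_sum_mul_log_prodNorm_sub_le (G := G) (fun i => ε / G.norm i) x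
  have h3 : ∑ p ∈ G.primes x, Real.log (G.norm p) *
      (|ε / G.norm p| ^ 2 * G.summatory (fun i => |ε / G.norm i|) (x / G.norm p ^ 2)) ≤
      F * G.signLogSum 1 x := by
    rw [abs_sign_div hε]
    calc _ ≤ ∑ p ∈ G.primes x, Real.log (G.norm p) / G.norm p ^ 2 * G.signLogSum 1 x := by
          refine Finset.sum_le_sum fun p _ => ?_
          have h : G.signLogSum 1 (x / G.norm p ^ 2) ≤ G.signLogSum 1 x :=
            signLogSum_one_mono (div_le_self hx0.le
              (one_le_pow₀ (one_le_two.trans (G.two_le p))))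
          rw [sq_abs, div_pow, ← sq_abs ε, hε, one_pow, div_mul_eq_mul_div, one_mul,
            div_mul_eq_mul_div, ← mul_div_assoc]
          gcongr
          · exact (log_norm_pos p).le
          · exact h
      _ = (∑ p ∈ G.primes x, Real.log (G.norm p) / G.norm p ^ 2) * G.signLogSum 1 x := by
          rw [Finset.sum_mul]
      _ ≤ _ := mul_le_mul_of_nonneg_right (hF x) (signLogSum_one_nonneg x)
  set M := ∑ t ∈ G.sqfree x, (∏ i ∈ t, ε / G.norm i) *
        ∑ p ∈ G.primes (x / G.prodNorm t), ε / G.norm p * Real.log (G.norm p)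
  have h4 : |M - ε * δ * J| ≤ (η * Real.log x + B) * G.signLogSum 1 x := by
    have e : M - ε * δ * J = ∑ t ∈ G.sqfree x, (∏ i ∈ t, ε / G.norm i) *
        (ε * (∑ p ∈ G.primes (x / G.prodNorm t), Real.log (G.norm p) / G.norm p -
          δ * Real.log (x / G.prodNorm t))) := by
      simp only [M, J]
      rw [Finset.mul_sum, ← Finset.sum_sub_distrib]
      refine Finset.sum_congr rfl fun s _ => ?_
      have : ∑ p ∈ G.primes (x / G.prodNorm s), ε / G.norm p * Real.log (G.norm p) =
          ε * ∑ p ∈ G.primes (x / G.prodNorm s), Real.log (G.norm p) / G.norm p := by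
        rw [Finset.mul_sum]
        exact Finset.sum_congr rfl fun p _ => by ring
      rw [this]
      ring
    rw [e, signLogSum_one, Finset.mul_sum]
    refine (Finset.abs_sum_le_sum_abs _ _).trans (Finset.sum_le_sum fun s hs => ?_)
    rw [abs_mul, prod_div_norm, abs_div, abs_prod_sign hε, abs_of_pos (prodNorm_pos s), one_div,
      abs_mul, hε, one_mul, mul_comm]
    refine mul_le_mul_of_nonneg_right ((hB _ (hle s hs)).trans ?_)
      (inv_nonneg.2 (prodNorm_pos s).le)
    gcongr
    · exact one_pos.trans_le (hle s hs)
    · exact div_le_self hx0.le (one_le_prodNorm s)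
  have h5 := h2.trans h3
  rw [abs_le] at h5 h4 ⊢
  constructor <;> linarith

end GenPrimes
end Wirsing

section WirsingOscillation
open scoped Classical
open Set
namespace GenPrimes

variable {ι : Type*} {G : GenPrimes ι} {δ : ℝ}

lemma tendsto_signLogSum_one (hθ : Tendsto (fun x => G.theta x / x) atTop (𝓝 δ)) (hδ : 0 < δ) :
    Tendsto (G.signLogSum 1) atTop atTop := by
  obtain ⟨B, hB0, hB⟩ := exists_abs_sum_log_div_sub_le hθ (η := δ / 12) (by positivity)
  have step : ∀ x, 1 < x → 8 * B / δ ≤ Real.log x →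
      G.signLogSum 1 x + δ / 4 ≤ G.signLogSum 1 (x ^ 2) := by
    intro x hx hxB
    have hlog : 0 < Real.log x := Real.log_pos hx
    have hxx : x ≤ x ^ 2 := le_self_pow₀ hx.le two_ne_zero
    set D := G.primes (x ^ 2) \ G.primes x
    have h1 : δ / 4 ≤ ∑ p ∈ D, (G.norm p)⁻¹ := by
      have e1 : ∑ p ∈ D, Real.log (G.norm p) / G.norm p ≤
          2 * Real.log x * ∑ p ∈ D, (G.norm p)⁻¹ := by
        rw [Finset.mul_sum]
        refine Finset.sum_le_sum fun p hp => ?_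
        rw [div_eq_mul_inv]
        refine mul_le_mul_of_nonneg_right ?_ (inv_nonneg.2 (norm_pos p).le)
        have := Real.log_le_log (norm_pos p) (G.mem_primes.1 (Finset.mem_sdiff.1 hp).1)
        rwa [Real.log_pow] at this
      have e2 := Finset.sum_sdiff (f := fun p => Real.log (G.norm p) / G.norm p)
        (primes_mono (G := G) hxx)
      have e3 := hB x hx.le
      have e4 := hB (x ^ 2) (hx.le.trans hxx)
      rw [Real.log_pow] at e4
      rw [abs_le] at e3 e4
      rw [div_le_iff₀ hδ] at hxB
      push_cast at e4
      have e5 : δ / 4 * (2 * Real.log x) ≤ 2 * Real.log x * ∑ p ∈ D, (G.norm p)⁻¹ := by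
        simp only [D] at e1 ⊢
        nlinarith
      refine le_of_mul_le_mul_right ?_ (by positivity : 0 < 2 * Real.log x)
      linarith
    have h2 : ∑ p ∈ D, (G.norm p)⁻¹ ≤
        ∑ s ∈ G.sqfree (x ^ 2) \ G.sqfree x, (G.prodNorm s)⁻¹ := by
      have : ∑ p ∈ D, (G.norm p)⁻¹ =
          ∑ s ∈ D.map ⟨fun p => ({p} : Finset ι), Finset.singleton_injective⟩,
            (G.prodNorm s)⁻¹ := by
        simp [prodNorm]
      rw [this]
      refine Finset.sum_le_sum_of_subset_of_nonneg ?_ fun s _ _ => inv_nonneg.2 (prodNorm_pos s).le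
      intro s hs
      obtain ⟨p, hp, rfl⟩ := Finset.mem_map.1 hs
      simpa [D, G.mem_primes, mem_sqfree_iff, prodNorm] using hp
    have h3 := Finset.sum_sdiff (f := fun s => (G.prodNorm s)⁻¹) (sqfree_mono (G := G) hxx)
    rw [signLogSum_one, signLogSum_one]
    linarith
  refine tendsto_atTop_atTop_of_monotone (fun _ _ => signLogSum_one_mono) fun b => ?_
  have key : ∀ n : ℕ, ∃ x, 1 < x ∧ 8 * B / δ ≤ Real.log x ∧ n * (δ / 4) ≤ G.signLogSum 1 x := by
    intro n
    induction n with
    | zero =>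
      refine ⟨Real.exp (8 * B / δ + 1), ?_, ?_, ?_⟩
      · rw [Real.one_lt_exp_iff]
        positivity
      · rw [Real.log_exp]
        linarith
      · simpa using signLogSum_one_nonneg _
    | succ n ih =>
      obtain ⟨x, hx, hxB, h⟩ := ih
      refine ⟨x ^ 2, one_lt_pow₀ hx two_ne_zero, ?_, ?_⟩
      · rw [Real.log_pow]
        push_cast
        linarith [Real.log_pos hx]
      · push_cast
        linarith [step x hx hxB]
  obtain ⟨n, hn⟩ := exists_nat_ge (b / (δ / 4))
  obtain ⟨x, -, -, h⟩ := key n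
  exact ⟨x, ((div_le_iff₀ (by positivity)).1 hn).trans h⟩

lemma exists_abs_signLogSum_neg_one_le_mul (hθ : Tendsto (fun x => G.theta x / x) atTop (𝓝 δ))
    (hδ : 0 < δ) (hδ1 : δ ≤ 1) {c K : ℝ} (hc : 0 < c)
    (h : ∀ x, 1 ≤ x → |G.signLogSum (-1) x| ≤ c * G.signLogSum 1 x + K) :
    ∃ K', ∀ x, 1 ≤ x → |G.signLogSum (-1) x| ≤ (1 - δ / 2) * c * G.signLogSum 1 x + K' := by
  obtain ⟨B, hB0, hB⟩ := exists_abs_log_mul_signLogSum_sub_le (G := G) (ε := -1) hθ (by simp)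
    (η := δ * c / 4) (by positivity)
  set y := Real.exp (B / (δ * c / 4) + 1)
  refine ⟨|K| + G.signLogSum 1 y, fun x hx => ?_⟩
  have hq : 0 ≤ (1 - δ / 2) * c := mul_nonneg (by linarith) hc.le
  have hx0 := signLogSum_one_nonneg (G := G) x
  rcases le_total x y with hxy | hxy
  · have h1 := abs_signLogSum_le (G := G) (ε := -1) (by simp) x
    have h2 := signLogSum_one_mono (G := G) hxy
    have h3 := mul_nonneg hq hx0
    linarith [abs_nonneg K]
  · have hlog : B / (δ * c / 4) + 1 ≤ Real.log x := by
      rw [Real.le_log_iff_exp_le (by linarith)]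
      exact hxy
    have hlog0 : 0 < Real.log x := lt_of_lt_of_le (by positivity) hlog
    have hBlog : B ≤ δ * c / 4 * Real.log x := by
      rw [← div_le_iff₀' (by positivity)]
      linarith
    have hJ := abs_sum_mul_log_div_le (F := G.sqfree x) (a := fun s => ∏ i ∈ s, -1 / G.norm i)
      (τ := G.prodNorm) (fun s hs => ⟨one_le_prodNorm s, mem_sqfree_iff.1 hs⟩) hx
      (B := c * G.signLogSum 1 x + K) (C := 0)
      (fun u hu => by
        rw [filter_sqfree hu.2]
        refine (h u hu.1).trans ?_
        have := mul_le_mul_of_nonneg_left (signLogSum_one_mono (G := G) hu.2) hc.le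
        linarith)
    have h1 := hB x hx
    set J := ∑ s ∈ G.sqfree x, (∏ i ∈ s, -1 / G.norm i) * Real.log (x / G.prodNorm s)
    have h2 : |(1 + -1 * δ) * J| ≤
        (1 - δ) * ((c * G.signLogSum 1 x + |K|) * Real.log x) := by
      rw [abs_mul, abs_of_nonneg (by linarith : 0 ≤ 1 + -1 * δ)]
      have : K * Real.log x ≤ |K| * Real.log x := by gcongr; exact le_abs_self K
      nlinarith [abs_nonneg K]
    have h3 : Real.log x * |G.signLogSum (-1) x| ≤
        Real.log x * ((1 - δ / 2) * c * G.signLogSum 1 x + |K|) := by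
      have e1 := abs_add_le (Real.log x * G.signLogSum (-1) x - (1 + -1 * δ) * J)
        ((1 + -1 * δ) * J)
      rw [sub_add_cancel, abs_mul, abs_of_pos hlog0] at e1
      have e2 : B * G.signLogSum 1 x ≤ δ * c / 4 * Real.log x * G.signLogSum 1 x := by gcongr
      have e3 : 0 ≤ δ * (|K| * Real.log x) := by positivity
      linarith
    have h4 := le_of_mul_le_mul_left h3 hlog0
    linarith [signLogSum_one_nonneg (G := G) y]

lemma exists_abs_signLogSum_neg_one_le (hθ : Tendsto (fun x => G.theta x / x) atTop (𝓝 δ))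
    (hδ : 0 < δ) (hδ1 : δ ≤ 1) {c : ℝ} (hc : 0 < c) :
    ∃ K, ∀ x, 1 ≤ x → |G.signLogSum (-1) x| ≤ c * G.signLogSum 1 x + K := by
  have key : ∀ n : ℕ, ∃ K, ∀ x, 1 ≤ x →
      |G.signLogSum (-1) x| ≤ (1 - δ / 2) ^ n * G.signLogSum 1 x + K := by
    intro n
    induction n with
    | zero => exact ⟨0, fun x _ => by simpa using abs_signLogSum_le (G := G) (ε := -1) (by simp) x⟩
    | succ n ih =>
      obtain ⟨K, hK⟩ := ih
      have := exists_abs_signLogSum_neg_one_le_mul hθ hδ hδ1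
        (pow_pos (by linarith : 0 < 1 - δ / 2) n) hK
      rwa [← pow_succ'] at this
  obtain ⟨n, hn⟩ := exists_pow_lt_of_lt_one hc (by linarith : 1 - δ / 2 < 1)
  obtain ⟨K, hK⟩ := key n
  refine ⟨K, fun x hx => (hK x hx).trans ?_⟩
  have := mul_le_mul_of_nonneg_right hn.le (signLogSum_one_nonneg (G := G) x)
  linarith

/-- Wirsing's theorem for the function `(-1) ^ ω` on the squarefree products of a system of
generalized primes of density `δ`. -/
theorem signSum_neg_one_isLittleO (hθ : Tendsto (fun x => G.theta x / x) atTop (𝓝 δ))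
    (hδ : 0 < δ) (hδ1 : δ ≤ 1) {C : ℝ}
    (hC : ∀ x, 1 ≤ x → ((G.sqfree x).card : ℝ) ≤ C * x) :
    (G.signSum (-1)) =o[atTop] fun x => ((G.sqfree x).card : ℝ) := by
  have hC0 : 0 ≤ C := by simpa using (Nat.cast_nonneg _).trans (hC 1 le_rfl)
  refine isLittleO_iff.2 fun c hc => ?_
  set η := min (δ / 4) (c * δ / 8)
  have hη : 0 < η := by positivity
  obtain ⟨B₁, hB₁0, hB₁⟩ := exists_abs_log_mul_signSum_sub_le (ε := 1) hθ hC0 hC (by simp) hη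
  obtain ⟨B₂, hB₂0, hB₂⟩ := exists_abs_log_mul_signSum_sub_le (ε := -1) hθ hC0 hC (by simp) hη
  obtain ⟨K, hK⟩ := exists_abs_signLogSum_neg_one_le hθ hδ hδ1 hη
  have ht := tendsto_signLogSum_one hθ hδ
  filter_upwards [ht.eventually_ge_atTop ((B₁ + B₂ + |K|) / η), eventually_gt_atTop 1] with x hx hx1
  have hx0 : 0 < x := by linarith
  have hlog := Real.log_pos hx1
  rw [div_le_iff₀ hη] at hx
  have h1 := hB₁ x hx1.le
  have h2 := hB₂ x hx1.le
  have h3 := hK x hx1.le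
  have hη1 : η ≤ δ / 4 := min_le_left _ _
  have hη2 : η ≤ c * δ / 8 := min_le_right _ _
  set m := G.signLogSum 1 x
  have hm : 0 ≤ m := signLogSum_one_nonneg x
  rw [signSum_one] at h1
  set V := ((G.sqfree x).card : ℝ)
  have hηm : η * m ≤ δ / 4 * m := by gcongr
  have hηm2 : η * m ≤ c * δ / 8 * m := by gcongr
  have h4 : x * (δ / 2 * m) ≤ Real.log x * V := by
    have e1 : x * B₁ ≤ x * (m * η) := by gcongr; linarith [abs_nonneg K]
    have e2 : x * (η * m) ≤ x * (δ / 4 * m) := by gcongr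
    have := (abs_le.1 h1).1
    linarith
  have h5 : Real.log x * |G.signSum (-1) x| ≤ x * (c * (δ / 2 * m)) := by
    have e1 := abs_add_le (Real.log x * G.signSum (-1) x - -1 * δ * x * G.signLogSum (-1) x)
        (-1 * δ * x * G.signLogSum (-1) x)
    rw [sub_add_cancel, abs_mul, abs_of_pos hlog] at e1
    have e2 : |-1 * δ * x * G.signLogSum (-1) x| ≤ x * |G.signLogSum (-1) x| := by
      rw [abs_mul, mul_assoc, abs_mul, abs_neg, abs_one, one_mul, abs_of_pos (by positivity)]
      gcongr
      exact mul_le_of_le_one_left hx0.le hδ1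
    have e3 : x * |G.signLogSum (-1) x| ≤ x * (η * m + K) := by gcongr
    have e4 : x * (B₂ + K) ≤ x * (m * η) := by gcongr; linarith [le_abs_self K]
    have e5 : x * (η * m) ≤ x * (c * δ / 8 * m) := by gcongr
    have e6 : 0 ≤ x * (c * δ / 8 * m) := by positivity
    linarith
  rw [Real.norm_eq_abs, Real.norm_of_nonneg (Nat.cast_nonneg _)]
  refine le_of_mul_le_mul_left ?_ hlog
  have := mul_le_mul_of_nonneg_left h4 hc.le
  linarith

end GenPrimes
end WirsingOscillation

section SquarefreeIdeals
open scoped Classical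

variable {K : Type*} [Field K] [NumberField K] {q : Ideal (𝓞 K) → Prop}

variable (q) in
/-- The nonzero prime ideals satisfying `q`. -/
abbrev PrimesWith : Type _ := {P : Ideal (𝓞 K) // P ≠ ⊥ ∧ P.IsPrime ∧ q P}

/-- The product of a finite set of primes. -/
def idealProd (s : Finset (PrimesWith q)) : Ideal (𝓞 K) := ∏ P ∈ s, (P : Ideal (𝓞 K))

omit [NumberField K] in
lemma idealProd_ne_bot (s : Finset (PrimesWith q)) : idealProd s ≠ ⊥ :=
  Finset.prod_ne_zero_iff.2 fun P _ => P.2.1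

lemma dvd_idealProd {Q : Ideal (𝓞 K)} (hQ : Q.IsPrime) {s : Finset (PrimesWith q)} :
    Q ∣ idealProd s ↔ ∃ P ∈ s, (P : Ideal (𝓞 K)) = Q := by
  refine ⟨fun h => ?_, ?_⟩
  · have hQ0 : Q ≠ ⊥ := fun h0 =>
      idealProd_ne_bot s (by rwa [h0, ← Ideal.zero_eq_bot, zero_dvd_iff] at h)
    obtain ⟨P, hP, hPQ⟩ := (Ideal.prime_of_isPrime hQ0 hQ).exists_mem_finset_dvd h
    have : (P : Ideal (𝓞 K)).IsMaximal := P.2.2.1.isMaximal P.2.1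
    exact ⟨P, hP, this.eq_of_le hQ.ne_top (Ideal.le_of_dvd hPQ)⟩
  · rintro ⟨P, hP, rfl⟩
    exact Finset.dvd_prod_of_mem _ hP

lemma idealProd_injective : Function.Injective (idealProd (q := q)) := by
  have key : ∀ (s : Finset (PrimesWith q)) P, P ∈ s ↔ (P : Ideal (𝓞 K)) ∣ idealProd s := by
    intro s P
    rw [dvd_idealProd P.2.2.1]
    exact ⟨fun h => ⟨P, h, rfl⟩, fun ⟨Q, hQ, h⟩ => Subtype.ext h ▸ hQ⟩
  intro s t h
  ext P
  rw [key, key, h]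

lemma absNorm_idealProd (s : Finset (PrimesWith q)) :
    (Ideal.absNorm (idealProd s) : ℝ) = ∏ P ∈ s, (Ideal.absNorm (P : Ideal (𝓞 K)) : ℝ) := by
  rw [idealProd, map_prod, Nat.cast_prod]

variable (q) in
lemma finite_setOf_prod_absNorm_le (x : ℝ) : Set.Finite {s : Finset (PrimesWith q) |
    ∏ P ∈ s, (Ideal.absNorm (P : Ideal (𝓞 K)) : ℝ) ≤ x} := by
  refine Set.Finite.of_finite_image ((idealsLE K x).finite_toSet.subset ?_)
    idealProd_injective.injOn
  rintro _ ⟨s, hs, rfl⟩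
  rw [Finset.mem_coe, mem_idealsLE, absNorm_idealProd]
  exact ⟨idealProd_ne_bot s, hs⟩

variable (q) in
/-- The prime ideals satisfying `q`, as a system of generalized primes. -/
def idealGenPrimes : GenPrimes (PrimesWith q) where
  norm P := Ideal.absNorm (P : Ideal (𝓞 K))
  two_le P := by exact_mod_cast two_le_absNorm P.2.1 P.2.2.1.ne_top
  primes x := (idealsLE K x).subtype _
  mem_primes {x P} := by
    rw [Finset.mem_subtype, mem_idealsLE]
    exact and_iff_right P.2.1
  sqfree x := (finite_setOf_prod_absNorm_le q x).toFinset
  mem_sqfree {x s} := by rw [Set.Finite.mem_toFinset]; rfl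

lemma squarefree_idealProd (s : Finset (PrimesWith q)) : Squarefree (idealProd s) := by
  refine Finset.squarefree_prod_of_pairwise_isCoprime (fun P _ Q _ hPQ => ?_) fun P _ => ?_
  · have hP : (P : Ideal (𝓞 K)).IsMaximal := P.2.2.1.isMaximal P.2.1
    have hQ : (Q : Ideal (𝓞 K)).IsMaximal := Q.2.2.1.isMaximal Q.2.1
    refine IsCoprime.isRelPrime ?_
    rw [Ideal.isCoprime_iff_sup_eq]
    exact hP.coprime_of_ne hQ fun h => hPQ (Subtype.ext h)
  · exact (Ideal.prime_of_isPrime P.2.1 P.2.2.1).squarefree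

lemma exists_idealProd_eq {I : Ideal (𝓞 K)} (hI : Squarefree I) (hI0 : I ≠ ⊥)
    (h : ∀ P : Ideal (𝓞 K), P.IsPrime → P ∣ I → q P) :
    ∃ s : Finset (PrimesWith q), idealProd s = I := by
  have hmem : ∀ P ∈ (UniqueFactorizationMonoid.normalizedFactors I).toFinset,
      P ≠ ⊥ ∧ P.IsPrime ∧ q P := by
    intro P hP
    rw [Multiset.mem_toFinset] at hP
    have hp := UniqueFactorizationMonoid.prime_of_normalized_factor P hP
    have hP1 := Ideal.isPrime_of_prime hp
    exact ⟨hp.ne_zero, hP1, h P hP1 (UniqueFactorizationMonoid.dvd_of_mem_normalizedFactors hP)⟩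
  refine ⟨(UniqueFactorizationMonoid.normalizedFactors I).toFinset.subtype _, ?_⟩
  rw [idealProd, Finset.prod_subtype_of_mem (fun P => P) hmem, Finset.prod_eq_multiset_prod,
    Multiset.map_id', Multiset.toFinset_val, Multiset.dedup_eq_self.2
      ((UniqueFactorizationMonoid.squarefree_iff_nodup_normalizedFactors hI0).1 hI)]
  exact Ideal.prod_normalizedFactors_eq_self hI0

lemma setOf_squarefree_eq (y : ℝ) : {I : Ideal (𝓞 K) | Squarefree I ∧ I ≠ ⊥ ∧
      (∀ P : Ideal (𝓞 K), P.IsPrime → P ∣ I → q P) ∧ (Ideal.absNorm I : ℝ) ≤ y} =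
    (((idealGenPrimes q).sqfree y).image idealProd : Finset (Ideal (𝓞 K))) := by
  ext I
  rw [Finset.mem_coe, Finset.mem_image, Set.mem_ofPred_eq]
  constructor
  · rintro ⟨h1, h2, h3, h4⟩
    obtain ⟨s, rfl⟩ := exists_idealProd_eq h1 h2 h3
    rw [absNorm_idealProd] at h4
    exact ⟨s, (idealGenPrimes q).mem_sqfree.2 h4, rfl⟩
  · rintro ⟨s, hs, rfl⟩
    refine ⟨squarefree_idealProd s, idealProd_ne_bot s, fun P hP hPs => ?_, ?_⟩
    · obtain ⟨Q, -, rfl⟩ := (dvd_idealProd hP).1 hPs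
      exact Q.2.2.2
    · rw [absNorm_idealProd]
      exact (idealGenPrimes q).mem_sqfree.1 hs

lemma omegaI_idealProd (s : Finset (PrimesWith q)) : omegaI K (idealProd s) = s.card := by
  have : {P : Ideal (𝓞 K) | P.IsPrime ∧ P ∣ idealProd s} =
      (s.map (Function.Embedding.subtype _) : Finset (Ideal (𝓞 K))) := by
    ext P
    rw [Finset.mem_coe, Finset.mem_map]
    constructor
    · rintro ⟨h1, h2⟩
      exact (dvd_idealProd h1).1 h2
    · rintro ⟨Q, hQ, rfl⟩
      exact ⟨Q.2.2.1, (dvd_idealProd Q.2.2.1).2 ⟨Q, hQ, rfl⟩⟩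
  rw [← Finset.card_map (Function.Embedding.subtype _), ← Set.ncard_coe_finset, ← this]
  rfl

lemma card_sqfree_idealGenPrimes_le (x : ℝ) :
    ((idealGenPrimes q).sqfree x).card ≤ (idealsLE K x).card := by
  refine Finset.card_le_card_of_injOn idealProd (fun s hs => ?_) idealProd_injective.injOn
  rw [Finset.mem_coe, mem_idealsLE, absNorm_idealProd]
  exact ⟨idealProd_ne_bot s, (idealGenPrimes q).mem_sqfree.1 hs⟩

lemma finsum_squarefree_eq (y : ℝ) : ∑ᶠ I ∈ {I : Ideal (𝓞 K) | Squarefree I ∧ I ≠ ⊥ ∧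
      (∀ P : Ideal (𝓞 K), P.IsPrime → P ∣ I → q P) ∧ (Ideal.absNorm I : ℝ) ≤ y},
        (-1 : ℝ) ^ omegaI K I = (idealGenPrimes q).signSum (-1) y := by
  rw [setOf_squarefree_eq, finsum_mem_coe_finset, Finset.sum_image idealProd_injective.injOn]
  simp [omegaI_idealProd, GenPrimes.signSum, GenPrimes.summatory]

lemma card_squarefree_eq (y : ℝ) : Nat.card {I : Ideal (𝓞 K) // Squarefree I ∧ I ≠ ⊥ ∧
      (∀ P : Ideal (𝓞 K), P.IsPrime → P ∣ I → q P) ∧ (Ideal.absNorm I : ℝ) ≤ y} =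
    ((idealGenPrimes q).sqfree y).card := by
  rw [← Finset.card_image_of_injective _ idealProd_injective, ← Set.ncard_coe_finset,
    ← setOf_squarefree_eq]
  rfl

lemma theta_idealGenPrimes_nonsplit {r : ℕ} (L : Fin r → IntermediateField K (AlgebraicClosure K))
    (x : ℝ) : (idealGenPrimes fun P => ∀ i, ¬SplitsIn K P (L i)).theta x =
      ∑ P ∈ nonsplitLE L x, Real.log (Ideal.absNorm P) := by
  refine Finset.sum_bij (fun P _ => (P : Ideal (𝓞 K))) ?_ ?_ ?_ ?_
  · intro P hP
    rw [nonsplitLE, Finset.mem_filter, mem_primesLE]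
    exact ⟨⟨P.2.1, (GenPrimes.mem_primes _).1 hP, P.2.2.1⟩, P.2.2.2⟩
  · intro P _ Q _ h
    exact Subtype.ext h
  · intro P hP
    rw [nonsplitLE, Finset.mem_filter, mem_primesLE] at hP
    exact ⟨⟨P, hP.1.1, hP.1.2.2, hP.2⟩, (GenPrimes.mem_primes _).2 hP.1.2.1, rfl⟩
  · intro P _
    rfl

end SquarefreeIdeals

/-- **Oscillation estimate** (equation (eq:smallerthan) of the paper, via Wirsing's
theorem).  Let `L 0, …, L (r-1)` be quadratic extensions of `k` whose compositum has
degree `2^r` over `k`; call a finite prime of `k` nonsplit if it splits in no `L i`.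
Then `∑ (-1)^{ω(I)} = o(#{I})` as `y → ∞`, where both the sum and the count range over
squarefree nonzero ideals `I` of `O_k` with `N(I) ≤ y` all of whose prime divisors are
nonsplit. -/
theorem sum_neg_one_pow_omega_isLittleO
    (r : ℕ) (L : Fin r → IntermediateField k (AlgebraicClosure k))
    (hquad : ∀ i, Module.finrank k (L i) = 2)
    (hcomp : Module.finrank k (⨆ i, L i : IntermediateField k (AlgebraicClosure k))
      = 2 ^ r) :
    (fun y : ℝ =>
        ∑ᶠ I ∈ {I : Ideal (𝓞 k) |
            Squarefree I ∧ I ≠ ⊥ ∧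
            (∀ P : Ideal (𝓞 k), P.IsPrime → P ∣ I → ∀ i, ¬ SplitsIn k P (L i)) ∧
            (Ideal.absNorm I : ℝ) ≤ y},
          ((-1 : ℝ)) ^ (omegaI k I))
      =o[atTop]
    (fun y : ℝ =>
        (Nat.card {I : Ideal (𝓞 k) //
            Squarefree I ∧ I ≠ ⊥ ∧
            (∀ P : Ideal (𝓞 k), P.IsPrime → P ∣ I → ∀ i, ¬ SplitsIn k P (L i)) ∧
            (Ideal.absNorm I : ℝ) ≤ y} : ℝ)) := by
  obtain ⟨C, -, hC⟩ := exists_card_idealsLE_le k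
  have hθ := tendsto_sum_log_nonsplitLE L hquad hcomp
  simp_rw [← theta_idealGenPrimes_nonsplit] at hθ
  have h := GenPrimes.signSum_neg_one_isLittleO hθ (by positivity)
    (inv_le_one_of_one_le₀ (one_le_pow₀ one_le_two)) (C := C) fun x hx =>
      le_trans (by exact_mod_cast card_sqfree_idealGenPrimes_le x) (hC x hx)
  refine h.congr (fun y => ?_) fun y => ?_
  · exact (finsum_squarefree_eq y).symm
  · exact congrArg Nat.cast (card_squarefree_eq y).symm

end
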